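/- arXiv:1709.03154 — 2 statements merged into one kernel-verified Lean document; each statement's English description precedes it below -/
import Mathlib

section
/- Let P ∈ P_d and let (P_n) be a sequence of probability measures on ℝ^d with finite first moment such that d₁(P_n, P) → 0, where d₁ is the Mallows (Wasserstein-1) distance. Then sup_{φ∈Φ} L(φ, P_n) → sup_{φ∈Φ} L(φ, P), P_n ∈ P_d for all sufficiently large n, and, taking α₀ > 0 and β₀ ∈ ℝ such that ψ*(P)(x) ≤ exp(−α₀‖x‖ + β₀) for all x, we have for every α < α₀ that ∫_{ℝ^d} e^{α‖x‖} |ψ*(P_n)(x) − ψ*(P)(x)| dx → 0 as n → ∞. -/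
open MeasureTheory Filter Set
open scoped ENNReal Topology

noncomputable section

/-- `ℝ^d` with its Euclidean norm and Lebesgue measure. -/
abbrev Rd (d : ℕ) : Type := EuclideanSpace ℝ (Fin d)

/-- A nonnegative function is log-concave (`log f` is concave, with `log 0 := -∞`),
expressed multiplicatively via `f x ^ (1-t) * f y ^ t ≤ f ((1-t) • x + t • y)`. -/
def IsLogConcaveFn {E : Type*} [AddCommGroup E] [Module ℝ E] (f : E → ℝ) : Prop :=
  (∀ x, 0 ≤ f x) ∧
  ∀ x y : E, ∀ t : ℝ, t ∈ Set.Icc (0:ℝ) 1 →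
    f x ^ (1 - t) * f y ^ t ≤ f ((1 - t) • x + t • y)

/-- A probability density with respect to the (Lebesgue) measure of a `MeasureSpace`. -/
def IsDensity {E : Type*} [MeasureSpace E] (f : E → ℝ) : Prop :=
  (∀ x, 0 ≤ f x) ∧ Measurable f ∧ ∫⁻ x, ENNReal.ofReal (f x) = 1

/-- Membership in the class `F_d`: an upper semi-continuous log-concave probability
density. -/
def IsLCDensity {E : Type*} [MeasureSpace E] [TopologicalSpace E] [AddCommGroup E]
    [Module ℝ E] (f : E → ℝ) : Prop :=
  IsDensity f ∧ UpperSemicontinuous f ∧ IsLogConcaveFn f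

/-- Membership in the class `P_d`: probability measures with finite first moment that are
not concentrated on any affine hyperplane `{x | l x = c}` (`l` a nonzero linear
functional). -/
def MemP {E : Type*} [NormedAddCommGroup E] [NormedSpace ℝ E] [MeasureSpace E]
    (P : Measure E) : Prop :=
  IsProbabilityMeasure P ∧ Integrable (fun x => ‖x‖) P ∧
  ∀ (l : E →ₗ[ℝ] ℝ) (c : ℝ), l ≠ 0 → P {x | l x = c} < 1

/-- The log-concave projection predicate: `fs ∈ F_d` maximises `∫ log f dP` over `F_d`
(candidates whose objective is `-∞`, i.e. that vanish on a set of positive `P`-measure or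
have non-integrable logarithm, are trivially dominated). -/
def IsLCProj {E : Type*} [NormedAddCommGroup E] [NormedSpace ℝ E] [MeasureSpace E]
    (P : Measure E) (fs : E → ℝ) : Prop :=
  IsLCDensity fs ∧ (∀ᵐ x ∂P, 0 < fs x) ∧ Integrable (fun x => Real.log (fs x)) P ∧
  ∀ g : E → ℝ, IsLCDensity g → (∀ᵐ x ∂P, 0 < g x) →
    Integrable (fun x => Real.log (g x)) P →
    ∫ x, Real.log (g x) ∂P ≤ ∫ x, Real.log (fs x) ∂P

/-- `log y` with values in `[-∞, ∞)`, with the convention `log 0 := -∞`. -/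
def elog (y : ℝ) : EReal := if y ≤ 0 then ⊥ else ((Real.log y : ℝ) : EReal)

/-- Positive part of an extended real number, as an `ℝ≥0∞`. -/
def epos (a : EReal) : ℝ≥0∞ := if a = ⊤ then ⊤ else ENNReal.ofReal a.toReal

/-- `e^a` for an extended real `a`, valued in `[0,∞]`. -/
def expE (a : EReal) : ℝ≥0∞ :=
  if a = ⊥ then 0 else if a = ⊤ then ⊤ else ENNReal.ofReal (Real.exp a.toReal)

/-- Integral of an `EReal`-valued function: positive part minus negative part. -/
def erealIntegral {α : Type*} [MeasurableSpace α] (P : Measure α) (φ : α → EReal) : EReal :=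
  ((∫⁻ x, epos (φ x) ∂P : ℝ≥0∞) : EReal) - ((∫⁻ x, epos (-(φ x)) ∂P : ℝ≥0∞) : EReal)

/-- The class `Φ`: upper semi-continuous, concave functions `φ : E → [-∞, ∞)` with
`φ(x) → -∞` as `‖x‖ → ∞`. -/
def MemPhi {E : Type*} [NormedAddCommGroup E] [NormedSpace ℝ E] (φ : E → EReal) : Prop :=
  (∀ x, φ x ≠ ⊤) ∧ UpperSemicontinuous φ ∧
  (∀ x y : E, ∀ t : ℝ, t ∈ Set.Icc (0:ℝ) 1 →
    (((1 - t : ℝ)) : EReal) * φ x + ((t : ℝ) : EReal) * φ y ≤ φ ((1 - t) • x + t • y)) ∧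
  Tendsto φ (Filter.comap (fun x => ‖x‖) Filter.atTop) (nhds ⊥)

/-- The functional `L(φ, P) = ∫ φ dP - ∫ e^φ dx`. -/
def Lfun {E : Type*} [NormedAddCommGroup E] [NormedSpace ℝ E] [MeasureSpace E]
    (φ : E → EReal) (P : Measure E) : EReal :=
  erealIntegral P φ - ((∫⁻ x, expE (φ x) : ℝ≥0∞) : EReal)

/-- `L*(P) = sup_{φ ∈ Φ} L(φ, P)`. -/
def Lstar {E : Type*} [NormedAddCommGroup E] [NormedSpace ℝ E] [MeasureSpace E]
    (P : Measure E) : EReal :=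
  ⨆ (φ : E → EReal) (_ : MemPhi φ), Lfun φ P

/-- Action of a matrix on a Euclidean vector. -/
def mulVE {m d : ℕ} (A : Matrix (Fin m) (Fin d) ℝ) (x : Rd d) : Rd m :=
  (WithLp.equiv 2 (Fin m → ℝ)).symm (A.mulVec ((WithLp.equiv 2 (Fin d → ℝ)) x))

/-- The Mallows (Wasserstein-1) distance between two measures, as the infimum of
`E‖X - Y‖` over couplings. -/
def mallows1 {E : Type*} [NormedAddCommGroup E] [MeasurableSpace E]
    (P Q : Measure E) : ℝ≥0∞ :=
  ⨅ (μ : Measure (E × E)) (_ : μ.map Prod.fst = P ∧ μ.map Prod.snd = Q),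
    ∫⁻ p, (‖p.1 - p.2‖₊ : ℝ≥0∞) ∂μ

lemma ball_subset_of_forall_dist_lt {E : Type*} [NormedAddCommGroup E] [InnerProductSpace ℝ E]
    [CompleteSpace E] {s D : Set E} {c : E} {r : ℝ}
    (hD : Convex ℝ D) (hDc : IsClosed D) (hs : Metric.ball c (2 * r) ⊆ convexHull ℝ s)
    (hsD : ∀ x ∈ s, ∃ y ∈ D, dist x y < r) : Metric.ball c r ⊆ D := by
  have hsub : Metric.ball c (2 * r) ⊆ Metric.thickening r D :=
    hs.trans (convexHull_min (fun x hx => Metric.mem_thickening_iff.2 (hsD x hx))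
      (hD.thickening r))
  intro z hz
  by_contra hzD
  obtain ⟨f, u, hfu, huz⟩ := geometric_hahn_banach_closed_point hD hDc hzD
  set v := (InnerProductSpace.toDual ℝ E).symm f with hv
  have hfv : ∀ x, f x = inner ℝ v x := fun x => by
    rw [hv, InnerProductSpace.toDual_symm_apply]
  have hr : 0 < r := dist_nonneg.trans_lt hz
  have hz' : z + (r / ‖v‖) • v ∈ Metric.ball c (2 * r) := by
    have h1 : ‖(r / ‖v‖) • v‖ ≤ r := by
      rw [norm_smul, Real.norm_of_nonneg (by positivity)]
      by_cases h0 : ‖v‖ = 0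
      · simp [h0, hr.le]
      · rw [div_mul_cancel₀ _ h0]
    rw [mem_ball_iff_norm] at hz ⊢
    have h2 : z + (r / ‖v‖) • v - c = (z - c) + (r / ‖v‖) • v := by abel
    rw [h2]
    linarith [norm_add_le (z - c) ((r / ‖v‖) • v)]
  obtain ⟨y, hyD, hy⟩ := Metric.mem_thickening_iff.1 (hsub hz')
  have hyz : f y < f z := (hfu y hyD).trans huz
  have hv0 : 0 < ‖v‖ := by
    rw [norm_pos_iff]
    intro h0
    simp [hfv, h0] at hyz
  have h3 : f (z + (r / ‖v‖) • v) = f z + r * ‖v‖ := by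
    rw [map_add, map_smul, hfv v, real_inner_self_eq_norm_sq, smul_eq_mul]
    field_simp
  have h4 : f (z + (r / ‖v‖) • v) - f y ≤ ‖v‖ * r := by
    rw [← map_sub, hfv]
    refine (real_inner_le_norm _ _).trans ?_
    rw [dist_eq_norm] at hy
    gcongr
  nlinarith

lemma integrable_of_lipschitzWith {E : Type*} [NormedAddCommGroup E] [MeasurableSpace E]
    [BorelSpace E] [SecondCountableTopology E] {Q : Measure E} [IsFiniteMeasure Q]
    (hQ : Integrable (fun x => ‖x‖) Q) {ψ : E → ℝ} {L : NNReal} (hψ : LipschitzWith L ψ) :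
    Integrable ψ Q := by
  refine Integrable.mono' ((integrable_const |ψ 0|).add (hQ.const_mul (L : ℝ)))
    hψ.continuous.aestronglyMeasurable (ae_of_all _ fun x => ?_)
  have h := hψ.dist_le_mul x 0
  rw [Real.dist_eq, dist_zero_right] at h
  have h2 := abs_sub_abs_le_abs_sub (ψ x) (ψ 0)
  simp only [Pi.add_apply, Real.norm_eq_abs]
  linarith

lemma integral_sub_le_of_mallows1_lt {E : Type*} [NormedAddCommGroup E] [MeasurableSpace E]
    [BorelSpace E] [SecondCountableTopology E] {P Q : Measure E} [IsProbabilityMeasure P]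
    [IsProbabilityMeasure Q] (hP : Integrable (fun x => ‖x‖) P)
    (hQ : Integrable (fun x => ‖x‖) Q) {δ : ℝ} (hδ : mallows1 Q P < ENNReal.ofReal δ)
    {ψ : E → ℝ} {L : NNReal} (hψ : LipschitzWith L ψ) :
    |∫ x, ψ x ∂Q - ∫ x, ψ x ∂P| ≤ L * δ := by
  obtain ⟨μ, hμ⟩ := iInf_lt_iff.1 hδ
  obtain ⟨⟨h1, h2⟩, hlt⟩ := iInf_lt_iff.1 hμ
  have hδ0 : 0 < δ := by
    rw [← ENNReal.ofReal_pos]; exact bot_le.trans_lt hδ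
  have i1 : Integrable (fun p : E × E => ψ p.1) μ := by
    have := integrable_of_lipschitzWith hQ hψ
    rw [← h1] at this
    exact this.comp_measurable measurable_fst
  have i2 : Integrable (fun p : E × E => ψ p.2) μ := by
    have := integrable_of_lipschitzWith hP hψ
    rw [← h2] at this
    exact this.comp_measurable measurable_snd
  have e1 : ∫ x, ψ x ∂Q = ∫ p, ψ p.1 ∂μ := by
    rw [← h1, integral_map measurable_fst.aemeasurable hψ.continuous.aestronglyMeasurable]
  have e2 : ∫ x, ψ x ∂P = ∫ p, ψ p.2 ∂μ := by
    rw [← h2, integral_map measurable_snd.aemeasurable hψ.continuous.aestronglyMeasurable]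
  rw [e1, e2, ← integral_sub i1 i2, ← Real.norm_eq_abs]
  refine (norm_integral_le_lintegral_norm _).trans ?_
  refine ENNReal.toReal_le_of_le_ofReal (by positivity) ?_
  calc ∫⁻ p, ENNReal.ofReal ‖ψ p.1 - ψ p.2‖ ∂μ
      ≤ ∫⁻ p, (L : ℝ≥0∞) * (‖p.1 - p.2‖₊ : ℝ≥0∞) ∂μ := by
        refine lintegral_mono fun p => ?_
        have h := hψ.nndist_le p.1 p.2
        rw [nndist_eq_nnnorm, nndist_eq_nnnorm] at h
        rw [ofReal_norm, enorm_eq_nnnorm, ← ENNReal.coe_mul]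
        exact ENNReal.coe_le_coe.2 h
    _ ≤ (L : ℝ≥0∞) * ENNReal.ofReal δ := by
        rw [lintegral_const_mul' _ _ ENNReal.coe_ne_top]
        gcongr
    _ = ENNReal.ofReal (L * δ) := by
        rw [ENNReal.ofReal_mul (by positivity), ENNReal.ofReal_coe_nnreal]

lemma exists_linearMap_eq_const_of_affineSpan_ne_top {E : Type*} [AddCommGroup E] [Module ℝ E]
    {S : Set E} (hS : S.Nonempty) (h : affineSpan ℝ S ≠ ⊤) :
    ∃ (l : E →ₗ[ℝ] ℝ) (c : ℝ), l ≠ 0 ∧ S ⊆ {x | l x = c} := by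
  obtain ⟨x₀, hx₀⟩ := hS
  have hlt : (affineSpan ℝ S).direction < ⊤ := by
    rw [lt_top_iff_ne_top]
    intro h'
    exact h ((AffineSubspace.direction_eq_top_iff_of_nonempty
      ⟨x₀, subset_affineSpan ℝ S hx₀⟩).1 h')
  obtain ⟨l, hl0, hl⟩ := Submodule.exists_le_ker_of_lt_top _ hlt
  refine ⟨l, l x₀, hl0, fun x hx => ?_⟩
  have : x -ᵥ x₀ ∈ (affineSpan ℝ S).direction :=
    AffineSubspace.vsub_mem_direction (subset_affineSpan ℝ S hx) (subset_affineSpan ℝ S hx₀)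
  have := hl this
  rw [LinearMap.mem_ker, vsub_eq_sub, map_sub, sub_eq_zero] at this
  exact this

/-- A piecewise linear bump supported on the closed ball of radius `r` around `x`. -/
def hat {E : Type*} [NormedAddCommGroup E] (x : E) (r : ℝ) (y : E) : ℝ :=
  max 0 (r - dist y x)

lemma lipschitzWith_hat {E : Type*} [NormedAddCommGroup E] (x : E) (r : ℝ) :
    LipschitzWith 1 (hat x r) := by
  refine LipschitzWith.of_le_add_mul 1 fun y z => ?_
  simp only [hat, NNReal.coe_one, one_mul]
  refine max_le (by positivity) ?_
  linarith [le_max_right 0 (r - dist z x), dist_triangle z y x, dist_comm z y]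

/-- The mass of `Q` near each of finitely many points `s`, whose convex hull contains a ball of
radius `2 * r` around `c`, is at least `η`. -/
def SpreadOn {E : Type*} [NormedAddCommGroup E] [NormedSpace ℝ E] [MeasurableSpace E]
    (s : Finset E) (c : E) (r η : ℝ) (Q : Measure E) : Prop :=
  Metric.ball c (2 * r) ⊆ convexHull ℝ (s : Set E) ∧ ∀ x ∈ s, η ≤ Q.real (Metric.ball x r)

lemma exists_finset_hat {d : ℕ} {P : Measure (Rd d)} (hP : MemP P) :
    ∃ (s : Finset (Rd d)) (c : Rd d) (r : ℝ), 0 < r ∧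
      Metric.ball c (2 * r) ⊆ convexHull ℝ (s : Set (Rd d)) ∧
      ∀ x ∈ s, 0 < ∫ y, hat x r y ∂P := by
  obtain ⟨hprob, hmom, hhyp⟩ := hP
  have hsupp : P P.supportᶜ = 0 := Measure.measure_compl_support
  have hne : P.support.Nonempty := by
    rw [Set.nonempty_iff_ne_empty]
    intro h
    rw [h, compl_empty, measure_univ] at hsupp
    exact one_ne_zero hsupp
  have hspan : affineSpan ℝ P.support = ⊤ := by
    by_contra h
    obtain ⟨l, c, hl0, hl⟩ := exists_linearMap_eq_const_of_affineSpan_ne_top hne h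
    refine (hhyp l c hl0).not_ge ?_
    calc 1 = P P.support := by
          rw [(prob_compl_eq_zero_iff Measure.isClosed_support.measurableSet).1 hsupp]
      _ ≤ _ := measure_mono hl
  obtain ⟨t, hts, b, hb⟩ := AffineBasis.exists_affine_subbasis hspan
  have hfin : t.Finite := by
    have := b.finite_set
    exact this
  have htop : affineSpan ℝ t = ⊤ := by
    have := b.tot
    rw [hb, Subtype.range_coe] at this
    exact this
  obtain ⟨c, hc⟩ := interior_convexHull_nonempty_iff_affineSpan_eq_top.2 htop
  obtain ⟨ε, hε, hball⟩ := Metric.isOpen_iff.1 isOpen_interior c hc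
  refine ⟨hfin.toFinset, c, ε / 2, by positivity, ?_, fun x hx => ?_⟩
  · rw [hfin.coe_toFinset, mul_div_cancel₀ _ two_ne_zero]
    exact hball.trans interior_subset
  · have hx' : x ∈ P.support := hts (hfin.mem_toFinset.1 hx)
    rw [integral_pos_iff_support_of_nonneg (f := hat x (ε / 2)) (fun y => le_max_left _ _)
      (integrable_of_lipschitzWith hmom (lipschitzWith_hat _ _))]
    refine ((Measure.mem_support_iff_forall x).1 hx' _
      (Metric.ball_mem_nhds x (half_pos hε))).trans_le (measure_mono fun y hy => ?_)
    rw [Function.mem_support]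
    have : 0 < ε / 2 - dist y x := sub_pos.2 hy
    exact (lt_max_of_lt_right this).ne'

lemma integral_hat_le {E : Type*} [NormedAddCommGroup E] [MeasurableSpace E] [BorelSpace E]
    {Q : Measure E} [IsProbabilityMeasure Q] (x : E) {r : ℝ} (hr : 0 < r) :
    ∫ y, hat x r y ∂Q ≤ r * Q.real (Metric.ball x r) := by
  have : ∫ y, (Metric.ball x r).indicator (fun _ => r) y ∂Q = r * Q.real (Metric.ball x r) := by
    rw [integral_indicator Metric.isOpen_ball.measurableSet, setIntegral_const, smul_eq_mul,
      mul_comm]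
  rw [← this]
  refine integral_mono_of_nonneg (ae_of_all _ fun y => le_max_left _ _)
    ((integrable_const r).indicator Metric.isOpen_ball.measurableSet) (ae_of_all _ fun y => ?_)
  by_cases hy : y ∈ Metric.ball x r
  · simp only [hat, indicator_of_mem hy]
    exact max_le hr.le (by linarith [dist_nonneg (x := y) (y := x)])
  · simp only [hat, indicator_of_notMem hy]
    rw [Metric.mem_ball, not_lt] at hy
    exact max_le le_rfl (by linarith)

/-- A measure in `P_d` and all measures sufficiently close to it in Mallows distance are
uniformly spread out. -/
lemma exists_spreadOn {d : ℕ} {P : Measure (Rd d)} (hP : MemP P)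
    {Pn : ℕ → Measure (Rd d)} (hprob : ∀ n, IsProbabilityMeasure (Pn n))
    (hmom : ∀ n, Integrable (fun x => ‖x‖) (Pn n))
    (hconv : Tendsto (fun n => mallows1 (Pn n) P) atTop (nhds 0)) :
    ∃ (s : Finset (Rd d)) (c : Rd d) (r η : ℝ), 0 < r ∧ 0 < η ∧ SpreadOn s c r η P ∧
      ∀ᶠ n in atTop, SpreadOn s c r η (Pn n) := by
  obtain ⟨s, c, r, hr, hball, hs⟩ := exists_finset_hat hP
  have := hP.1
  obtain ⟨η, hη, hηs⟩ : ∃ η : ℝ, 0 < η ∧ ∀ x ∈ s, η < ∫ y, hat x r y ∂P := by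
    clear hball
    induction s using Finset.induction_on with
    | empty => exact ⟨1, one_pos, by simp⟩
    | insert a s _ ih =>
      obtain ⟨η, hη, h⟩ := ih fun x hx => hs x (Finset.mem_insert_of_mem hx)
      have ha := hs a (Finset.mem_insert_self _ _)
      refine ⟨min η ((∫ y, hat a r y ∂P) / 2), by positivity, fun x hx => ?_⟩
      rcases Finset.mem_insert.1 hx with rfl | hx
      · exact (min_le_right _ _).trans_lt (half_lt_self ha)
      · exact (min_le_left _ _).trans_lt (h x hx)
  refine ⟨s, c, r, η / (2 * r), hr, by positivity, ⟨hball, fun x hx => ?_⟩, ?_⟩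
  · rw [div_le_iff₀ (by positivity)]
    linarith [hηs x hx, integral_hat_le (Q := P) x hr]
  · have hev : ∀ᶠ n in atTop, mallows1 (Pn n) P < ENNReal.ofReal (η / 2) :=
      hconv.eventually_lt_const (ENNReal.ofReal_pos.2 (by positivity))
    filter_upwards [hev] with n hn
    have := hprob n
    refine ⟨hball, fun x hx => ?_⟩
    have h1 := abs_le.1 (integral_sub_le_of_mallows1_lt hP.2.1 (hmom n) hn
      (lipschitzWith_hat x r))
    rw [div_le_iff₀ (by positivity)]
    have h2 := integral_hat_le (Q := Pn n) x hr
    simp only [NNReal.coe_one, one_mul] at h1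
    linarith [hηs x hx]

lemma SpreadOn.ball_subset {d : ℕ} {s : Finset (Rd d)} {c : Rd d} {r η : ℝ}
    {Q : Measure (Rd d)} [IsProbabilityMeasure Q] (h : SpreadOn s c r η Q) {D : Set (Rd d)}
    (hD : Convex ℝ D) (hDc : IsClosed D) (hQ : 1 - η < Q.real D) : Metric.ball c r ⊆ D := by
  refine ball_subset_of_forall_dist_lt hD hDc h.1 fun x hx => ?_
  by_contra! hcon
  have hdisj : Disjoint D (Metric.ball x r) := by
    rw [Set.disjoint_left]
    intro y hy hyx
    have := hcon y hy
    rw [dist_comm] at this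
    exact this.not_gt hyx
  have h1 := measureReal_union (μ := Q) hdisj Metric.isOpen_ball.measurableSet
  have h2 : Q.real (D ∪ Metric.ball x r) ≤ 1 := measureReal_le_one
  linarith [h.2 x hx]

lemma SpreadOn.memP {d : ℕ} {s : Finset (Rd d)} {c : Rd d} {r η : ℝ} (hr : 0 < r) (hη : 0 < η)
    {Q : Measure (Rd d)} [hQ : IsProbabilityMeasure Q] (hmom : Integrable (fun x => ‖x‖) Q)
    (h : SpreadOn s c r η Q) : MemP Q := by
  refine ⟨hQ, hmom, fun l a hl => ?_⟩
  by_contra! hcon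
  have hQ1 : Q {x | l x = a} = 1 := le_antisymm prob_le_one hcon
  have hball : Metric.ball c r ⊆ {x | l x = a} := by
    refine h.ball_subset ?_ ?_ ?_
    · exact convex_hyperplane l.isLinear a
    · exact isClosed_eq l.continuous_of_finiteDimensional continuous_const
    · rw [measureReal_def, hQ1]; simp [hη]
  refine hl (LinearMap.ext fun v => ?_)
  by_cases hv : v = 0
  · simp [hv]
  have hv' : 0 < ‖v‖ := norm_pos_iff.2 hv
  have h1 : l c = a := hball (Metric.mem_ball_self hr)
  have h2 : l (c + (r / (2 * ‖v‖)) • v) = a := by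
    refine hball ?_
    rw [mem_ball_iff_norm, add_sub_cancel_left, norm_smul, Real.norm_of_nonneg (by positivity)]
    have : r / (2 * ‖v‖) * ‖v‖ = r / 2 := by field_simp
    linarith
  rw [map_add, map_smul, h1, smul_eq_mul, add_eq_left] at h2
  simpa [hr.ne', hv] using h2

section LogConcave

variable {d : ℕ} {f : Rd d → ℝ} {c : Rd d} {k r I : ℝ}

lemma IsLogConcaveFn.convex_superlevel (hf : IsLogConcaveFn f) (hk : 0 < k) :
    Convex ℝ {x | k ≤ f x} := by
  intro x hx y hy a b ha hb hab
  obtain rfl : a = 1 - b := by linarith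
  calc k = k ^ (1 - b) * k ^ b := by
        rw [← Real.rpow_add hk, sub_add_cancel, Real.rpow_one]
    _ ≤ f x ^ (1 - b) * f y ^ b := by
        have hx' : k ≤ f x := hx
        have hy' : k ≤ f y := hy
        gcongr
        exact Real.rpow_nonneg (hf.1 x) _
    _ ≤ _ := hf.2 x y b ⟨hb, by linarith⟩

lemma mul_measureReal_le_integral (hf0 : ∀ x, 0 ≤ f x) (hi : Integrable f)
    {S : Set (Rd d)} (hS : MeasurableSet S) (hS' : volume S ≠ ∞) (h : ∀ x ∈ S, k ≤ f x) :
    k * volume.real S ≤ ∫ x, f x := by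
  calc k * volume.real S = ∫ _ in S, k := by rw [setIntegral_const, smul_eq_mul, mul_comm]
    _ ≤ ∫ x in S, f x :=
        setIntegral_mono_on (integrableOn_const hS') hi.integrableOn hS h
    _ ≤ ∫ x, f x := setIntegral_le_integral hi (ae_of_all _ hf0)

lemma IsLogConcaveFn.rpow_mul_le_of_mem_ball (hf : IsLogConcaveFn f) (hk : 0 < k)
    (hball : ∀ x ∈ Metric.ball c r, k ≤ f x) {t : ℝ} (ht0 : 0 ≤ t) (ht1 : t < 1) (x : Rd d)
    {z : Rd d} (hz : z ∈ Metric.ball (c + t • (x - c)) ((1 - t) * r)) :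
    k ^ (1 - t) * f x ^ t ≤ f z := by
  have ht : 0 < 1 - t := by linarith
  set w := c + (1 - t)⁻¹ • (z - (c + t • (x - c))) with hw
  have hwb : w ∈ Metric.ball c r := by
    rw [mem_ball_iff_norm] at hz ⊢
    rw [hw, add_sub_cancel_left, norm_smul, Real.norm_of_nonneg (by positivity),
      inv_mul_lt_iff₀ ht]
    exact hz
  have hzw : (1 - t) • w + t • x = z := by
    rw [hw, smul_add, smul_inv_smul₀ ht.ne']
    module
  calc k ^ (1 - t) * f x ^ t ≤ f w ^ (1 - t) * f x ^ t := by
        have := hball w hwb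
        have := Real.rpow_nonneg (hf.1 x) t
        gcongr
    _ ≤ f z := hzw ▸ hf.2 w x t ⟨ht0, ht1.le⟩

lemma volume_real_ball (x : Rd d) (r : ℝ) :
    volume.real (Metric.ball x r) = volume.real (Metric.ball (0 : Rd d) r) := by
  rw [measureReal_def, measureReal_def, Measure.addHaar_ball_center]

lemma volume_real_ball_pos (x : Rd d) (hr : 0 < r) : 0 < volume.real (Metric.ball x r) :=
  ENNReal.toReal_pos (Metric.measure_ball_pos _ _ hr).ne' measure_ball_lt_top.ne

lemma IsLogConcaveFn.rpow_mul_volume_le (hf : IsLogConcaveFn f) (hi : Integrable f) (hk : 0 < k)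
    (hball : ∀ x ∈ Metric.ball c r, k ≤ f x) {t : ℝ} (ht0 : 0 ≤ t) (ht1 : t < 1) (x : Rd d) :
    k ^ (1 - t) * f x ^ t * volume.real (Metric.ball (0 : Rd d) ((1 - t) * r)) ≤ ∫ x, f x := by
  rw [← volume_real_ball (c + t • (x - c))]
  exact mul_measureReal_le_integral hf.1 hi Metric.isOpen_ball.measurableSet
    measure_ball_lt_top.ne fun z hz => hf.rpow_mul_le_of_mem_ball hk hball ht0 ht1 x hz

/-- A log-concave function with bounded integral that is at least `k` on a fixed ball is at most
`k / e` far away from it. -/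
lemma exists_radius_le_of_integral_le (c : Rd d) (hk : 0 < k) (hr : 0 < r) (I : ℝ) :
    ∃ R : ℝ, 0 < R ∧ ∀ f : Rd d → ℝ, IsLogConcaveFn f → Integrable f → ∫ x, f x ≤ I →
      (∀ x ∈ Metric.ball c r, k ≤ f x) → ∀ x, R ≤ ‖x - c‖ → f x ≤ k * Real.exp (-1) := by
  set k' := k * Real.exp (-1) with hk'
  have hk'0 : 0 < k' := by positivity
  have hk'k : k' ≤ k := by
    have : Real.exp (-1) ≤ 1 := Real.exp_le_one_iff.2 (by norm_num)
    nlinarith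
  set v := volume.real (Metric.ball (0 : Rd d) (r / 2)) with hv
  have hv0 : 0 < v := volume_real_ball_pos _ (by positivity)
  obtain ⟨N, hN⟩ := exists_nat_gt (max 1 (I / (k' * v)))
  have hN1 : (1 : ℝ) < N := (le_max_left _ _).trans_lt hN
  have hNI : I < k' * (N * v) := by
    have := (le_max_right _ _).trans_lt hN
    rw [div_lt_iff₀ (by positivity)] at this
    linarith
  refine ⟨2 * N * r, by positivity, fun f hf hi hI hball x hx => ?_⟩
  by_contra! hcon
  set ctr : ℕ → Rd d := fun j => c + ((j : ℝ) / (2 * N)) • (x - c) with hctr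
  have hdisj : Set.PairwiseDisjoint (Finset.range N : Set ℕ)
      (fun j => Metric.ball (ctr j) (r / 2)) := by
    intro i _ j _ hij
    refine Metric.ball_disjoint_ball ?_
    rw [dist_eq_norm, hctr]
    simp only [add_sub_add_left_eq_sub, ← sub_smul, norm_smul, ← sub_div]
    rw [Real.norm_eq_abs, abs_div, abs_of_pos (show (0 : ℝ) < 2 * N by positivity)]
    have hij' : (1 : ℝ) ≤ |(i : ℝ) - j| := by
      have : (1 : ℤ) ≤ |(i : ℤ) - j| := Int.one_le_abs (by omega)
      exact_mod_cast this
    rw [div_mul_eq_mul_div, le_div_iff₀ (by positivity)]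
    nlinarith [norm_nonneg (x - c)]
  have hvol : volume.real (⋃ j ∈ Finset.range N, Metric.ball (ctr j) (r / 2)) = N * v := by
    rw [measureReal_biUnion_finset hdisj (fun j _ => Metric.isOpen_ball.measurableSet)
      (fun j _ => measure_ball_lt_top.ne)]
    simp [volume_real_ball (ctr _), hv]
  have := mul_measureReal_le_integral (k := k') hf.1 hi
    (S := ⋃ j ∈ Finset.range N, Metric.ball (ctr j) (r / 2))
    (Finset.measurableSet_biUnion _ fun j _ => Metric.isOpen_ball.measurableSet)
    ((measure_biUnion_lt_top (Finset.finite_toSet _) fun j _ => measure_ball_lt_top).ne) (by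
      intro z hz
      simp only [mem_iUnion, Finset.mem_range] at hz
      obtain ⟨j, hj, hz⟩ := hz
      have hjN : (j : ℝ) < N := by exact_mod_cast hj
      have ht0 : (0 : ℝ) ≤ (j : ℝ) / (2 * N) := by positivity
      have ht1 : (j : ℝ) / (2 * N) < 1 / 2 := by
        rw [div_lt_iff₀ (by positivity)]; linarith
      refine le_trans ?_ (hf.rpow_mul_le_of_mem_ball hk hball ht0 (by linarith) x
        (Metric.ball_subset_ball ?_ hz))
      · have h1 : 0 ≤ 1 - (j : ℝ) / (2 * N) := by linarith
        calc k' = k' ^ (1 - (j : ℝ) / (2 * N)) * k' ^ ((j : ℝ) / (2 * N)) := by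
              rw [← Real.rpow_add hk'0, sub_add_cancel, Real.rpow_one]
          _ ≤ _ := by gcongr
      · nlinarith)
  rw [hvol] at this
  linarith

/-- Moving along a ray out of `c`, a log-concave function that drops by a factor at distance `R`
continues to decay exponentially. -/
lemma IsLogConcaveFn.le_of_le_on_sphere (hf : IsLogConcaveFn f) (hk : 0 < k) (hc : k ≤ f c)
    {R m : ℝ} (hR : 0 < R) (hm : ∀ x, ‖x - c‖ = R → f x ≤ k * Real.exp (-m)) {x : Rd d}
    (hx : R ≤ ‖x - c‖) : f x ≤ k * Real.exp (-(m * (‖x - c‖ / R))) := by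
  have hx0 : 0 < ‖x - c‖ := hR.trans_le hx
  set s := R / ‖x - c‖ with hs
  have hs0 : 0 < s := by positivity
  have hs1 : s ≤ 1 := (div_le_one hx0).2 hx
  have h1 := hm ((1 - s) • c + s • x) (by
    have : (1 - s) • c + s • x - c = s • (x - c) := by module
    rw [this, norm_smul, Real.norm_of_nonneg hs0.le, hs, div_mul_cancel₀ _ hx0.ne'])
  have h2 := hf.2 c x s ⟨hs0.le, hs1⟩
  have h3 : k ^ (1 - s) * f x ^ s ≤ k * Real.exp (-m) := by
    refine le_trans ?_ (h2.trans h1)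
    have := Real.rpow_nonneg (hf.1 x) s
    have : 0 ≤ 1 - s := by linarith
    gcongr
  have h4 : f x ^ s ≤ (k * Real.exp (-(m * (‖x - c‖ / R)))) ^ s := by
    rw [Real.mul_rpow hk.le (Real.exp_pos _).le, ← Real.exp_mul]
    have h5 : -(m * (‖x - c‖ / R)) * s = -m := by rw [hs]; field_simp
    rw [h5]
    have h6 : k = k ^ (1 - s) * k ^ s := by
      rw [← Real.rpow_add hk, sub_add_cancel, Real.rpow_one]
    have h7 : k ^ (1 - s) * f x ^ s ≤ k ^ (1 - s) * (k ^ s * Real.exp (-m)) := by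
      rw [← mul_assoc, ← h6]; exact h3
    exact le_of_mul_le_mul_left h7 (by positivity)
  exact (Real.rpow_le_rpow_iff (hf.1 x) (by positivity) hs0).1 h4

lemma IsLogConcaveFn.le_of_ball (hf : IsLogConcaveFn f) (hi : Integrable f) (hI : ∫ x, f x ≤ I)
    (hk : 0 < k) (hr : 0 < r) (hball : ∀ x ∈ Metric.ball c r, k ≤ f x) (x : Rd d) :
    f x ≤ (I / volume.real (Metric.ball (0 : Rd d) (r / 2))) ^ 2 / k := by
  have h := hf.rpow_mul_volume_le hi hk hball (t := 1 / 2) (by norm_num) (by norm_num) x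
  have hv := volume_real_ball_pos (0 : Rd d) (half_pos hr)
  have e : (1 - 1 / 2) * r = r / 2 := by ring
  rw [e] at h
  have h1 : k ^ (1 - 1 / 2 : ℝ) * f x ^ (1 / 2 : ℝ) ≤
      I / volume.real (Metric.ball (0 : Rd d) (r / 2)) := by
    rw [le_div_iff₀ hv]; exact h.trans hI
  have h2 : (1 - 1 / 2 : ℝ) = 1 / 2 := by norm_num
  rw [h2, ← Real.sqrt_eq_rpow, ← Real.sqrt_eq_rpow, ← Real.sqrt_mul hk.le] at h1
  rw [le_div_iff₀ hk, mul_comm]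
  have h3 := hf.1 x
  rw [← Real.sq_sqrt (mul_nonneg hk.le h3)]
  gcongr

/-- Uniform exponential decay of log-concave functions with bounded integral that are bounded
below on a fixed ball. -/
lemma exists_exp_decay (c : Rd d) (hk : 0 < k) (hr : 0 < r) (I : ℝ) :
    ∃ a b : ℝ, 0 < a ∧ ∀ f : Rd d → ℝ, IsLogConcaveFn f → Integrable f → ∫ x, f x ≤ I →
      (∀ x ∈ Metric.ball c r, k ≤ f x) → ∀ x, f x ≤ Real.exp (b - a * ‖x‖) := by
  obtain ⟨R, hR, hfar⟩ := exists_radius_le_of_integral_le c hk hr I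
  set M := (I / volume.real (Metric.ball (0 : Rd d) (r / 2))) ^ 2 / k with hM
  have hM0 : 0 ≤ M := by positivity
  set B := max k (M * Real.exp 1) with hB
  have hB0 : 0 < B := lt_max_of_lt_left hk
  refine ⟨1 / R, Real.log B + ‖c‖ / R, by positivity, fun f hf hi hI hball x => ?_⟩
  have key : f x ≤ B * Real.exp (-(‖x - c‖ / R)) := by
    rcases le_total R ‖x - c‖ with hx | hx
    · have := hf.le_of_le_on_sphere hk (hball c (Metric.mem_ball_self hr)) hR (m := 1)
        (fun y hy => hfar f hf hi hI hball y hy.ge) hx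
      rw [one_mul] at this
      refine this.trans ?_
      gcongr
      exact le_max_left _ _
    · refine (hf.le_of_ball hi hI hk hr hball x).trans ?_
      rw [← hM]
      have h1 : ‖x - c‖ / R ≤ 1 := (div_le_one hR).2 hx
      calc M = M * Real.exp 1 * Real.exp (-1) := by
            rw [mul_assoc, ← Real.exp_add]; simp
        _ ≤ B * Real.exp (-(‖x - c‖ / R)) := by
            gcongr
            exact le_max_right _ _
  refine key.trans ?_
  rw [← Real.exp_log hB0, ← Real.exp_add, Real.log_exp]
  refine Real.exp_le_exp.2 ?_
  have h2 : ‖x‖ / R ≤ ‖x - c‖ / R + ‖c‖ / R := by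
    rw [← add_div]
    gcongr
    linarith [norm_sub_norm_le x c]
  linarith [one_div_mul_eq_div R ‖x‖]

end LogConcave

lemma integrable_exp_sub_mul_norm {d : ℕ} {a : ℝ} (ha : 0 < a) (b : ℝ) :
    Integrable (fun x : Rd d => Real.exp (b - a * ‖x‖)) := by
  set n := Module.finrank ℝ (Rd d) + 1 with hn
  have h1 : Integrable (fun x : Rd d => (1 + ‖x‖) ^ (-(n : ℝ))) :=
    integrable_one_add_norm (by rw [hn]; push_cast; linarith)
  refine (h1.const_mul (Real.exp (b + a) * (n.factorial / a ^ n))).mono'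
    (by fun_prop) (ae_of_all _ fun x => ?_)
  rw [Real.norm_of_nonneg (Real.exp_pos _).le]
  have hx : 0 < 1 + ‖x‖ := by positivity
  have h2 := Real.pow_div_factorial_le_exp (x := a * (1 + ‖x‖)) (by positivity) n
  have e : Real.exp (b - a * ‖x‖) = Real.exp (b + a) * Real.exp (-(a * (1 + ‖x‖))) := by
    rw [← Real.exp_add]; congr 1; ring
  rw [e, mul_assoc, Real.exp_neg, Real.rpow_neg hx.le, Real.rpow_natCast]
  gcongr
  rw [inv_le_comm₀ (by positivity) (by positivity)]
  refine le_trans (le_of_eq ?_) h2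
  rw [mul_pow]
  field_simp

section UniformBall

variable {d : ℕ} {f : Rd d → ℝ} {s : Finset (Rd d)} {c : Rd d} {r η : ℝ} {Q : Measure (Rd d)}

lemma SpreadOn.le_of_measureReal [IsProbabilityMeasure Q] (h : SpreadOn s c r η Q)
    (hf : IsLogConcaveFn f) (hu : UpperSemicontinuous f) {k : ℝ} (hk : 0 < k)
    (hQ : 1 - η < Q.real {x | k ≤ f x}) : ∀ x ∈ Metric.ball c r, k ≤ f x :=
  h.ball_subset (hf.convex_superlevel hk) (hu.isClosed_preimage k) hQ

lemma exists_exp_neg_nat_superlevel [IsProbabilityMeasure Q] (hη : 0 < η)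
    (hu : UpperSemicontinuous f) (hpos : ∀ᵐ x ∂Q, 0 < f x) :
    ∃ n : ℕ, 1 - η < Q.real {x | Real.exp (-(n : ℝ)) ≤ f x} := by
  have hmono : Monotone fun n : ℕ => {x | Real.exp (-(n : ℝ)) ≤ f x} := by
    intro m n hmn x hx
    have hx : Real.exp (-(m : ℝ)) ≤ f x := hx
    refine le_trans (Real.exp_le_exp.2 ?_) hx
    have : (m : ℝ) ≤ n := by exact_mod_cast hmn
    linarith
  have hU : (⋃ n : ℕ, {x | Real.exp (-(n : ℝ)) ≤ f x}) = {x | 0 < f x} := by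
    ext x
    simp only [mem_iUnion, mem_ofPred_eq]
    refine ⟨fun ⟨n, hn⟩ => (Real.exp_pos _).trans_le hn, fun hx => ?_⟩
    obtain ⟨n, hn⟩ := exists_nat_ge (-Real.log (f x))
    refine ⟨n, ?_⟩
    rw [← Real.le_log_iff_exp_le hx]
    linarith
  have h1 := tendsto_measure_iUnion_atTop (μ := Q) hmono
  have h2 : Q {x | 0 < f x} = 1 :=
    (mem_ae_iff_prob_eq_one (measurableSet_lt measurable_const hu.measurable)).1 hpos
  rw [hU, h2] at h1
  have h3 := (ENNReal.tendsto_toReal ENNReal.one_ne_top).comp h1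
  obtain ⟨n, hn⟩ := (h3.eventually_const_lt (show 1 - η < (1 : ℝ≥0∞).toReal by simpa)).exists
  exact ⟨n, hn⟩

lemma SpreadOn.exists_le_on_ball [IsProbabilityMeasure Q] (hη : 0 < η) (h : SpreadOn s c r η Q)
    (hf : IsLogConcaveFn f) (hu : UpperSemicontinuous f) (hpos : ∀ᵐ x ∂Q, 0 < f x) :
    ∃ k : ℝ, 0 < k ∧ ∀ x ∈ Metric.ball c r, k ≤ f x := by
  obtain ⟨n, hn⟩ := exists_exp_neg_nat_superlevel hη hu hpos
  exact ⟨_, Real.exp_pos _, h.le_of_measureReal hf hu (Real.exp_pos _) hn⟩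

/-- Log-concave functions with integral at most one and log-likelihood bounded below are uniformly
bounded below on a fixed ball. -/
lemma exists_uniform_le_on_ball (s : Finset (Rd d)) (c : Rd d) (hr : 0 < r) (hη : 0 < η) (K : ℝ) :
    ∃ k : ℝ, 0 < k ∧ ∀ Q : Measure (Rd d), IsProbabilityMeasure Q → SpreadOn s c r η Q →
      ∀ f : Rd d → ℝ, IsLogConcaveFn f → UpperSemicontinuous f → Integrable f → ∫ x, f x ≤ 1 →
      (∀ᵐ x ∂Q, 0 < f x) → Integrable (fun x => Real.log (f x)) Q →
      -K ≤ ∫ x, Real.log (f x) ∂Q → ∀ x ∈ Metric.ball c r, k ≤ f x := by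
  set τ := η / 2 with hτ
  have hτ0 : 0 < τ := by positivity
  set t := 1 / (1 + τ) with ht
  have ht0 : 0 < t := by positivity
  have ht1 : t < 1 := by rw [ht, div_lt_one (by positivity)]; linarith
  have htτ : 1 - t = τ * t := by rw [ht]; field_simp; ring
  set v := volume.real (Metric.ball (0 : Rd d) ((1 - t) * r)) with hv
  have hv0 : 0 < v := volume_real_ball_pos _ (mul_pos (by linarith) hr)
  set C := |(1 / t) * Real.log v| with hC
  have hC0 : 0 ≤ C := abs_nonneg _
  obtain ⟨T, hT⟩ := exists_nat_gt ((2 / η) * (K + C) + 1)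
  refine ⟨Real.exp (-(T : ℝ)), Real.exp_pos _, fun Q hQ hsp f hf hu hi hI hpos hlog hK => ?_⟩
  refine hsp.le_of_measureReal hf hu (Real.exp_pos _) ?_
  by_contra! hcon
  have hex := exists_exp_neg_nat_superlevel hη hu hpos
  classical
  set n₀ := Nat.find hex with hn₀
  have hn₀s := Nat.find_spec hex
  rw [← hn₀] at hn₀s
  have hTn : T < n₀ := by
    by_contra! hle
    refine hcon.not_gt (hn₀s.trans_le (measureReal_mono fun x hx => ?_))
    have hx : Real.exp (-(n₀ : ℝ)) ≤ f x := hx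
    refine le_trans (Real.exp_le_exp.2 ?_) hx
    have : (n₀ : ℝ) ≤ T := by exact_mod_cast hle
    linarith
  obtain ⟨m, hm⟩ : ∃ m, n₀ = m + 1 := ⟨n₀ - 1, by omega⟩
  have hTm : (T : ℝ) ≤ m := by
    have : T ≤ m := by omega
    exact_mod_cast this
  have hmD := Nat.find_min hex (m := m) (by rw [← hn₀]; omega)
  rw [not_lt] at hmD
  have hball := hsp.le_of_measureReal hf hu (Real.exp_pos _) hn₀s
  rw [hm] at hball
  push_cast at hball
  set M := C + τ * (m + 1) with hM
  have hup : ∀ x, 0 < f x → Real.log (f x) ≤ M := by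
    intro x hx
    have h1 := (hf.rpow_mul_volume_le hi (Real.exp_pos _) hball ht0.le ht1 x).trans hI
    rw [← hv] at h1
    have h2 := Real.log_le_log (by positivity) h1
    rw [Real.log_mul (by positivity) hv0.ne', Real.log_mul (by positivity) (by positivity),
      Real.log_rpow (Real.exp_pos _), Real.log_rpow hx, Real.log_exp, Real.log_one, htτ] at h2
    have h3 : -C ≤ (1 / t) * Real.log v := neg_abs_le _
    have h4 : Real.log v = t * ((1 / t) * Real.log v) := by field_simp
    have h5 : t * Real.log (f x) ≤ t * M := by
      rw [hM]
      have : t * -C ≤ t * ((1 / t) * Real.log v) := by gcongr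
      rw [← h4] at this
      linarith
    exact le_of_mul_le_mul_left h5 ht0
  set D := {x | Real.exp (-(m : ℝ)) ≤ f x} with hD
  have hDm : MeasurableSet D := (hu.isClosed_preimage _).measurableSet
  have hInt : ∫ x, Real.log (f x) ∂Q ≤ ∫ x, (-(m : ℝ) + D.indicator (fun _ => M + m) x) ∂Q := by
    refine integral_mono_ae hlog
      ((integrable_const _).add ((integrable_const _).indicator hDm)) ?_
    filter_upwards [hpos] with x hx
    by_cases hxD : x ∈ D
    · simp only [indicator_of_mem hxD]
      linarith [hup x hx]
    · simp only [indicator_of_notMem hxD, add_zero]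
      have hxD : f x < Real.exp (-(m : ℝ)) := not_le.1 hxD
      exact ((Real.log_lt_iff_lt_exp hx).2 hxD).le
  rw [integral_add (integrable_const _) ((integrable_const _).indicator hDm),
    integral_indicator hDm, setIntegral_const, integral_const] at hInt
  simp only [probReal_univ, smul_eq_mul, one_mul] at hInt
  have hm0 : (0 : ℝ) ≤ m := Nat.cast_nonneg m
  have hM0 : 0 ≤ M := by positivity
  have h6 : Q.real D * (M + m) ≤ (1 - η) * (M + m) := by gcongr
  have h7 : η * M ≥ 0 := by positivity
  have h8 : -K ≤ M - η * m := by linarith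
  rw [hM, hτ] at h8
  have h9 : (2 / η) * (K + C) + 1 < m := hT.trans_le hTm
  have h10 : (2 / η) * (K + C) < m - 1 := by linarith
  rw [div_mul_eq_mul_div, div_lt_iff₀ hη] at h10
  nlinarith

end UniformBall

section LipEnv

variable {d : ℕ}

/-- The smallest function `F` above `f` for which `log F` is `L`-Lipschitz. -/
def lipEnv (L : ℝ) (f : Rd d → ℝ) (x : Rd d) : ℝ := ⨆ y, f y * Real.exp (-(L * ‖x - y‖))

variable {f : Rd d → ℝ} {a b L : ℝ}

lemma mul_exp_le_of_decay (hf : ∀ x, f x ≤ Real.exp (b - a * ‖x‖)) (ha : 0 ≤ a) (x y : Rd d) :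
    f y * Real.exp (-(L * ‖x - y‖)) ≤ Real.exp (b - a * ‖x‖) * Real.exp (-((L - a) * ‖x - y‖)) := by
  have h := norm_sub_norm_le x y
  calc f y * Real.exp (-(L * ‖x - y‖)) ≤ Real.exp (b - a * ‖y‖) * Real.exp (-(L * ‖x - y‖)) := by
        gcongr; exact hf y
    _ ≤ _ := by
        rw [← Real.exp_add, ← Real.exp_add]
        refine Real.exp_le_exp.2 ?_
        nlinarith

lemma mul_exp_le_of_decay' (hf : ∀ x, f x ≤ Real.exp (b - a * ‖x‖)) (ha : 0 ≤ a) (hL : a ≤ L)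
    (x y : Rd d) : f y * Real.exp (-(L * ‖x - y‖)) ≤ Real.exp (b - a * ‖x‖) := by
  refine (mul_exp_le_of_decay hf ha x y).trans ?_
  refine mul_le_of_le_one_right (Real.exp_pos _).le (Real.exp_le_one_iff.2 ?_)
  nlinarith [norm_nonneg (x - y)]

lemma bddAbove_lipEnv (hf : ∀ x, f x ≤ Real.exp (b - a * ‖x‖)) (ha : 0 ≤ a) (hL : a ≤ L)
    (x : Rd d) : BddAbove (range fun y => f y * Real.exp (-(L * ‖x - y‖))) :=
  ⟨_, forall_mem_range.2 (mul_exp_le_of_decay' hf ha hL x)⟩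

lemma lipEnv_le_exp (hf : ∀ x, f x ≤ Real.exp (b - a * ‖x‖)) (ha : 0 ≤ a) (hL : a ≤ L)
    (x : Rd d) : lipEnv L f x ≤ Real.exp (b - a * ‖x‖) :=
  ciSup_le (mul_exp_le_of_decay' hf ha hL x)

lemma le_lipEnv (hf : ∀ x, f x ≤ Real.exp (b - a * ‖x‖)) (ha : 0 ≤ a) (hL : a ≤ L)
    (x y : Rd d) : f y * Real.exp (-(L * ‖x - y‖)) ≤ lipEnv L f x :=
  le_ciSup (bddAbove_lipEnv hf ha hL x) y

lemma self_le_lipEnv (hf : ∀ x, f x ≤ Real.exp (b - a * ‖x‖)) (ha : 0 ≤ a) (hL : a ≤ L)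
    (x : Rd d) : f x ≤ lipEnv L f x := by
  simpa using le_lipEnv hf ha hL x x

lemma lipEnv_pos (hf : ∀ x, f x ≤ Real.exp (b - a * ‖x‖)) (ha : 0 ≤ a) (hL : a ≤ L)
    {x₀ : Rd d} (hx₀ : 0 < f x₀) (x : Rd d) : 0 < lipEnv L f x :=
  (mul_pos hx₀ (Real.exp_pos _)).trans_le (le_lipEnv hf ha hL x x₀)

lemma lipEnv_mul_exp_le (hf0 : ∀ x, 0 ≤ f x) (hf : ∀ x, f x ≤ Real.exp (b - a * ‖x‖))
    (ha : 0 ≤ a) (hL : a ≤ L) (x y : Rd d) :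
    lipEnv L f y ≤ lipEnv L f x * Real.exp (L * ‖x - y‖) := by
  refine ciSup_le fun z => ?_
  refine le_trans ?_ (mul_le_mul_of_nonneg_right (le_lipEnv hf ha hL x z) (Real.exp_pos _).le)
  rw [mul_assoc, ← Real.exp_add]
  have := hf0 z
  have h : ‖x - z‖ ≤ ‖x - y‖ + ‖y - z‖ := norm_sub_le_norm_sub_add_norm_sub x y z
  gcongr
  nlinarith

lemma lipschitzWith_log_lipEnv (hf0 : ∀ x, 0 ≤ f x) (hf : ∀ x, f x ≤ Real.exp (b - a * ‖x‖))
    (ha : 0 ≤ a) (hL : a ≤ L) {x₀ : Rd d} (hx₀ : 0 < f x₀) :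
    LipschitzWith L.toNNReal (fun x => Real.log (lipEnv L f x)) := by
  refine LipschitzWith.of_le_add_mul _ fun y x => ?_
  have hy := lipEnv_pos hf ha hL hx₀ y
  have hx := lipEnv_pos hf ha hL hx₀ x
  have h := Real.log_le_log hy (lipEnv_mul_exp_le hf0 hf ha hL x y)
  rw [Real.coe_toNNReal L (ha.trans hL)]
  rwa [Real.log_mul hx.ne' (Real.exp_pos _).ne', Real.log_exp, ← dist_eq_norm, dist_comm] at h

lemma continuous_lipEnv (hf0 : ∀ x, 0 ≤ f x) (hf : ∀ x, f x ≤ Real.exp (b - a * ‖x‖))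
    (ha : 0 ≤ a) (hL : a ≤ L) {x₀ : Rd d} (hx₀ : 0 < f x₀) : Continuous (lipEnv L f) := by
  have h := Real.continuous_exp.comp (lipschitzWith_log_lipEnv hf0 hf ha hL hx₀).continuous
  exact h.congr fun x => Real.exp_log (lipEnv_pos hf ha hL hx₀ x)

lemma isLogConcaveFn_lipEnv (hlc : IsLogConcaveFn f) (hf : ∀ x, f x ≤ Real.exp (b - a * ‖x‖))
    (ha : 0 ≤ a) (hL : a ≤ L) {x₀ : Rd d} (hx₀ : 0 < f x₀) : IsLogConcaveFn (lipEnv L f) := by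
  refine ⟨fun x => (lipEnv_pos hf ha hL hx₀ x).le, fun x y t ht => ?_⟩
  have hx := lipEnv_pos hf ha hL hx₀ x
  have hy := lipEnv_pos hf ha hL hx₀ y
  set W := lipEnv L f ((1 - t) • x + t • y) with hW
  have ht1 : 0 ≤ 1 - t := by linarith [ht.2]
  have key : ∀ δ ∈ Ioo (0 : ℝ) 1, δ * (lipEnv L f x ^ (1 - t) * lipEnv L f y ^ t) ≤ W := by
    intro δ hδ
    obtain ⟨u, hu⟩ := exists_lt_of_lt_ciSup (show δ * lipEnv L f x < ⨆ y, _ from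
      mul_lt_of_lt_one_left hx hδ.2)
    obtain ⟨w, hw⟩ := exists_lt_of_lt_ciSup (show δ * lipEnv L f y < ⨆ y, _ from
      mul_lt_of_lt_one_left hy hδ.2)
    have hδ0 := hδ.1
    have hu0 := hlc.1 u
    have hw0 := hlc.1 w
    calc δ * (lipEnv L f x ^ (1 - t) * lipEnv L f y ^ t)
        = (δ * lipEnv L f x) ^ (1 - t) * (δ * lipEnv L f y) ^ t := by
          rw [Real.mul_rpow hδ0.le hx.le, Real.mul_rpow hδ0.le hy.le]
          nth_rewrite 1 [show δ = δ ^ (1 - t) * δ ^ t by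
            rw [← Real.rpow_add hδ0, sub_add_cancel, Real.rpow_one]]
          ring
      _ ≤ (f u * Real.exp (-(L * ‖x - u‖))) ^ (1 - t) *
          (f w * Real.exp (-(L * ‖y - w‖))) ^ t := by
          have := ht.1
          gcongr
      _ = f u ^ (1 - t) * f w ^ t *
          Real.exp (-(L * ((1 - t) * ‖x - u‖ + t * ‖y - w‖))) := by
          rw [Real.mul_rpow hu0 (Real.exp_pos _).le, Real.mul_rpow hw0 (Real.exp_pos _).le,
            ← Real.exp_mul, ← Real.exp_mul]
          rw [mul_mul_mul_comm, ← Real.exp_add]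
          congr 2
          ring
      _ ≤ f ((1 - t) • u + t • w) *
          Real.exp (-(L * ‖((1 - t) • x + t • y) - ((1 - t) • u + t • w)‖)) := by
          have := hlc.1 ((1 - t) • u + t • w)
          have hn : ‖((1 - t) • x + t • y) - ((1 - t) • u + t • w)‖ ≤
              (1 - t) * ‖x - u‖ + t * ‖y - w‖ := by
            have e : ((1 - t) • x + t • y) - ((1 - t) • u + t • w) =
              (1 - t) • (x - u) + t • (y - w) := by module
            rw [e]
            refine (norm_add_le _ _).trans ?_
            rw [norm_smul, norm_smul, Real.norm_of_nonneg ht1, Real.norm_of_nonneg ht.1]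
          have hL0 : 0 ≤ L := ha.trans hL
          gcongr
          exact hlc.2 u w t ht
      _ ≤ W := le_lipEnv hf ha hL _ _
  by_contra! hlt
  set A := lipEnv L f x ^ (1 - t) * lipEnv L f y ^ t with hA
  have hW0 : 0 < W := lipEnv_pos hf ha hL hx₀ _
  have hA0 : 0 < A := hW0.trans hlt
  obtain ⟨δ, h1, h2⟩ := exists_between ((div_lt_one hA0).2 hlt)
  have := key δ ⟨(div_pos hW0 hA0).trans h1, h2⟩
  rw [div_lt_iff₀ hA0] at h1
  linarith

lemma integral_comp_homothety (f : Rd d → ℝ) (c : Rd d) {t : ℝ} (ht : 0 < t) :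
    ∫ x, f (c + t • (x - c)) = (t ^ d)⁻¹ * ∫ x, f x := by
  rw [integral_sub_right_eq_self (fun x => f (c + t • x)) c,
    Measure.integral_comp_smul volume (fun x => f (c + x)) t,
    integral_add_left_eq_self (fun x => f x) c, finrank_euclideanSpace_fin, smul_eq_mul,
    abs_of_pos (by positivity)]

lemma integrable_comp_homothety {f : Rd d → ℝ} (hf : Integrable f) (c : Rd d) {t : ℝ}
    (ht : 0 < t) : Integrable (fun x => f (c + t • (x - c))) :=
  ((hf.comp_add_left c).comp_smul ht.ne').comp_sub_right c

/-- Uniform control of the mass added by passing to the Lipschitz envelope. -/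
lemma exists_lipEnv_integral_le (c : Rd d) {k r : ℝ} (hk : 0 < k) (hr : 0 < r) (ha : 0 < a) (b : ℝ)
    {ε : ℝ} (hε : 0 < ε) :
    ∃ L : ℝ, a ≤ L ∧ ∀ f : Rd d → ℝ, IsLogConcaveFn f → Integrable f → ∫ x, f x ≤ 1 →
      (∀ x ∈ Metric.ball c r, k ≤ f x) → (∀ x, f x ≤ Real.exp (b - a * ‖x‖)) →
      ∫ x, lipEnv L f x ≤ 1 + ε := by
  set κ := Real.exp b / k with hκ
  have hκ0 : 0 < κ := by positivity
  obtain ⟨θ, hθ1, hθ⟩ : ∃ θ : ℝ, 1 < θ ∧ κ ^ (θ - 1) * θ ^ d < 1 + ε / 2 := by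
    have hc : Tendsto (fun θ : ℝ => κ ^ (θ - 1) * θ ^ d) (𝓝[>] 1)
        (𝓝 (κ ^ ((1 : ℝ) - 1) * 1 ^ d)) := by
      refine Tendsto.mono_left (Continuous.tendsto ?_ 1) nhdsWithin_le_nhds
      have : Continuous fun θ : ℝ => κ ^ (θ - 1) :=
        continuous_const.rpow (by fun_prop) fun _ => Or.inl hκ0.ne'
      fun_prop
    have h1 : κ ^ ((1 : ℝ) - 1) * 1 ^ d < 1 + ε / 2 := by simp [hε]
    obtain ⟨θ, h2, h3⟩ := ((hc.eventually_lt_const h1).and self_mem_nhdsWithin).exists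
    exact ⟨θ, h3, h2⟩
  have hθ0 : 0 < θ := by linarith
  set lam := 1 / θ with hlam
  have hlam0 : 0 < lam := by positivity
  have hlam1 : lam < 1 := by rw [hlam, div_lt_one hθ0]; exact hθ1
  set ρ := r * (1 - lam) / lam with hρ
  have hρ0 : 0 < ρ := by
    have : 0 < 1 - lam := by linarith
    positivity
  set J := ∫ x : Rd d, Real.exp (b - a * ‖x‖) with hJ
  obtain ⟨N, haN, hN⟩ : ∃ N : ℝ, 0 ≤ N ∧ J * Real.exp (-(N * ρ)) < ε / 2 := by
    have h1 : Tendsto (fun N : ℝ => J * Real.exp (-(N * ρ))) atTop (𝓝 (J * 0)) :=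
      (Real.tendsto_exp_neg_atTop_nhds_zero.comp (tendsto_id.atTop_mul_const hρ0)).const_mul J
    rw [mul_zero] at h1
    exact ((eventually_ge_atTop 0).and (h1.eventually_lt_const (half_pos hε))).exists
  refine ⟨a + N, by linarith, fun f hf hi hI hball hdec => ?_⟩
  have hL : a ≤ a + N := by linarith
  have hfz : ∀ x, 0 ≤ f (c + lam • (x - c)) := fun x => hf.1 _
  have hbound : ∀ x, lipEnv (a + N) f x ≤
      κ ^ (θ - 1) * f (c + lam • (x - c)) + Real.exp (b - a * ‖x‖) * Real.exp (-(N * ρ)) := by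
    intro x
    refine ciSup_le fun y => ?_
    rcases le_or_gt ρ ‖x - y‖ with hxy | hxy
    · have h1 := mul_exp_le_of_decay (L := a + N) hdec ha.le x y
      have h2 : Real.exp (b - a * ‖x‖) * Real.exp (-((a + N - a) * ‖x - y‖)) ≤
          Real.exp (b - a * ‖x‖) * Real.exp (-(N * ρ)) := by
        rw [add_sub_cancel_left]
        gcongr
      have h3 : 0 ≤ κ ^ (θ - 1) * f (c + lam • (x - c)) :=
        mul_nonneg (by positivity) (hfz x)
      linarith
    · have h1 : f y * Real.exp (-((a + N) * ‖x - y‖)) ≤ f y := by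
        refine mul_le_of_le_one_right (hf.1 y) (Real.exp_le_one_iff.2 ?_)
        have : 0 ≤ (a + N) * ‖x - y‖ := by positivity
        linarith
      set z := c + lam • (x - c) with hz
      have h2 : k ^ (1 - lam) * f y ^ lam ≤ f z := by
        refine hf.rpow_mul_le_of_mem_ball hk hball hlam0.le hlam1 y ?_
        rw [mem_ball_iff_norm, hz]
        have e : c + lam • (x - c) - (c + lam • (y - c)) = lam • (x - y) := by module
        rw [e, norm_smul, Real.norm_of_nonneg hlam0.le]
        rw [hρ, lt_div_iff₀ hlam0] at hxy
        linarith
      have h3 : f y ≤ κ ^ (θ - 1) * f z := by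
        have hfz0 : 0 ≤ f z := hf.1 z
        rcases hfz0.eq_or_lt with h0 | h0
        · have h4 : f y ^ lam ≤ 0 := by
            rw [← h0] at h2
            exact nonpos_of_mul_nonpos_right h2 (by positivity)
          have h5 : f y = 0 := by
            by_contra hne
            exact h4.not_gt (Real.rpow_pos_of_pos ((hf.1 y).lt_of_ne' hne) _)
          rw [h5, ← h0]; simp
        · have h4 : (k ^ (1 - lam) * f y ^ lam) ^ θ ≤ f z ^ θ :=
            Real.rpow_le_rpow (mul_nonneg (by positivity) (Real.rpow_nonneg (hf.1 y) _)) h2 hθ0.le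
          have el : lam * θ = 1 := by rw [hlam]; field_simp
          rw [Real.mul_rpow (by positivity) (Real.rpow_nonneg (hf.1 y) _),
            ← Real.rpow_mul hk.le, ← Real.rpow_mul (hf.1 y), el, Real.rpow_one,
            show (1 - lam) * θ = θ - 1 by rw [sub_mul, el, one_mul],
            show f z ^ θ = f z ^ (θ - 1) * f z by
              rw [← Real.rpow_add_one h0.ne', sub_add_cancel]] at h4
          have h5 : f z ^ (θ - 1) ≤ Real.exp b ^ (θ - 1) := by
            refine Real.rpow_le_rpow hfz0 ((hdec z).trans (Real.exp_le_exp.2 ?_)) (by linarith)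
            have : 0 ≤ a * ‖z‖ := by positivity
            linarith
          rw [hκ, Real.div_rpow (Real.exp_pos _).le hk.le, div_mul_eq_mul_div,
            le_div_iff₀ (by positivity), mul_comm]
          exact h4.trans (by gcongr)
      have h4 : 0 ≤ Real.exp (b - a * ‖x‖) * Real.exp (-(N * ρ)) := by positivity
      linarith
  have i1 : Integrable fun x => κ ^ (θ - 1) * f (c + lam • (x - c)) :=
    (integrable_comp_homothety hi c hlam0).const_mul _
  have i2 : Integrable fun x : Rd d => Real.exp (b - a * ‖x‖) * Real.exp (-(N * ρ)) :=
    (integrable_exp_sub_mul_norm ha b).mul_const _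
  have hx₀ : 0 < f c := hk.trans_le (hball c (Metric.mem_ball_self hr))
  calc ∫ x, lipEnv (a + N) f x
      ≤ ∫ x, (κ ^ (θ - 1) * f (c + lam • (x - c)) +
          Real.exp (b - a * ‖x‖) * Real.exp (-(N * ρ))) :=
        integral_mono_of_nonneg (ae_of_all _ fun x => (lipEnv_pos hdec ha.le hL hx₀ x).le)
          (i1.add i2) (ae_of_all _ hbound)
    _ = κ ^ (θ - 1) * (θ ^ d * ∫ x, f x) + J * Real.exp (-(N * ρ)) := by
        rw [integral_add i1 i2, integral_const_mul, integral_mul_const,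
          integral_comp_homothety f c hlam0, hlam, one_div, inv_pow, inv_inv]
    _ ≤ κ ^ (θ - 1) * (θ ^ d * 1) + J * Real.exp (-(N * ρ)) := by gcongr
    _ ≤ 1 + ε := by rw [mul_one]; linarith

end LipEnv

section Extended

lemma elog_of_pos {y : ℝ} (hy : 0 < y) : elog y = ((Real.log y : ℝ) : EReal) :=
  if_neg hy.not_ge

lemma elog_eq_log (y : ℝ) : elog y = ENNReal.log (ENNReal.ofReal y) := by
  rw [ENNReal.log_ofReal]; rfl

lemma expE_eq_exp (a : EReal) : expE a = EReal.exp a := by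
  induction a using EReal.rec <;> simp [expE]

lemma epos_coe (y : ℝ) : epos (y : EReal) = ENNReal.ofReal y := by
  simp [epos]

lemma measurable_epos : Measurable epos :=
  Measurable.ite (measurableSet_singleton ⊤) measurable_const
    (ENNReal.measurable_ofReal.comp measurable_ereal_toReal)

lemma coe_ennreal_eq_coe_toReal {a : ℝ≥0∞} (ha : a ≠ ⊤) :
    (a : EReal) = ((a.toReal : ℝ) : EReal) := by
  lift a to NNReal using ha
  rfl

variable {d : ℕ} {Q : Measure (Rd d)} {f : Rd d → ℝ}

lemma Lfun_elog (hf0 : ∀ x, 0 ≤ f x) (hi : Integrable f) (hpos : ∀ᵐ x ∂Q, 0 < f x)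
    (hlog : Integrable (fun x => Real.log (f x)) Q) :
    Lfun (fun x => elog (f x)) Q = ((∫ x, Real.log (f x) ∂Q - ∫ x, f x : ℝ) : EReal) := by
  have h1 : ∫⁻ x, epos (elog (f x)) ∂Q = ∫⁻ x, ENNReal.ofReal (Real.log (f x)) ∂Q := by
    refine lintegral_congr_ae ?_
    filter_upwards [hpos] with x hx
    rw [elog_of_pos hx, epos_coe]
  have h2 : ∫⁻ x, epos (-(elog (f x))) ∂Q = ∫⁻ x, ENNReal.ofReal (-Real.log (f x)) ∂Q := by
    refine lintegral_congr_ae ?_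
    filter_upwards [hpos] with x hx
    rw [elog_of_pos hx, ← EReal.coe_neg, epos_coe]
  have h3 : ∫⁻ x, expE (elog (f x)) = ∫⁻ x, ENNReal.ofReal (f x) := by
    simp_rw [expE_eq_exp, elog_eq_log, ENNReal.exp_log]
  have t1 : ∫⁻ x, ENNReal.ofReal (Real.log (f x)) ∂Q ≠ ⊤ := hlog.lintegral_lt_top.ne
  have t2 : ∫⁻ x, ENNReal.ofReal (-Real.log (f x)) ∂Q ≠ ⊤ := hlog.neg.lintegral_lt_top.ne
  have t3 : ∫⁻ x, ENNReal.ofReal (f x) ≠ ⊤ := hi.lintegral_lt_top.ne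
  rw [Lfun, erealIntegral, h1, h2, h3, coe_ennreal_eq_coe_toReal t1, coe_ennreal_eq_coe_toReal t2,
    coe_ennreal_eq_coe_toReal t3, integral_eq_lintegral_pos_part_sub_lintegral_neg_part hlog,
    integral_eq_lintegral_of_nonneg_ae (ae_of_all _ hf0) hi.1]
  simp only [EReal.coe_sub]

lemma memPhi_elog (hlc : IsLogConcaveFn f) (hu : UpperSemicontinuous f) {a b : ℝ} (ha : 0 < a)
    (hdec : ∀ x, f x ≤ Real.exp (b - a * ‖x‖)) : MemPhi (fun x => elog (f x)) := by
  refine ⟨fun x => ?_, ?_, fun x y t ht => ?_, ?_⟩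
  · change elog (f x) ≠ ⊤
    rw [elog_eq_log, Ne, ENNReal.log_eq_top_iff]
    exact ENNReal.ofReal_ne_top
  · simp_rw [elog_eq_log]
    exact (ENNReal.continuous_log.comp ENNReal.continuous_ofReal).comp_upperSemicontinuous hu
      (ENNReal.log_monotone.comp ENNReal.ofReal_mono)
  · rcases ht.1.eq_or_lt with rfl | ht0
    · simp
    rcases ht.2.eq_or_lt with rfl | ht1
    · simp
    rcases (hlc.1 x).eq_or_lt with hx | hx
    · have : elog (f x) = ⊥ := if_pos hx.ge
      simp only [this]
      rw [EReal.coe_mul_bot_of_pos (sub_pos.2 ht1), EReal.bot_add]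
      exact bot_le
    rcases (hlc.1 y).eq_or_lt with hy | hy
    · have : elog (f y) = ⊥ := if_pos hy.ge
      simp only [this]
      rw [EReal.coe_mul_bot_of_pos ht0, EReal.add_bot]
      exact bot_le
    have h := hlc.2 x y t ht
    have h0 : 0 < f x ^ (1 - t) * f y ^ t := by positivity
    have h1 := Real.log_le_log h0 h
    rw [Real.log_mul (by positivity) (by positivity), Real.log_rpow hx, Real.log_rpow hy] at h1
    simp only [elog_of_pos hx, elog_of_pos hy, elog_of_pos (h0.trans_le h)]
    exact_mod_cast h1
  · have h0 : Tendsto (fun x : Rd d => Real.exp (b - a * ‖x‖))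
        (Filter.comap (fun x => ‖x‖) Filter.atTop) (𝓝 0) := by
      refine Real.tendsto_exp_atBot.comp ?_
      have h1 : Tendsto (fun x : Rd d => a * ‖x‖) (Filter.comap (fun x => ‖x‖) Filter.atTop)
        atTop := tendsto_comap.const_mul_atTop ha
      simpa [sub_eq_add_neg] using
        tendsto_atBot_add_const_left _ b (tendsto_neg_atTop_atBot.comp h1)
    have h2 := tendsto_of_tendsto_of_tendsto_of_le_of_le tendsto_const_nhds h0 hlc.1 hdec
    simp_rw [elog_eq_log]
    have h3 := ((ENNReal.continuous_log.comp ENNReal.continuous_ofReal).tendsto 0).comp h2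
    simpa [Function.comp_def] using h3

lemma MemPhi.exists_le {φ : Rd d → EReal} (hφ : MemPhi φ) : ∃ B : ℝ, ∀ x, φ x ≤ B := by
  obtain ⟨htop, hu, -, hlim⟩ := hφ
  have h1 : ∀ᶠ x in Filter.comap (fun x : Rd d => ‖x‖) atTop, φ x < 0 :=
    hlim.eventually_lt_const EReal.bot_lt_zero
  rw [eventually_comap] at h1
  obtain ⟨R, hR⟩ := eventually_atTop.1 h1
  have hne : (Metric.closedBall (0 : Rd d) |R|).Nonempty := ⟨0, by simp⟩
  obtain ⟨x₀, -, hx₀⟩ := (hu.upperSemicontinuousOn _).exists_isMaxOn hne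
    (isCompact_closedBall (0 : Rd d) |R|)
  refine ⟨max 0 (φ x₀).toReal, fun x => ?_⟩
  rcases le_or_gt ‖x‖ |R| with hx | hx
  · have h2 : φ x ≤ φ x₀ := hx₀ (by simpa using hx)
    refine h2.trans ((EReal.le_coe_toReal (htop x₀)).trans ?_)
    exact_mod_cast le_max_right _ _
  · have h2 := hR ‖x‖ ((le_abs_self R).trans hx.le) x rfl
    refine h2.le.trans ?_
    exact_mod_cast le_max_left _ _

lemma MemPhi.exists_eq_of_Lfun_ne_bot [IsProbabilityMeasure Q] {φ : Rd d → EReal} (hφ : MemPhi φ)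
    (hL : Lfun φ Q ≠ ⊥) :
    ∃ f : Rd d → ℝ, IsLogConcaveFn f ∧ UpperSemicontinuous f ∧ Integrable f ∧
      (∀ᵐ x ∂Q, 0 < f x) ∧ Integrable (fun x => Real.log (f x)) Q ∧
      Lfun φ Q = ((∫ x, Real.log (f x) ∂Q - ∫ x, f x : ℝ) : EReal) := by
  obtain ⟨B, hB⟩ := hφ.exists_le
  obtain ⟨htop, hu, hconc, -⟩ := hφ
  set f : Rd d → ℝ := fun x => (EReal.exp (φ x)).toReal with hf
  have hexp : ∀ x, EReal.exp (φ x) ≠ ⊤ := fun x => by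
    rw [Ne, EReal.exp_eq_top_iff]; exact htop x
  have hfexp : ∀ x, ENNReal.ofReal (f x) = EReal.exp (φ x) := fun x =>
    ENNReal.ofReal_toReal (hexp x)
  have hφf : ∀ x, φ x = elog (f x) := fun x => by
    rw [elog_eq_log, hfexp, EReal.log_exp]
  have hf0 : ∀ x, 0 ≤ f x := fun x => ENNReal.toReal_nonneg
  have hlc : IsLogConcaveFn f := by
    refine ⟨hf0, fun x y t ht => ?_⟩
    have h := EReal.exp_monotone (hconc x y t ht)
    rw [EReal.exp_add, mul_comm ((1 - t : ℝ) : EReal), mul_comm (t : EReal), EReal.exp_mul,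
      EReal.exp_mul] at h
    have h2 := ENNReal.toReal_mono (hexp _) h
    rwa [ENNReal.toReal_mul, ← ENNReal.toReal_rpow, ← ENNReal.toReal_rpow] at h2
  have hfu : UpperSemicontinuous f := by
    intro x y hxy
    have hy : 0 < y := (hf0 x).trans_lt hxy
    have h1 : UpperSemicontinuous fun x => EReal.exp (φ x) :=
      ENNReal.continuous_exp.comp_upperSemicontinuous hu EReal.exp_monotone
    have h2 := h1 x (ENNReal.ofReal y) ((ENNReal.lt_ofReal_iff_toReal_lt (hexp x)).2 hxy)
    filter_upwards [h2] with z hz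
    exact (ENNReal.lt_ofReal_iff_toReal_lt (hexp z)).1 hz
  have hInt : ∫⁻ x, expE (φ x) ≠ ⊤ := by
    intro h
    rw [Lfun, h] at hL
    exact hL (by simp)
  have hneg : ∫⁻ x, epos (-(φ x)) ∂Q ≠ ⊤ := by
    intro h
    rw [Lfun, erealIntegral, h] at hL
    exact hL (by simp)
  have hi : Integrable f := by
    refine ⟨hfu.measurable.aestronglyMeasurable, ?_⟩
    rw [hasFiniteIntegral_iff_ofReal (ae_of_all _ hf0)]
    simp_rw [hfexp, ← expE_eq_exp]
    exact hInt.lt_top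
  have hpos : ∀ᵐ x ∂Q, 0 < f x := by
    have hm : Measurable fun x => epos (-(φ x)) :=
      measurable_epos.comp hu.measurable.neg
    filter_upwards [ae_lt_top hm hneg] with x hx
    refine (hf0 x).lt_of_ne fun h0 => ?_
    have : φ x = ⊥ := by rw [hφf, ← h0]; simp [elog]
    simp [this, epos] at hx
  have hlog : Integrable (fun x => Real.log (f x)) Q := by
    refine ⟨(Real.measurable_log.comp hfu.measurable).aestronglyMeasurable, ?_⟩
    rw [hasFiniteIntegral_iff_norm]
    have hle : ∫⁻ x, ENNReal.ofReal ‖Real.log (f x)‖ ∂Q ≤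
        ∫⁻ x, (ENNReal.ofReal B + epos (-(φ x))) ∂Q := by
      refine lintegral_mono_ae ?_
      filter_upwards [hpos] with x hx
      have h1 : Real.log (f x) ≤ B := by
        have := hB x
        rw [hφf, elog_of_pos hx] at this
        exact_mod_cast this
      rw [hφf, elog_of_pos hx, ← EReal.coe_neg, epos_coe, Real.norm_eq_abs]
      rcases le_total 0 (Real.log (f x)) with h | h
      · rw [abs_of_nonneg h]
        exact (ENNReal.ofReal_le_ofReal h1).trans le_self_add
      · rw [abs_of_nonpos h]
        exact le_add_self
    refine hle.trans_lt ?_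
    rw [lintegral_add_left measurable_const, lintegral_const, measure_univ, mul_one]
    exact ENNReal.add_lt_top.2 ⟨ENNReal.ofReal_lt_top, hneg.lt_top⟩
  refine ⟨f, hlc, hfu, hi, hpos, hlog, ?_⟩
  rw [← Lfun_elog hf0 hi hpos hlog]
  simp_rw [← hφf]

lemma coe_le_Lstar (hlc : IsLogConcaveFn f) (hu : UpperSemicontinuous f) (hi : Integrable f)
    {a b : ℝ} (ha : 0 < a) (hdec : ∀ x, f x ≤ Real.exp (b - a * ‖x‖)) (hpos : ∀ᵐ x ∂Q, 0 < f x)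
    (hlog : Integrable (fun x => Real.log (f x)) Q) :
    ((∫ x, Real.log (f x) ∂Q - ∫ x, f x : ℝ) : EReal) ≤ Lstar Q := by
  rw [← Lfun_elog hlc.1 hi hpos hlog]
  exact le_iSup₂_of_le _ (memPhi_elog hlc hu ha hdec) le_rfl

end Extended

section Normalize

variable {d : ℕ} {Q : Measure (Rd d)} {f : Rd d → ℝ}

lemma IsLogConcaveFn.const_mul (hf : IsLogConcaveFn f) {A : ℝ} (hA : 0 < A) :
    IsLogConcaveFn fun x => A * f x := by
  refine ⟨fun x => mul_nonneg hA.le (hf.1 x), fun x y t ht => ?_⟩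
  rw [Real.mul_rpow hA.le (hf.1 x), Real.mul_rpow hA.le (hf.1 y), mul_mul_mul_comm,
    ← Real.rpow_add hA, sub_add_cancel, Real.rpow_one]
  exact mul_le_mul_of_nonneg_left (hf.2 x y t ht) hA.le

lemma isLCDensity_normalize (hf : IsLogConcaveFn f) (hu : UpperSemicontinuous f)
    (hi : Integrable f) (h0 : 0 < ∫ x, f x) : IsLCDensity fun x => (∫ x, f x)⁻¹ * f x := by
  have hlc := hf.const_mul (inv_pos.2 h0)
  have hu' : UpperSemicontinuous fun x => (∫ x, f x)⁻¹ * f x :=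
    (continuous_const_mul _).comp_upperSemicontinuous hu
      (monotone_mul_left_of_nonneg (inv_pos.2 h0).le)
  refine ⟨⟨hlc.1, hu'.measurable, ?_⟩, hu', hlc⟩
  rw [← ofReal_integral_eq_lintegral_ofReal (hi.const_mul _) (ae_of_all _ hlc.1),
    integral_const_mul, inv_mul_cancel₀ h0.ne', ENNReal.ofReal_one]

lemma IsLCDensity.integrable (hf : IsLCDensity f) : Integrable f := by
  refine ⟨hf.1.2.1.aestronglyMeasurable, ?_⟩
  rw [hasFiniteIntegral_iff_ofReal (ae_of_all _ hf.1.1), hf.1.2.2]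
  exact ENNReal.one_lt_top

lemma IsLCDensity.integral_eq_one (hf : IsLCDensity f) : ∫ x, f x = 1 := by
  rw [integral_eq_lintegral_of_nonneg_ae (ae_of_all _ hf.1.1) hf.integrable.1, hf.1.2.2,
    ENNReal.toReal_one]

variable [IsProbabilityMeasure Q]

lemma integrable_log_normalize {A : ℝ} (hA : 0 < A) (hpos : ∀ᵐ x ∂Q, 0 < f x)
    (hlog : Integrable (fun x => Real.log (f x)) Q) :
    Integrable (fun x => Real.log (A * f x)) Q ∧
      ∫ x, Real.log (A * f x) ∂Q = Real.log A + ∫ x, Real.log (f x) ∂Q := by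
  have h : (fun x => Real.log (A * f x)) =ᵐ[Q] fun x => Real.log A + Real.log (f x) := by
    filter_upwards [hpos] with x hx
    exact Real.log_mul hA.ne' hx.ne'
  refine ⟨((integrable_const _).add hlog).congr h.symm, ?_⟩
  rw [integral_congr_ae h, integral_add (integrable_const _) hlog]
  simp

/-- Optimality of the log-concave projection among non-normalised competitors. -/
lemma IsLCProj.integral_log_le {fs : Rd d → ℝ} (hfs : IsLCProj Q fs) (hf : IsLogConcaveFn f)
    (hu : UpperSemicontinuous f) (hi : Integrable f) (h0 : 0 < ∫ x, f x)
    (hpos : ∀ᵐ x ∂Q, 0 < f x) (hlog : Integrable (fun x => Real.log (f x)) Q) :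
    ∫ x, Real.log (f x) ∂Q - Real.log (∫ x, f x) ≤ ∫ x, Real.log (fs x) ∂Q := by
  obtain ⟨h1, h2⟩ := integrable_log_normalize (inv_pos.2 h0) hpos hlog
  have h3 := hfs.2.2.2 _ (isLCDensity_normalize hf hu hi h0)
    (hpos.mono fun x hx => mul_pos (inv_pos.2 h0) hx) h1
  rw [h2, Real.log_inv] at h3
  linarith

lemma SpreadOn.integral_pos {s : Finset (Rd d)} {c : Rd d} {r η : ℝ} (hr : 0 < r) (hη : 0 < η)
    (h : SpreadOn s c r η Q) (hf : IsLogConcaveFn f) (hu : UpperSemicontinuous f)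
    (hi : Integrable f) (hpos : ∀ᵐ x ∂Q, 0 < f x) : 0 < ∫ x, f x := by
  obtain ⟨k, hk, hball⟩ := h.exists_le_on_ball hη hf hu hpos
  exact (mul_pos hk (volume_real_ball_pos c hr)).trans_le
    (mul_measureReal_le_integral hf.1 hi Metric.isOpen_ball.measurableSet
      measure_ball_lt_top.ne hball)

/-- To bound `L*` it suffices to consider log-concave densities. -/
lemma SpreadOn.Lstar_le {s : Finset (Rd d)} {c : Rd d} {r η : ℝ} (hr : 0 < r) (hη : 0 < η)
    (h : SpreadOn s c r η Q) {X : ℝ}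
    (hX : ∀ f : Rd d → ℝ, IsLCDensity f → (∀ᵐ x ∂Q, 0 < f x) →
      Integrable (fun x => Real.log (f x)) Q → ∫ x, Real.log (f x) ∂Q - 1 ≤ X) :
    Lstar Q ≤ X := by
  refine iSup₂_le fun φ hφ => ?_
  by_cases hL : Lfun φ Q = ⊥
  · rw [hL]; exact bot_le
  obtain ⟨f, hf, hu, hi, hpos, hlog, e⟩ := hφ.exists_eq_of_Lfun_ne_bot hL
  rw [e]
  refine EReal.coe_le_coe ?_
  have h0 := h.integral_pos hr hη hf hu hi hpos
  obtain ⟨h1, h2⟩ := integrable_log_normalize (inv_pos.2 h0) hpos hlog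
  have h3 := hX _ (isLCDensity_normalize hf hu hi h0)
    (hpos.mono fun x hx => mul_pos (inv_pos.2 h0) hx) h1
  rw [h2, Real.log_inv] at h3
  linarith [Real.log_le_sub_one_of_pos h0]

end Normalize

section Majorant

variable {d : ℕ} {P Q : Measure (Rd d)} {s : Finset (Rd d)} {c : Rd d} {r η : ℝ}

/-- `F` is a log-concave, log-Lipschitz majorant of `f` with total mass at most `1 + ε`. -/
structure IsLipMajorant (L : NNReal) (ε : ℝ) (f F : Rd d → ℝ) : Prop where
  le : ∀ x, f x ≤ F x
  pos : ∀ x, 0 < F x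
  logConcave : IsLogConcaveFn F
  continuous : Continuous F
  decay : ∃ a b : ℝ, 0 < a ∧ ∀ x, F x ≤ Real.exp (b - a * ‖x‖)
  lipschitz : LipschitzWith L fun x => Real.log (F x)
  integral_le : ∫ x, F x ≤ 1 + ε

lemma exists_lipMajorant (s : Finset (Rd d)) (c : Rd d) (hr : 0 < r) (hη : 0 < η) (K : ℝ) {ε : ℝ}
    (hε : 0 < ε) :
    ∃ L : NNReal, ∀ Q : Measure (Rd d), IsProbabilityMeasure Q → SpreadOn s c r η Q →
      ∀ f : Rd d → ℝ, IsLCDensity f → (∀ᵐ x ∂Q, 0 < f x) →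
      Integrable (fun x => Real.log (f x)) Q → -K ≤ ∫ x, Real.log (f x) ∂Q →
      ∃ F, IsLipMajorant L ε f F := by
  obtain ⟨k, hk, hkf⟩ := exists_uniform_le_on_ball s c hr hη K
  obtain ⟨a, b, ha, hab⟩ := exists_exp_decay c hk hr 1
  obtain ⟨L, haL, hL⟩ := exists_lipEnv_integral_le c hk hr ha b hε
  refine ⟨L.toNNReal, fun Q hQ hsp f hf hpos hlog hK => ⟨lipEnv L f, ?_⟩⟩
  have hi := hf.integrable
  have h1 := hf.integral_eq_one.le
  have hball := hkf Q hQ hsp f hf.2.2 hf.2.1 hi h1 hpos hlog hK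
  have hdec := hab f hf.2.2 hi h1 hball
  have hx₀ : 0 < f c := hk.trans_le (hball c (Metric.mem_ball_self hr))
  exact ⟨self_le_lipEnv hdec ha.le haL, lipEnv_pos hdec ha.le haL hx₀,
    isLogConcaveFn_lipEnv hf.2.2 hdec ha.le haL hx₀, continuous_lipEnv hf.1.1 hdec ha.le haL hx₀,
    ⟨a, b, ha, lipEnv_le_exp hdec ha.le haL⟩,
    lipschitzWith_log_lipEnv hf.1.1 hdec ha.le haL hx₀, hL f hf.2.2 hi h1 hball hdec⟩

namespace IsLipMajorant

variable {L : NNReal} {ε : ℝ} {f F : Rd d → ℝ}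

lemma integrable (h : IsLipMajorant L ε f F) : Integrable F := by
  obtain ⟨a, b, ha, hab⟩ := h.decay
  refine (integrable_exp_sub_mul_norm ha b).mono' h.continuous.aestronglyMeasurable
    (ae_of_all _ fun x => ?_)
  rw [Real.norm_of_nonneg (h.pos x).le]
  exact hab x

lemma integrable_log [IsProbabilityMeasure Q] (h : IsLipMajorant L ε f F)
    (hQ : Integrable (fun x => ‖x‖) Q) : Integrable (fun x => Real.log (F x)) Q :=
  integrable_of_lipschitzWith hQ h.lipschitz

lemma one_le_integral (h : IsLipMajorant L ε f F) (hf : IsLCDensity f) : 1 ≤ ∫ x, F x := by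
  rw [← hf.integral_eq_one]
  exact integral_mono hf.integrable h.integrable h.le

lemma integral_log_le [IsProbabilityMeasure Q] (h : IsLipMajorant L ε f F)
    (hQ : Integrable (fun x => ‖x‖) Q) (hpos : ∀ᵐ x ∂Q, 0 < f x)
    (hlog : Integrable (fun x => Real.log (f x)) Q) :
    ∫ x, Real.log (f x) ∂Q ≤ ∫ x, Real.log (F x) ∂Q :=
  integral_mono_ae hlog (h.integrable_log hQ)
    (hpos.mono fun x hx => Real.log_le_log hx (h.le x))

lemma coe_le_Lstar [IsProbabilityMeasure Q] (h : IsLipMajorant L ε f F)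
    (hQ : Integrable (fun x => ‖x‖) Q) :
    ((∫ x, Real.log (F x) ∂Q - ∫ x, F x : ℝ) : EReal) ≤ Lstar Q := by
  obtain ⟨a, b, ha, hab⟩ := h.decay
  exact _root_.coe_le_Lstar h.logConcave h.continuous.upperSemicontinuous h.integrable ha hab
    (ae_of_all _ h.pos) (h.integrable_log hQ)

lemma sub_le_of_isLCProj [IsProbabilityMeasure Q] (h : IsLipMajorant L ε f F)
    (hQ : Integrable (fun x => ‖x‖) Q) (hf : IsLCDensity f) {g : Rd d → ℝ} (hg : IsLCProj Q g) :
    ∫ x, Real.log (F x) ∂Q - ε ≤ ∫ x, Real.log (g x) ∂Q := by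
  have h1 := h.one_le_integral hf
  have h2 := hg.integral_log_le h.logConcave h.continuous.upperSemicontinuous h.integrable
    (by linarith) (ae_of_all _ h.pos) (h.integrable_log hQ)
  have h3 := Real.log_le_sub_one_of_pos (show 0 < ∫ x, F x by linarith)
  linarith [h.integral_le]

end IsLipMajorant

lemma eventually_abs_integral_sub_le {Pn : ℕ → Measure (Rd d)} [IsProbabilityMeasure P]
    (hP : Integrable (fun x => ‖x‖) P) (hprob : ∀ n, IsProbabilityMeasure (Pn n))
    (hmom : ∀ n, Integrable (fun x => ‖x‖) (Pn n))
    (hconv : Tendsto (fun n => mallows1 (Pn n) P) atTop (nhds 0)) (L : NNReal) {ε : ℝ}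
    (hε : 0 < ε) :
    ∀ᶠ n in atTop, ∀ ψ : Rd d → ℝ, LipschitzWith L ψ →
      |∫ x, ψ x ∂(Pn n) - ∫ x, ψ x ∂P| ≤ ε := by
  have hδ : 0 < ε / (L + 1) := by positivity
  filter_upwards [hconv.eventually_lt_const (ENNReal.ofReal_pos.2 hδ)] with n hn ψ hψ
  have := hprob n
  refine (integral_sub_le_of_mallows1_lt hP (hmom n) hn hψ).trans ?_
  rw [← mul_div_assoc, div_le_iff₀ (by positivity)]
  nlinarith [L.2]

/-- Along a sequence converging in Mallows distance, the log-likelihood of a log-concave density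
eventually does not exceed the optimal value for the limit by more than `ε`. -/
lemma eventually_integral_log_le {Pn : ℕ → Measure (Rd d)} (hP : MemP P)
    (hprob : ∀ n, IsProbabilityMeasure (Pn n))
    (hmom : ∀ n, Integrable (fun x => ‖x‖) (Pn n))
    (hconv : Tendsto (fun n => mallows1 (Pn n) P) atTop (nhds 0)) {fs : Rd d → ℝ}
    (hfs : IsLCProj P fs) {ε : ℝ} (hε : 0 < ε) :
    ∀ᶠ n in atTop, ∀ f : Rd d → ℝ, IsLCDensity f → (∀ᵐ x ∂(Pn n), 0 < f x) →
      Integrable (fun x => Real.log (f x)) (Pn n) →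
      ∫ x, Real.log (f x) ∂(Pn n) ≤ ∫ x, Real.log (fs x) ∂P + ε := by
  obtain ⟨s, c, r, η, hr, hη, -, hsp⟩ := exists_spreadOn hP hprob hmom hconv
  have := hP.1
  obtain ⟨L, hL⟩ := exists_lipMajorant s c hr hη (-∫ x, Real.log (fs x) ∂P) (half_pos hε)
  filter_upwards [hsp, eventually_abs_integral_sub_le hP.2.1 hprob hmom hconv L (half_pos hε)]
    with n hn hd f hf hpos hlog
  have := hprob n
  by_contra! hcon
  obtain ⟨F, hF⟩ := hL (Pn n) (hprob n) hn f hf hpos hlog (by linarith)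
  have h1 := hF.integral_log_le (hmom n) hpos hlog
  have h2 := abs_le.1 (hd _ hF.lipschitz)
  have h3 := hF.sub_le_of_isLCProj hP.2.1 hf hfs
  linarith [h2.2]

/-- The optimal density of the limit has log-Lipschitz majorants of almost optimal
log-likelihood along the sequence. -/
lemma exists_lipMajorant_eventually_le {Pn : ℕ → Measure (Rd d)} (hP : MemP P)
    (hprob : ∀ n, IsProbabilityMeasure (Pn n))
    (hmom : ∀ n, Integrable (fun x => ‖x‖) (Pn n))
    (hconv : Tendsto (fun n => mallows1 (Pn n) P) atTop (nhds 0)) {fs : Rd d → ℝ}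
    (hfs : IsLCProj P fs) {ε : ℝ} (hε : 0 < ε) :
    ∃ (L : NNReal) (F : Rd d → ℝ), IsLipMajorant L ε fs F ∧
      ∀ᶠ n in atTop, ∫ x, Real.log (fs x) ∂P - ε ≤ ∫ x, Real.log (F x) ∂(Pn n) := by
  obtain ⟨s, c, r, η, hr, hη, hspP, -⟩ := exists_spreadOn hP hprob hmom hconv
  have := hP.1
  obtain ⟨L, hL⟩ := exists_lipMajorant s c hr hη (-∫ x, Real.log (fs x) ∂P) hε
  obtain ⟨F, hF⟩ := hL P hP.1 hspP fs hfs.1 hfs.2.1 hfs.2.2.1 (by rw [neg_neg])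
  refine ⟨L, F, hF, ?_⟩
  filter_upwards [eventually_abs_integral_sub_le hP.2.1 hprob hmom hconv L hε] with n hd
  have h1 := hF.integral_log_le hP.2.1 hfs.2.1 hfs.2.2.1
  have h2 := abs_le.1 (hd _ hF.lipschitz)
  linarith [h2.1]

lemma Lstar_eq {Pn : ℕ → Measure (Rd d)} (hP : MemP P)
    (hprob : ∀ n, IsProbabilityMeasure (Pn n))
    (hmom : ∀ n, Integrable (fun x => ‖x‖) (Pn n))
    (hconv : Tendsto (fun n => mallows1 (Pn n) P) atTop (nhds 0)) {fs : Rd d → ℝ}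
    (hfs : IsLCProj P fs) {a b : ℝ} (ha : 0 < a) (hdec : ∀ x, fs x ≤ Real.exp (b - a * ‖x‖)) :
    Lstar P = ((∫ x, Real.log (fs x) ∂P - 1 : ℝ) : EReal) := by
  obtain ⟨s, c, r, η, hr, hη, hspP, -⟩ := exists_spreadOn hP hprob hmom hconv
  have := hP.1
  refine le_antisymm (hspP.Lstar_le hr hη fun f hf hpos hlog => ?_) ?_
  · linarith [hfs.2.2.2 f hf hpos hlog]
  · have h := coe_le_Lstar hfs.1.2.2 hfs.1.2.1 hfs.1.integrable ha hdec hfs.2.1 hfs.2.2.1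
    rwa [hfs.1.integral_eq_one] at h

lemma tendsto_Lstar {Pn : ℕ → Measure (Rd d)} (hP : MemP P)
    (hprob : ∀ n, IsProbabilityMeasure (Pn n))
    (hmom : ∀ n, Integrable (fun x => ‖x‖) (Pn n))
    (hconv : Tendsto (fun n => mallows1 (Pn n) P) atTop (nhds 0)) {fs : Rd d → ℝ}
    (hfs : IsLCProj P fs) :
    Tendsto (fun n => Lstar (Pn n)) atTop
      (𝓝 ((∫ x, Real.log (fs x) ∂P - 1 : ℝ) : EReal)) := by
  obtain ⟨s, c, r, η, hr, hη, -, hsp⟩ := exists_spreadOn hP hprob hmom hconv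
  set ℓ := ∫ x, Real.log (fs x) ∂P with hℓ
  refine tendsto_order.2 ⟨fun y hy => ?_, fun y hy => ?_⟩
  · obtain ⟨z, hyz, hz⟩ := EReal.lt_iff_exists_real_btwn.1 hy
    have hz' := EReal.coe_lt_coe_iff.1 hz
    set ε := (ℓ - 1 - z) / 2 with hε
    obtain ⟨L, F, hF, hev⟩ := exists_lipMajorant_eventually_le hP hprob hmom hconv hfs
      (show 0 < ε by rw [hε]; linarith)
    filter_upwards [hev] with n hn
    have := hprob n
    refine hyz.trans_le (le_trans (EReal.coe_le_coe_iff.2 ?_) (hF.coe_le_Lstar (hmom n)))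
    linarith [hF.integral_le]
  · obtain ⟨z, hz, hzy⟩ := EReal.lt_iff_exists_real_btwn.1 hy
    have hz' := EReal.coe_lt_coe_iff.1 hz
    filter_upwards [hsp, eventually_integral_log_le hP hprob hmom hconv hfs
      (show 0 < z - (ℓ - 1) by linarith)] with n hn hup
    have := hprob n
    refine lt_of_le_of_lt (hn.Lstar_le hr hη fun f hf hpos hlog => ?_) hzy
    linarith [hup f hf hpos hlog]

end Majorant

section TotalVariation

variable {d : ℕ} {P Q : Measure (Rd d)} {s : Finset (Rd d)} {c : Rd d} {r η : ℝ}

lemma UpperSemicontinuous.mul_continuous_of_pos {f F : Rd d → ℝ} (hf : UpperSemicontinuous f)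
    (hF : Continuous F) (hF0 : ∀ x, 0 < F x) : UpperSemicontinuous fun x => f x * F x := by
  intro x y hy
  have h1 : f x < y / F x := (lt_div_iff₀ (hF0 x)).2 hy
  obtain ⟨u, hu1, hu2⟩ := exists_between h1
  have h2 : ∀ᶠ z in 𝓝 x, u * F z < y :=
    (hF.const_mul u).continuousAt.eventually_lt_const ((lt_div_iff₀ (hF0 x)).1 hu2)
  filter_upwards [hf x u hu1, h2] with z hz1 hz2
  exact (mul_le_mul_of_nonneg_right hz1.le (hF0 z).le).trans_lt hz2

lemma IsLogConcaveFn.sqrt_mul {f F : Rd d → ℝ} (hf : IsLogConcaveFn f) (hF : IsLogConcaveFn F) :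
    IsLogConcaveFn fun x => √(f x * F x) := by
  refine ⟨fun x => Real.sqrt_nonneg _, fun x y t ht => ?_⟩
  have hfx := hf.1 x
  have hfy := hf.1 y
  have hFx := hF.1 x
  have hFy := hF.1 y
  have e : ∀ u p : ℝ, 0 ≤ u → √u ^ p = √(u ^ p) := fun u p hu => by
    rw [Real.sqrt_eq_rpow, Real.sqrt_eq_rpow, ← Real.rpow_mul hu, ← Real.rpow_mul hu, mul_comm]
  rw [e _ _ (by positivity), e _ _ (by positivity), ← Real.sqrt_mul (by positivity)]
  refine Real.sqrt_le_sqrt ?_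
  rw [Real.mul_rpow hfx hFx, Real.mul_rpow hfy hFy, mul_mul_mul_comm]
  exact mul_le_mul (hf.2 x y t ht) (hF.2 x y t ht) (by positivity) (hf.1 _)

lemma integrable_sqrt_mul {f F : Rd d → ℝ} (hf0 : ∀ x, 0 ≤ f x) (hF0 : ∀ x, 0 ≤ F x)
    (hf : Integrable f) (hF : Integrable F) : Integrable fun x => √(f x * F x) := by
  refine (hf.add hF).mono' ?_ (ae_of_all _ fun x => ?_)
  · exact Real.continuous_sqrt.comp_aestronglyMeasurable (hf.1.mul hF.1)
  · rw [Real.norm_of_nonneg (Real.sqrt_nonneg _)]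
    refine Real.sqrt_le_iff.2 ⟨add_nonneg (hf0 x) (hF0 x), ?_⟩
    simp only [Pi.add_apply]
    nlinarith [hf0 x, hF0 x, mul_nonneg (hf0 x) (hF0 x)]

lemma abs_sub_le_of_sqrt {u v σ : ℝ} (hu : 0 ≤ u) (hv : 0 ≤ v) (hσ : 0 < σ) :
    |u - v| ≤ σ * (u + v) + (u + v - 2 * √(u * v)) / (2 * σ) := by
  rw [Real.sqrt_mul hu]
  have h1 := Real.mul_self_sqrt hu
  have h2 := Real.mul_self_sqrt hv
  set p := √u
  set q := √v
  have e : |u - v| = |p - q| * (p + q) := by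
    have hpq : 0 ≤ p + q := add_nonneg (Real.sqrt_nonneg _) (Real.sqrt_nonneg _)
    have h : u - v = (p - q) * (p + q) := by rw [← h1, ← h2]; ring
    rw [h, abs_mul, abs_of_nonneg hpq]
  have h3 : u + v - 2 * (p * q) = |p - q| ^ 2 := by rw [sq_abs, ← h1, ← h2]; ring
  have h4 : (p + q) ^ 2 ≤ 2 * (u + v) := by rw [← h1, ← h2]; nlinarith [sq_nonneg (p - q)]
  rw [e, h3, ← sub_le_iff_le_add', le_div_iff₀ (by positivity)]
  nlinarith [sq_nonneg (|p - q| - σ * (p + q)), mul_le_mul_of_nonneg_left h4 (sq_nonneg σ)]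

lemma IsLCProj.integral_abs_sub_le [IsProbabilityMeasure Q] (hr : 0 < r) (hη : 0 < η)
    (hsp : SpreadOn s c r η Q) (hQ : Integrable (fun x => ‖x‖) Q) {L : NNReal}
    {fs F g : Rd d → ℝ} (hfs : IsLCDensity fs) {σ M : ℝ} (hσ : 0 < σ) (hσ1 : σ ≤ 1)
    (hF : IsLipMajorant L (σ ^ 2) fs F) (hg : IsLCProj Q g)
    (hup : ∫ x, Real.log (g x) ∂Q ≤ M + σ ^ 2) (hlow : M - σ ^ 2 ≤ ∫ x, Real.log (F x) ∂Q) :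
    ∫ x, |g x - fs x| ≤ 6 * σ := by
  obtain ⟨hgd, hgpos, hglog, -⟩ := id hg
  set h : Rd d → ℝ := fun x => √(g x * F x) with hh
  have hlc : IsLogConcaveFn h := hgd.2.2.sqrt_mul hF.logConcave
  have hu : UpperSemicontinuous h :=
    Real.continuous_sqrt.comp_upperSemicontinuous
      (hgd.2.1.mul_continuous_of_pos hF.continuous hF.pos) fun _ _ => Real.sqrt_le_sqrt
  have hi : Integrable h :=
    integrable_sqrt_mul hgd.1.1 (fun x => (hF.pos x).le) hgd.integrable hF.integrable
  have hpos : ∀ᵐ x ∂Q, 0 < h x :=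
    hgpos.mono fun x hx => Real.sqrt_pos.2 (mul_pos hx (hF.pos x))
  have heq : (fun x => Real.log (h x)) =ᵐ[Q]
      fun x => (1 / 2) * (Real.log (g x) + Real.log (F x)) := by
    filter_upwards [hgpos] with x hx
    rw [hh, Real.log_sqrt (mul_pos hx (hF.pos x)).le, Real.log_mul hx.ne' (hF.pos x).ne']
    ring
  have hFlog := hF.integrable_log hQ
  have hlog : Integrable (fun x => Real.log (h x)) Q :=
    ((hglog.add hFlog).const_mul (1 / 2)).congr heq.symm
  have hInt : ∫ x, Real.log (h x) ∂Q
      = (1 / 2) * (∫ x, Real.log (g x) ∂Q + ∫ x, Real.log (F x) ∂Q) := by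
    rw [integral_congr_ae heq, integral_const_mul, integral_add hglog hFlog]
  have h0 := hsp.integral_pos hr hη hlc hu hi hpos
  have h1 := hg.integral_log_le hlc hu hi h0 hpos hlog
  have h2 := Real.log_le_sub_one_of_pos h0
  have h3 : 1 - σ ^ 2 ≤ ∫ x, h x := by linarith
  have hI1 := hF.one_le_integral hfs
  have hI2 := hF.integral_le
  have hgF : ∫ x, |g x - F x| ≤ σ * (1 + ∫ x, F x)
      + (1 + (∫ x, F x) - 2 * ∫ x, h x) / (2 * σ) := by
    have hadd : Integrable fun x => g x + F x := hgd.integrable.add hF.integrable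
    have hsub : Integrable fun x => (g x + F x - 2 * h x) / (2 * σ) :=
      (hadd.sub (hi.const_mul 2)).div_const _
    calc ∫ x, |g x - F x|
        ≤ ∫ x, (σ * (g x + F x) + (g x + F x - 2 * h x) / (2 * σ)) :=
          integral_mono (hgd.integrable.sub hF.integrable).abs
            ((hadd.const_mul σ).add hsub)
            fun x => abs_sub_le_of_sqrt (hgd.1.1 x) (hF.pos x).le hσ
      _ = _ := by
          rw [integral_add (hadd.const_mul σ) hsub,
            integral_const_mul, integral_div, integral_sub hadd (hi.const_mul 2),
            integral_add hgd.integrable hF.integrable, integral_const_mul, hgd.integral_eq_one]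
  have hFf : ∫ x, |F x - fs x| ≤ σ ^ 2 := by
    have : ∀ x, |F x - fs x| = F x - fs x := fun x => abs_of_nonneg (sub_nonneg.2 (hF.le x))
    simp_rw [this]
    rw [integral_sub hF.integrable hfs.integrable, hfs.integral_eq_one]
    linarith
  have h4 : (1 + (∫ x, F x) - 2 * ∫ x, h x) / (2 * σ) ≤ 3 / 2 * σ := by
    rw [div_le_iff₀ (by positivity)]
    nlinarith
  have hσ2 : σ ^ 2 ≤ σ := by nlinarith
  have h5 : σ * (1 + ∫ x, F x) ≤ σ * 3 := mul_le_mul_of_nonneg_left (by nlinarith) hσ.le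
  calc ∫ x, |g x - fs x| ≤ ∫ x, (|g x - F x| + |F x - fs x|) :=
        integral_mono (hgd.integrable.sub hfs.integrable).abs
          ((hgd.integrable.sub hF.integrable).abs.add (hF.integrable.sub hfs.integrable).abs)
          fun x => abs_sub_le _ _ _
    _ = (∫ x, |g x - F x|) + ∫ x, |F x - fs x| :=
        integral_add (hgd.integrable.sub hF.integrable).abs (hF.integrable.sub hfs.integrable).abs
    _ ≤ 6 * σ := by linarith

/-- Total variation convergence of the log-concave projections. -/
lemma eventually_integral_abs_sub_le {Pn : ℕ → Measure (Rd d)} (hP : MemP P)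
    (hprob : ∀ n, IsProbabilityMeasure (Pn n))
    (hmom : ∀ n, Integrable (fun x => ‖x‖) (Pn n))
    (hconv : Tendsto (fun n => mallows1 (Pn n) P) atTop (nhds 0)) {fs : Rd d → ℝ}
    (hfs : IsLCProj P fs) {ε : ℝ} (hε : 0 < ε) :
    ∀ᶠ n in atTop, ∀ g, IsLCProj (Pn n) g → ∫ x, |g x - fs x| ≤ ε := by
  obtain ⟨s, c, r, η, hr, hη, -, hsp⟩ := exists_spreadOn hP hprob hmom hconv
  set σ := min 1 (ε / 6) with hσ
  have hσ0 : 0 < σ := lt_min one_pos (by positivity)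
  obtain ⟨L, F, hF, hev⟩ := exists_lipMajorant_eventually_le hP hprob hmom hconv hfs
    (show 0 < σ ^ 2 by positivity)
  filter_upwards [hsp, hev, eventually_integral_log_le hP hprob hmom hconv hfs
    (show 0 < σ ^ 2 by positivity)] with n hn hlow hup g hg
  have := hprob n
  have h := hg.integral_abs_sub_le hr hη hn (hmom n) hfs.1 hσ0 (min_le_left _ _) hF
    (hup g hg.1 hg.2.1 hg.2.2.1) hlow
  have : σ ≤ ε / 6 := min_le_right _ _
  linarith

/-- The log-concave projections are eventually bounded below on a fixed ball. -/
lemma exists_eventually_le_on_ball {Pn : ℕ → Measure (Rd d)} (hP : MemP P)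
    (hprob : ∀ n, IsProbabilityMeasure (Pn n))
    (hmom : ∀ n, Integrable (fun x => ‖x‖) (Pn n))
    (hconv : Tendsto (fun n => mallows1 (Pn n) P) atTop (nhds 0)) {fs : Rd d → ℝ}
    (hfs : IsLCProj P fs) :
    ∃ (c : Rd d) (r k : ℝ), 0 < r ∧ 0 < k ∧
      ∀ᶠ n in atTop, ∀ g, IsLCProj (Pn n) g → ∀ x ∈ Metric.ball c r, k ≤ g x := by
  obtain ⟨s, c, r, η, hr, hη, -, hsp⟩ := exists_spreadOn hP hprob hmom hconv
  obtain ⟨k, hk, hkf⟩ := exists_uniform_le_on_ball s c hr hη (-(∫ x, Real.log (fs x) ∂P - 2))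
  obtain ⟨L, F, hF, hev⟩ := exists_lipMajorant_eventually_le hP hprob hmom hconv hfs one_pos
  refine ⟨c, r, k, hr, hk, ?_⟩
  filter_upwards [hsp, hev] with n hn hlow g hg
  have := hprob n
  have h1 := hF.sub_le_of_isLCProj (hmom n) hfs.1 hg
  exact hkf (Pn n) (hprob n) hn g hg.1.2.2 hg.1.2.1 hg.1.integrable hg.1.integral_eq_one.le hg.2.1
    hg.2.2.1 (by linarith)

end TotalVariation

section Weighted

variable {d : ℕ}

/-- Log-concave densities which are `L¹`-close to a function with exponential decay of rate `α₀`
have uniform exponential decay of any smaller rate. -/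
lemma exists_exp_decay_of_integral_abs_sub_le (c : Rd d) {k r : ℝ} (hk : 0 < k) (hr : 0 < r)
    {f : Rd d → ℝ} {α₀ β₀ : ℝ} (hα₀ : 0 < α₀) (hf : Integrable f)
    (hbd : ∀ x, f x ≤ Real.exp (β₀ - α₀ * ‖x‖)) {α' : ℝ} (hα' : 0 < α') (hlt : α' < α₀) :
    ∃ ε b : ℝ, 0 < ε ∧ ∀ g : Rd d → ℝ, IsLogConcaveFn g → Integrable g → ∫ x, g x ≤ 1 →
      (∀ x ∈ Metric.ball c r, k ≤ g x) → ∫ x, |g x - f x| ≤ ε →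
      ∀ x, g x ≤ Real.exp (b - α' * ‖x‖) := by
  set V := volume.real (Metric.ball (0 : Rd d) (r / 2)) with hV
  have hV0 : 0 < V := volume_real_ball_pos 0 (half_pos hr)
  set C := Real.log 4 + 2 * β₀ + α₀ * (2 * ‖c‖ + r) - 2 * Real.log k with hC
  obtain ⟨R, hR0, hR⟩ : ∃ R : ℝ, 0 < R ∧ C ≤ (α₀ - α') * R := by
    refine ⟨max 1 (C / (α₀ - α')), lt_max_of_lt_left one_pos, ?_⟩
    have h := le_max_right 1 (C / (α₀ - α'))
    rw [div_le_iff₀ (by linarith)] at h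
    linarith
  set S := Real.exp (β₀ + α₀ * (‖c‖ + r / 2) - α₀ * R / 2) with hS
  set M := (1 / V) ^ 2 / k with hM
  have hM0 : 0 ≤ M := by positivity
  set B := k * Real.exp (α' * ‖c‖) + M * Real.exp (α' * (R + ‖c‖)) with hB
  have hB0 : 0 < B := by positivity
  refine ⟨S * V, Real.log B, by positivity, fun g hg hi h1 hball hclose x => ?_⟩
  have hcr : k ≤ g c := hball c (Metric.mem_ball_self hr)
  have hsphere : ∀ x, ‖x - c‖ = R → g x ≤ k * Real.exp (-(α' * R)) := fun x hx => by
    have hgx := hg.1 x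
    set A := k ^ (1 - 1 / 2 : ℝ) * g x ^ (1 / 2 : ℝ) with hA
    have hA2 : A ^ 2 = k * g x := by
      rw [hA, mul_pow, ← Real.rpow_natCast, ← Real.rpow_natCast, ← Real.rpow_mul hk.le,
        ← Real.rpow_mul hgx]
      norm_num
    have hA0 : 0 ≤ A := by positivity
    have hmem : ∀ z ∈ Metric.ball (c + (1 / 2 : ℝ) • (x - c)) (r / 2), A - S ≤ |g z - f z| := by
      intro z hz
      have e : (1 - 1 / 2) * r = r / 2 := by ring
      have h2 : A ≤ g z := hg.rpow_mul_le_of_mem_ball hk hball (by norm_num) (by norm_num) x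
        (by rwa [e])
      have h3 : R / 2 - ‖c‖ - r / 2 ≤ ‖z‖ := by
        have h4 : ‖(1 / 2 : ℝ) • (x - c)‖ = R / 2 := by
          rw [norm_smul, hx, Real.norm_of_nonneg (by norm_num)]; ring
        have h5 : ‖z - (c + (1 / 2 : ℝ) • (x - c))‖ < r / 2 := by rwa [← dist_eq_norm]
        have h6 : (1 / 2 : ℝ) • (x - c) = z - c - (z - (c + (1 / 2 : ℝ) • (x - c))) := by abel
        have h7 := norm_sub_le (z - c) (z - (c + (1 / 2 : ℝ) • (x - c)))
        rw [← h6, h4] at h7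
        linarith [norm_sub_le z c]
      have h4 : f z ≤ S := (hbd z).trans (Real.exp_le_exp.2 (by nlinarith))
      linarith [le_abs_self (g z - f z)]
    have h2 := mul_measureReal_le_integral (fun z => abs_nonneg (g z - f z)) (hi.sub hf).abs
      Metric.isOpen_ball.measurableSet measure_ball_lt_top.ne hmem
    rw [volume_real_ball] at h2
    have h3 : A ≤ 2 * S := by
      have := le_of_mul_le_mul_right (h2.trans hclose) hV0
      linarith
    have h4 : k * g x ≤ 4 * S ^ 2 := by rw [← hA2]; nlinarith
    have h5 : 4 * S ^ 2 = k * (k * Real.exp (C - α₀ * R)) := by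
      have e : Real.exp (C - α₀ * R) =
          4 * Real.exp (2 * (β₀ + α₀ * (‖c‖ + r / 2) - α₀ * R / 2)) / (k * k) := by
        have e' : C - α₀ * R = Real.log 4 + 2 * (β₀ + α₀ * (‖c‖ + r / 2) - α₀ * R / 2)
            - (Real.log k + Real.log k) := by rw [hC]; ring
        rw [e', Real.exp_sub, Real.exp_add, Real.exp_add, Real.exp_log hk,
          Real.exp_log (by norm_num)]
      rw [e, hS, ← Real.exp_nat_mul]
      push_cast
      field_simp
    rw [h5] at h4
    refine (le_of_mul_le_mul_left h4 hk).trans ?_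
    exact mul_le_mul_of_nonneg_left (Real.exp_le_exp.2 (by linarith)) hk.le
  have hBx : Real.exp (Real.log B - α' * ‖x‖) = B * Real.exp (-(α' * ‖x‖)) := by
    rw [sub_eq_add_neg, Real.exp_add, Real.exp_log hB0]
  rw [hBx, hB, add_mul, mul_assoc, mul_assoc, ← Real.exp_add, ← Real.exp_add]
  rcases le_or_gt R ‖x - c‖ with hx | hx
  · have h2 := hg.le_of_le_on_sphere hk hcr hR0 hsphere hx
    have h3 : Real.exp (-(α' * R * (‖x - c‖ / R))) ≤
        Real.exp (α' * ‖c‖ + -(α' * ‖x‖)) := by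
      have e : α' * R * (‖x - c‖ / R) = α' * ‖x - c‖ := by field_simp
      rw [e]
      exact Real.exp_le_exp.2 (by nlinarith [norm_sub_norm_le x c])
    have h4 := mul_le_mul_of_nonneg_left h3 hk.le
    have : 0 ≤ M * Real.exp (α' * (R + ‖c‖) + -(α' * ‖x‖)) := by positivity
    linarith
  · have h2 : g x ≤ M := hg.le_of_ball hi h1 hk hr hball x
    have h3 : 1 ≤ Real.exp (α' * (R + ‖c‖) + -(α' * ‖x‖)) :=
      Real.one_le_exp (by nlinarith [norm_sub_norm_le x c])
    have h4 := mul_le_mul_of_nonneg_left h3 hM0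
    have : 0 ≤ k * Real.exp (α' * ‖c‖ + -(α' * ‖x‖)) := by positivity
    linarith

/-- Uniform exponential decay upgrades `L¹`-closeness to closeness in exponentially weighted
`L¹`. -/
lemma exists_lintegral_exp_mul_abs_sub_le {α α' : ℝ} (hlt : α < α') (b : ℝ) {ε : ℝ} (hε : 0 < ε) :
    ∃ δ : ℝ, 0 < δ ∧ ∀ f g : Rd d → ℝ, (∀ x, 0 ≤ f x) → (∀ x, 0 ≤ g x) → Integrable f →
      Integrable g → (∀ x, f x ≤ Real.exp (b - α' * ‖x‖)) →
      (∀ x, g x ≤ Real.exp (b - α' * ‖x‖)) → ∫ x, |g x - f x| ≤ δ →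
      ∫⁻ x, ENNReal.ofReal (Real.exp (α * ‖x‖) * |g x - f x|) ≤ ENNReal.ofReal ε := by
  set γ := (α' - α) / 2 with hγ
  have hγ0 : 0 < γ := by rw [hγ]; linarith
  have hiT := integrable_exp_sub_mul_norm (d := d) hγ0 b
  set T := ∫ x : Rd d, Real.exp (b - γ * ‖x‖) with hT
  have hlim : Tendsto (fun R : ℝ => Real.exp (-(γ * R)) * T) atTop (𝓝 0) := by
    have h := (Real.tendsto_exp_neg_atTop_nhds_zero.comp
      (tendsto_id.const_mul_atTop hγ0)).mul_const T
    simpa using h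
  obtain ⟨R, hRT, hR0⟩ :=
    ((hlim.eventually_lt_const (half_pos hε)).and (eventually_ge_atTop 0)).exists
  refine ⟨ε / 2 / Real.exp (|α| * R), by positivity, fun f g hf0 hg0 hf hg hfb hgb hfg => ?_⟩
  have hd := (hg.sub hf).abs
  have hpt : ∀ x, Real.exp (α * ‖x‖) * |g x - f x| ≤
      Real.exp (|α| * R) * |g x - f x| + Real.exp (-(γ * R)) * Real.exp (b - γ * ‖x‖) := by
    intro x
    rcases le_or_gt ‖x‖ R with hx | hx
    · have h1 : Real.exp (α * ‖x‖) ≤ Real.exp (|α| * R) := Real.exp_le_exp.2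
        ((mul_le_mul_of_nonneg_right (le_abs_self α) (norm_nonneg x)).trans
          (mul_le_mul_of_nonneg_left hx (abs_nonneg α)))
      have h2 := mul_le_mul_of_nonneg_right h1 (abs_nonneg (g x - f x))
      have : 0 ≤ Real.exp (-(γ * R)) * Real.exp (b - γ * ‖x‖) := by positivity
      linarith
    · have h1 : |g x - f x| ≤ Real.exp (b - α' * ‖x‖) :=
        abs_le.2 ⟨by linarith [hg0 x, hfb x], by linarith [hf0 x, hgb x]⟩
      have h2 : Real.exp (α * ‖x‖) * |g x - f x| ≤
          Real.exp (-(γ * R)) * Real.exp (b - γ * ‖x‖) := by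
        refine (mul_le_mul_of_nonneg_left h1 (Real.exp_pos _).le).trans ?_
        rw [← Real.exp_add, ← Real.exp_add]
        refine Real.exp_le_exp.2 ?_
        have e : α = α' - 2 * γ := by rw [hγ]; ring
        rw [e]
        nlinarith
      have : 0 ≤ Real.exp (|α| * R) * |g x - f x| := by positivity
      linarith
  calc ∫⁻ x, ENNReal.ofReal (Real.exp (α * ‖x‖) * |g x - f x|)
      ≤ ∫⁻ x, ENNReal.ofReal (Real.exp (|α| * R) * |g x - f x| +
          Real.exp (-(γ * R)) * Real.exp (b - γ * ‖x‖)) :=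
        lintegral_mono fun x => ENNReal.ofReal_le_ofReal (hpt x)
    _ = ENNReal.ofReal (∫ x, (Real.exp (|α| * R) * |g x - f x| +
          Real.exp (-(γ * R)) * Real.exp (b - γ * ‖x‖))) :=
        (ofReal_integral_eq_lintegral_ofReal ((hd.const_mul _).add (hiT.const_mul _))
          (ae_of_all _ fun x => add_nonneg (by positivity) (by positivity))).symm
    _ ≤ ENNReal.ofReal ε := by
        refine ENNReal.ofReal_le_ofReal ?_
        have e := integral_add (hd.const_mul (Real.exp (|α| * R)))
          (hiT.const_mul (Real.exp (-(γ * R))))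
        rw [integral_const_mul, integral_const_mul] at e
        refine e.le.trans ?_
        rw [le_div_iff₀ (Real.exp_pos _), mul_comm] at hfg
        have : Real.exp (|α| * R) * ∫ x, |g x - f x| ≤ ε / 2 := hfg
        calc _ ≤ ε / 2 + ε / 2 := add_le_add this hRT.le
          _ = ε := by ring

end Weighted

/-- Continuity of the log-concave projection with respect to the Mallows distance. -/
theorem statement14 (d : ℕ) (P : Measure (Rd d)) (hP : MemP P)
    (Pn : ℕ → Measure (Rd d)) (hprob : ∀ n, IsProbabilityMeasure (Pn n))
    (hmom : ∀ n, Integrable (fun x => ‖x‖) (Pn n))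
    (hconv : Tendsto (fun n => mallows1 (Pn n) P) atTop (nhds 0))
    (fs : Rd d → ℝ) (hfs : IsLCProj P fs)
    (α₀ β₀ : ℝ) (hα₀ : 0 < α₀) (hbd : ∀ x, fs x ≤ Real.exp (-α₀ * ‖x‖ + β₀)) :
    Tendsto (fun n => Lstar (Pn n)) atTop (nhds (Lstar P)) ∧
    (∀ᶠ n in atTop, MemP (Pn n)) ∧
    ∀ α : ℝ, α < α₀ → ∀ g : ℕ → Rd d → ℝ,
      (∀ᶠ n in atTop, IsLCProj (Pn n) (g n)) →
      Tendsto
        (fun n => ∫⁻ x, ENNReal.ofReal (Real.exp (α * ‖x‖) * |g n x - fs x|))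
        atTop (nhds 0) := by
  have hbd' : ∀ x, fs x ≤ Real.exp (β₀ - α₀ * ‖x‖) := fun x =>
    (hbd x).trans_eq (by congr 1; ring)
  refine ⟨?_, ?_, fun α hα g hg => ?_⟩
  · rw [Lstar_eq hP hprob hmom hconv hfs hα₀ hbd']
    exact tendsto_Lstar hP hprob hmom hconv hfs
  · obtain ⟨s, c, r, η, hr, hη, -, hsp⟩ := exists_spreadOn hP hprob hmom hconv
    filter_upwards [hsp] with n hn
    have := hprob n
    exact hn.memP hr hη (hmom n)
  · obtain ⟨α', hα', hα'α₀⟩ := exists_between (max_lt hα hα₀)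
    obtain ⟨hαα', hα'0⟩ := max_lt_iff.1 hα'
    obtain ⟨c, r, k, hr, hk, hball⟩ := exists_eventually_le_on_ball hP hprob hmom hconv hfs
    obtain ⟨ε₁, b, hε₁, hdec⟩ := exists_exp_decay_of_integral_abs_sub_le c hk hr hα₀
      hfs.1.integrable hbd' hα'0 hα'α₀
    refine ENNReal.tendsto_nhds_zero.2 fun ε hε => ?_
    obtain ⟨e, he, heε⟩ := ENNReal.lt_iff_exists_nnreal_btwn.1 hε
    obtain ⟨δ, hδ, hclose⟩ := exists_lintegral_exp_mul_abs_sub_le (d := d) hαα' (max b β₀)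
      (NNReal.coe_pos.2 (ENNReal.coe_pos.1 he))
    filter_upwards [hg, hball, eventually_integral_abs_sub_le hP hprob hmom hconv hfs hε₁,
      eventually_integral_abs_sub_le hP hprob hmom hconv hfs hδ] with n hn hb h1 h2
    have hgn := hdec (g n) hn.1.2.2 hn.1.integrable hn.1.integral_eq_one.le (hb _ hn) (h1 _ hn)
    have h3 := hclose fs (g n) hfs.1.1.1 hn.1.1.1 hfs.1.integrable hn.1.integrable
      (fun x => (hbd' x).trans (Real.exp_le_exp.2 (by
        nlinarith [le_max_right b β₀, norm_nonneg x])))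
      (fun x => (hgn x).trans (Real.exp_le_exp.2 (by linarith [le_max_left b β₀]))) (h2 _ hn)
    rw [ENNReal.ofReal_coe_nnreal] at h3
    exact h3.trans heε.le
end
end

section
/- For each d ∈ ℕ there exists a constant c_d > 0 such that, for all n ∈ ℕ, inf over all estimators f̃_n (i.e., all jointly measurable maps from (ℝ^d)^n × ℝ^d to [0,∞) such that f̃_n(x₁,…,x_n; ·) is a probability density for each (x₁,…,x_n)) of sup over f₀ ∈ F_d of E_{f₀} d_H²(f̃_n(X₁,…,X_n; ·), f₀) — where X₁,…,X_n are i.i.d. with density f₀ — is at least c₁ n^{−4/5} when d = 1, and at least c_d n^{−2/(d+1)} when d ≥ 2. -/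
open MeasureTheory Filter Set
open scoped ENNReal Topology

noncomputable section

/-- Squared Hellinger distance between two densities. -/
def hellingerSq {E : Type*} [MeasureSpace E] (f g : E → ℝ) : ℝ :=
  ∫ x, (Real.sqrt (f x) - Real.sqrt (g x)) ^ 2


theorem lintegral_fin_prod_eq_prod {E : Type*} [MeasurableSpace E] {n : ℕ}
    {μ : Fin n → Measure E} [∀ i, SigmaFinite (μ i)] {f : Fin n → E → ℝ≥0∞}
    (hf : ∀ i, Measurable (f i)) :
    ∫⁻ x, ∏ i, f i (x i) ∂(Measure.pi μ) = ∏ i, ∫⁻ x, f i x ∂(μ i) := by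
  induction n with
  | zero => simp
  | succ n ih =>
    rw [← ((measurePreserving_piFinSuccAbove μ 0).symm).lintegral_comp_emb
      (MeasurableEquiv.measurableEmbedding _)]
    simp_rw [MeasurableEquiv.piFinSuccAbove_symm_apply, Fin.insertNthEquiv,
      Fin.prod_univ_succ, Fin.insertNth_zero, Equiv.coe_fn_mk, Fin.cons_succ,
      Fin.zero_succAbove, cast_eq, Fin.cons_zero]
    rw [← ih fun i => hf i.succ,
      lintegral_prod_mul (f := f 0) (g := fun y : Fin n → E => ∏ i : Fin n, f i.succ (y i))
        (hf 0).aemeasurable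
        (Finset.measurable_fun_prod _ fun i _ =>
          (hf i.succ).comp (measurable_pi_apply i)).aemeasurable]

theorem pi_withDensity_fin {E : Type*} [MeasurableSpace E] {n : ℕ}
    {μ : Measure E} [SigmaFinite μ] {f : E → ℝ≥0∞} (hf : Measurable f)
    [SigmaFinite (μ.withDensity f)] :
    Measure.pi (fun _ : Fin n => μ.withDensity f) =
      (Measure.pi fun _ : Fin n => μ).withDensity fun x => ∏ i, f (x i) := by
  refine Measure.pi_eq fun s hs => ?_
  rw [withDensity_apply _ (MeasurableSet.univ_pi hs), Measure.restrict_pi_pi,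
    lintegral_fin_prod_eq_prod fun _ => hf]
  simp_rw [withDensity_apply _ (hs _)]

/-- The affinity of two product densities is at least `3/4` when the squared Hellinger distance of
the factors is at most `1 / (2 n)`. -/
theorem three_quarters_le_affinity_pow {E : Type*} [MeasurableSpace E] {μ : Measure E}
    {p q : E → ℝ} (hp0 : ∀ x, 0 ≤ p x) (hq0 : ∀ x, 0 ≤ q x)
    (hp : Measurable p) (hq : Measurable q) (hp1 : ∫⁻ x, ENNReal.ofReal (p x) ∂μ = 1)
    (hq1 : ∫⁻ x, ENNReal.ofReal (q x) ∂μ = 1) {γ : ℝ} (hγ : 0 ≤ γ)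
    (hH : ∫⁻ x, ENNReal.ofReal ((√(p x) - √(q x)) ^ 2) ∂μ ≤ ENNReal.ofReal γ)
    {n : ℕ} (hn : 1 ≤ n) (hnγ : n * γ ≤ 1 / 2) :
    ENNReal.ofReal (3 / 4) ≤ (∫⁻ x, ENNReal.ofReal √(p x * q x) ∂μ) ^ n := by
  set ρ := ∫⁻ x, ENNReal.ofReal √(p x * q x) ∂μ with hρ
  have hn' : (1 : ℝ) ≤ n := by exact_mod_cast hn
  have key : 2 ≤ 2 * ρ + ENNReal.ofReal γ := by
    calc (2 : ℝ≥0∞) = ∫⁻ x, ENNReal.ofReal (p x) ∂μ + ∫⁻ x, ENNReal.ofReal (q x) ∂μ := by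
          rw [hp1, hq1]; norm_num
      _ = ∫⁻ x, (ENNReal.ofReal (p x) + ENNReal.ofReal (q x)) ∂μ := by
          rw [lintegral_add_left hp.ennreal_ofReal]
      _ = ∫⁻ x, (2 * ENNReal.ofReal √(p x * q x) +
            ENNReal.ofReal ((√(p x) - √(q x)) ^ 2)) ∂μ := by
          refine lintegral_congr fun x => ?_
          rw [← ENNReal.ofReal_add (hp0 x) (hq0 x),
            show (2 : ℝ≥0∞) = ENNReal.ofReal 2 by norm_num,
            ← ENNReal.ofReal_mul (by norm_num),
            ← ENNReal.ofReal_add (by positivity) (by positivity), Real.sqrt_mul (hp0 x)]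
          congr 1
          nlinarith [Real.sq_sqrt (hp0 x), Real.sq_sqrt (hq0 x)]
      _ = 2 * ρ + ∫⁻ x, ENNReal.ofReal ((√(p x) - √(q x)) ^ 2) ∂μ := by
          rw [lintegral_add_left (by fun_prop), lintegral_const_mul _ (by fun_prop)]
      _ ≤ _ := by gcongr
  have hρ1 : ENNReal.ofReal (1 - γ / 2) ≤ ρ := by
    rcases eq_or_ne ρ ⊤ with h | h
    · simp [h]
    · rw [ENNReal.ofReal_le_iff_le_toReal h]
      have := ENNReal.toReal_mono (by finiteness) key
      rw [ENNReal.toReal_add (by finiteness) (by finiteness), ENNReal.toReal_mul,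
        ENNReal.toReal_ofReal hγ] at this
      norm_num at this
      linarith
  have hγ2 : γ ≤ 1 / 2 := by nlinarith
  calc ENNReal.ofReal (3 / 4) ≤ ENNReal.ofReal ((1 - γ / 2) ^ n) := by
        apply ENNReal.ofReal_le_ofReal
        have := one_add_mul_le_pow (a := -(γ / 2)) (by linarith) n
        rw [← sub_eq_add_neg] at this
        linarith
    _ = ENNReal.ofReal (1 - γ / 2) ^ n := by rw [ENNReal.ofReal_pow (by linarith)]
    _ ≤ _ := by gcongr

/-- Two-point bound for product measures whose factors are Hellinger-close. -/
theorem two_point_lower_bound {E : Type*} [MeasurableSpace E] {μ : Measure E} [SigmaFinite μ]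
    {p q : E → ℝ} (hp0 : ∀ x, 0 ≤ p x) (hq0 : ∀ x, 0 ≤ q x)
    (hp : Measurable p) (hq : Measurable q) (hp1 : ∫⁻ x, ENNReal.ofReal (p x) ∂μ = 1)
    (hq1 : ∫⁻ x, ENNReal.ofReal (q x) ∂μ = 1) {γ : ℝ} (hγ : 0 ≤ γ)
    (hH : ∫⁻ x, ENNReal.ofReal ((√(p x) - √(q x)) ^ 2) ∂μ ≤ ENNReal.ofReal γ)
    {n : ℕ} (hn : 1 ≤ n) (hnγ : n * γ ≤ 1 / 2) {h₀ h₁ : (Fin n → E) → ℝ≥0∞}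
    (hh₀ : Measurable h₀) (hh₁ : Measurable h₁) {a : ℝ≥0∞} (ha : ∀ xs, a ≤ h₀ xs + h₁ xs) :
    a / 4 ≤
      ∫⁻ xs, h₀ xs ∂(Measure.pi fun _ => μ.withDensity fun x => ENNReal.ofReal (p x)) +
      ∫⁻ xs, h₁ xs ∂(Measure.pi fun _ => μ.withDensity fun x => ENNReal.ofReal (q x)) := by
  have : IsFiniteMeasure (μ.withDensity fun x => ENNReal.ofReal (p x)) :=
    isFiniteMeasure_withDensity (by simp [hp1])
  have : IsFiniteMeasure (μ.withDensity fun x => ENNReal.ofReal (q x)) :=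
    isFiniteMeasure_withDensity (by simp [hq1])
  rw [pi_withDensity_fin (by fun_prop), pi_withDensity_fin (by fun_prop)]
  set ν := Measure.pi fun _ : Fin n => μ
  set P : (Fin n → E) → ℝ≥0∞ := fun xs => ∏ i, ENNReal.ofReal (p (xs i))
  set Q : (Fin n → E) → ℝ≥0∞ := fun xs => ∏ i, ENNReal.ofReal (q (xs i))
  have hP : Measurable P := by fun_prop
  have hQ : Measurable Q := by fun_prop
  rw [lintegral_withDensity_eq_lintegral_mul _ hP hh₀,
    lintegral_withDensity_eq_lintegral_mul _ hQ hh₁, ← lintegral_add_left (hP.mul hh₀)]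
  have hPint : ∫⁻ xs, P xs ∂ν = 1 := by
    rw [lintegral_fin_prod_eq_prod (f := fun _ x => ENNReal.ofReal (p x)) (fun _ => by fun_prop)]
    simp [hp1]
  have hQint : ∫⁻ xs, Q xs ∂ν = 1 := by
    rw [lintegral_fin_prod_eq_prod (f := fun _ x => ENNReal.ofReal (q x)) (fun _ => by fun_prop)]
    simp [hq1]
  have haff : ENNReal.ofReal (3 / 4) ≤ ∫⁻ xs, ∏ i, ENNReal.ofReal √(p (xs i) * q (xs i)) ∂ν := by
    rw [lintegral_fin_prod_eq_prod (f := fun _ x => ENNReal.ofReal √(p x * q x))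
      (fun _ => by fun_prop)]
    simpa using three_quarters_le_affinity_pow hp0 hq0 hp hq hp1 hq1 hγ hH hn hnγ
  have hpt : ∀ xs, ∏ i, ENNReal.ofReal √(p (xs i) * q (xs i)) ≤
      min (P xs) (Q xs) + ENNReal.ofReal (1 / 4) * (P xs + Q xs) := by
    intro xs
    have hP0 : 0 ≤ ∏ i, p (xs i) := Finset.prod_nonneg fun i _ => hp0 _
    have hQ0 : 0 ≤ ∏ i, q (xs i) := Finset.prod_nonneg fun i _ => hq0 _
    simp only [P, Q]
    rw [← ENNReal.ofReal_prod_of_nonneg (fun i _ => hp0 _),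
      ← ENNReal.ofReal_prod_of_nonneg (fun i _ => hq0 _),
      ← ENNReal.ofReal_prod_of_nonneg (fun i _ => Real.sqrt_nonneg _), ← ENNReal.ofReal_min,
      ← ENNReal.ofReal_add hP0 hQ0, ← ENNReal.ofReal_mul (by norm_num),
      ← ENNReal.ofReal_add (le_min hP0 hQ0) (by positivity)]
    apply ENNReal.ofReal_le_ofReal
    rw [← Real.sqrt_prod _ (fun i _ => mul_nonneg (hp0 _) (hq0 _)), Finset.prod_mul_distrib]
    generalize ∏ i, p (xs i) = s at *
    generalize ∏ i, q (xs i) = t at *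
    rw [Real.sqrt_mul hP0]
    rcases le_total s t with h | h
    · rw [min_eq_left h]
      nlinarith [Real.sq_sqrt hP0, Real.sq_sqrt hQ0, sq_nonneg (√s - √t / 2)]
    · rw [min_eq_right h]
      nlinarith [Real.sq_sqrt hP0, Real.sq_sqrt hQ0, sq_nonneg (√t - √s / 2)]
  have hmin : ENNReal.ofReal (1 / 4) ≤ ∫⁻ xs, min (P xs) (Q xs) ∂ν := by
    have h1 : ENNReal.ofReal (3 / 4) ≤
        ∫⁻ xs, min (P xs) (Q xs) ∂ν + ENNReal.ofReal (1 / 2) := by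
      refine haff.trans ((lintegral_mono hpt).trans ?_)
      rw [lintegral_add_left (hP.min hQ), lintegral_const_mul _ (by fun_prop),
        lintegral_add_left hP, hPint, hQint, show (1 + 1 : ℝ≥0∞) = ENNReal.ofReal 2 by norm_num,
        ← ENNReal.ofReal_mul (by norm_num)]
      norm_num
    have h2 : ENNReal.ofReal (3 / 4) = ENNReal.ofReal (1 / 4) + ENNReal.ofReal (1 / 2) := by
      rw [← ENNReal.ofReal_add (by norm_num) (by norm_num)]; norm_num
    rw [h2] at h1
    exact (ENNReal.add_le_add_iff_right ENNReal.ofReal_ne_top).1 h1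
  calc a / 4 = a * ENNReal.ofReal (1 / 4) := by
        rw [div_eq_mul_inv, one_div, ENNReal.ofReal_inv_of_pos (by norm_num)]; norm_num
    _ ≤ a * ∫⁻ xs, min (P xs) (Q xs) ∂ν := by gcongr
    _ ≤ ∫⁻ xs, a * min (P xs) (Q xs) ∂ν := lintegral_const_mul_le _ _
    _ ≤ _ := by
        refine lintegral_mono fun xs => ?_
        calc a * min (P xs) (Q xs) ≤ (h₀ xs + h₁ xs) * min (P xs) (Q xs) := by
              gcongr; exact ha xs
          _ = min (P xs) (Q xs) * h₀ xs + min (P xs) (Q xs) * h₁ xs := by ring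
          _ ≤ P xs * h₀ xs + Q xs * h₁ xs := by
              gcongr
              · exact min_le_left _ _
              · exact min_le_right _ _

theorem lintegral_le_ofReal_hellingerSq {E : Type*} [MeasureSpace E] {f g : E → ℝ}
    (hf : IsDensity f) (hg : IsDensity g) :
    ∫⁻ x, ENNReal.ofReal ((√(f x) - √(g x)) ^ 2) ≤ ENNReal.ofReal (hellingerSq f g) := by
  obtain ⟨hf0, hfm, hf1⟩ := hf
  obtain ⟨hg0, hgm, hg1⟩ := hg
  have hint : Integrable fun x => (√(f x) - √(g x)) ^ 2 := by
    have hfi : Integrable f := ⟨hfm.aestronglyMeasurable, by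
      rw [hasFiniteIntegral_iff_ofReal (Eventually.of_forall hf0), hf1]; simp⟩
    have hgi : Integrable g := ⟨hgm.aestronglyMeasurable, by
      rw [hasFiniteIntegral_iff_ofReal (Eventually.of_forall hg0), hg1]; simp⟩
    refine (hfi.add hgi).mono' (by fun_prop) (Eventually.of_forall fun x => ?_)
    rw [Real.norm_of_nonneg (sq_nonneg _), Pi.add_apply]
    nlinarith [Real.sq_sqrt (hf0 x), Real.sq_sqrt (hg0 x),
      mul_nonneg (Real.sqrt_nonneg (f x)) (Real.sqrt_nonneg (g x))]
  rw [hellingerSq, ofReal_integral_eq_lintegral_ofReal hint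
    (Eventually.of_forall fun x => sq_nonneg _)]

theorem sum_setLIntegral_le {E J : Type*} [MeasurableSpace E] [Fintype J] {μ : Measure E}
    {A : J → Set E} (hA : ∀ j, MeasurableSet (A j)) (hdisj : Pairwise (Function.onFun Disjoint A))
    (g : E → ℝ≥0∞) : ∑ j, ∫⁻ x in A j, g x ∂μ ≤ ∫⁻ x, g x ∂μ := by
  rw [← tsum_fintype (L := .unconditional _), ← lintegral_iUnion hA hdisj]
  exact setLIntegral_le_lintegral _ _

/-- The vertex of the Boolean hypercube obtained by flipping the `j`-th coordinate. -/
def flipAt {J : Type*} [DecidableEq J] (j : J) (τ : J → Bool) : J → Bool :=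
  Function.update τ j (!τ j)

theorem flipAt_involutive {J : Type*} [DecidableEq J] (j : J) :
    Function.Involutive (flipAt j) := fun τ => by
  simp [flipAt]

/-- Assouad's lemma for squared Hellinger risk over a hypercube of densities. -/
theorem assouad_hellinger {E J : Type*} [MeasureSpace E] [SigmaFinite (volume : Measure E)]
    [Fintype J] [DecidableEq J] {f : (J → Bool) → E → ℝ} (hf : ∀ τ, IsDensity (f τ))
    {A : J → Set E} (hA : ∀ j, MeasurableSet (A j)) (hdisj : Pairwise (Function.onFun Disjoint A))
    (hoff : ∀ τ j, ∀ x ∉ A j, f (flipAt j τ) x = f τ x) {α γ : ℝ} (hγ : 0 ≤ γ)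
    (hlow : ∀ τ j, ENNReal.ofReal α ≤
      ∫⁻ x in A j, ENNReal.ofReal ((√(f τ x) - √(f (flipAt j τ) x)) ^ 2))
    (hup : ∀ τ j, ∫⁻ x in A j, ENNReal.ofReal ((√(f τ x) - √(f (flipAt j τ) x)) ^ 2) ≤
      ENNReal.ofReal γ)
    {n : ℕ} (hn : 1 ≤ n) (hnγ : n * γ ≤ 1 / 2) {T : (Fin n → E) → E → ℝ}
    (hT : Measurable (Function.uncurry T)) (hTd : ∀ xs, IsDensity (T xs)) :
    Fintype.card J * (ENNReal.ofReal α / 16) ≤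
      ⨆ τ, ∫⁻ xs, ENNReal.ofReal (hellingerSq (T xs) (f τ))
        ∂(Measure.pi fun _ : Fin n => volume.withDensity fun x => ENNReal.ofReal (f τ x)) := by
  set P : (J → Bool) → Measure (Fin n → E) := fun τ =>
    Measure.pi fun _ : Fin n => volume.withDensity fun x => ENNReal.ofReal (f τ x)
  set R : (J → Bool) → ℝ≥0∞ := fun τ => ∫⁻ xs, ENNReal.ofReal (hellingerSq (T xs) (f τ)) ∂(P τ)
  set h : J → (J → Bool) → (Fin n → E) → ℝ≥0∞ := fun j τ xs =>
    ∫⁻ x in A j, ENNReal.ofReal ((√(T xs x) - √(f τ x)) ^ 2)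
  have hfm : ∀ τ, Measurable (f τ) := fun τ => (hf τ).2.1
  have hf0 : ∀ τ x, 0 ≤ f τ x := fun τ => (hf τ).1
  have hTm : ∀ xs, Measurable (T xs) := fun xs => (hTd xs).2.1
  have hh : ∀ j τ, Measurable (h j τ) := by
    intro j τ
    refine Measurable.lintegral_prod_right'
      (f := fun z : (Fin n → E) × E => ENNReal.ofReal ((√(T z.1 z.2) - √(f τ z.2)) ^ 2)) ?_
    have hT' : Measurable fun z : (Fin n → E) × E => T z.1 z.2 := hT
    have := hfm τ
    fun_prop
  have hR : ∀ τ, ∑ j, ∫⁻ xs, h j τ xs ∂(P τ) ≤ R τ := by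
    intro τ
    rw [← lintegral_finsetSum _ fun j _ => hh j τ]
    exact lintegral_mono fun xs => (sum_setLIntegral_le hA hdisj _).trans
      (lintegral_le_ofReal_hellingerSq (hTd xs) (hf τ))
  have hpair : ∀ j τ, ENNReal.ofReal α / 8 ≤
      ∫⁻ xs, h j τ xs ∂(P τ) + ∫⁻ xs, h j (flipAt j τ) xs ∂(P (flipAt j τ)) := by
    intro j τ
    have hH : ∫⁻ x, ENNReal.ofReal ((√(f τ x) - √(f (flipAt j τ) x)) ^ 2) ≤
        ENNReal.ofReal γ := by
      refine le_trans (le_of_eq ?_) (hup τ j)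
      rw [← lintegral_indicator (hA j)]
      refine lintegral_congr fun x => ?_
      by_cases hx : x ∈ A j
      · simp [hx]
      · simp [hx, hoff τ j x hx]
    have := two_point_lower_bound (a := ENNReal.ofReal α / 2) (hf0 τ) (hf0 (flipAt j τ)) (hfm τ)
      (hfm _) (hf τ).2.2 (hf _).2.2 hγ hH hn hnγ (hh j τ) (hh j (flipAt j τ)) ?_
    · refine le_trans (le_of_eq ?_) this
      rw [div_eq_mul_inv, div_eq_mul_inv, div_eq_mul_inv, mul_assoc,
        ← ENNReal.mul_inv (by simp) (by simp)]
      norm_num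
    · intro xs
      have := hTm xs
      have := hfm τ
      have := hfm (flipAt j τ)
      rw [ENNReal.div_le_iff (by norm_num) (by norm_num)]
      refine (hlow τ j).trans ?_
      simp only [h]
      rw [← lintegral_add_left (by fun_prop), ← lintegral_mul_const _ (by fun_prop)]
      refine lintegral_mono fun x => ?_
      rw [← ENNReal.ofReal_add (by positivity) (by positivity),
        show (2 : ℝ≥0∞) = ENNReal.ofReal 2 by norm_num, ← ENNReal.ofReal_mul (by positivity)]
      apply ENNReal.ofReal_le_ofReal
      nlinarith [sq_nonneg (√(T xs x) - √(f τ x) + (√(T xs x) - √(f (flipAt j τ) x)))]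
  have hj : ∀ j, Fintype.card (J → Bool) * (ENNReal.ofReal α / 8) ≤
      2 * ∑ τ, ∫⁻ xs, h j τ xs ∂(P τ) := by
    intro j
    have hflip : ∑ τ, ∫⁻ xs, h j (flipAt j τ) xs ∂(P (flipAt j τ)) =
        ∑ τ, ∫⁻ xs, h j τ xs ∂(P τ) :=
      Equiv.sum_comp (flipAt_involutive j).toPerm fun τ => ∫⁻ xs, h j τ xs ∂(P τ)
    rw [two_mul]
    nth_rw 2 [← hflip]
    rw [← Finset.sum_add_distrib, ← nsmul_eq_mul, ← Finset.card_univ, ← Finset.sum_const]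
    exact Finset.sum_le_sum fun τ _ => hpair j τ
  have hsum : Fintype.card (J → Bool) * (Fintype.card J * (ENNReal.ofReal α / 8)) ≤
      Fintype.card (J → Bool) * (2 * ⨆ τ, R τ) := by
    calc (Fintype.card (J → Bool) : ℝ≥0∞) * (Fintype.card J * (ENNReal.ofReal α / 8))
        = ∑ _j : J, Fintype.card (J → Bool) * (ENNReal.ofReal α / 8) := by
          rw [Finset.sum_const, Finset.card_univ, nsmul_eq_mul]; ring
      _ ≤ ∑ j, 2 * ∑ τ, ∫⁻ xs, h j τ xs ∂(P τ) := Finset.sum_le_sum fun j _ => hj j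
      _ = 2 * ∑ τ, ∑ j, ∫⁻ xs, h j τ xs ∂(P τ) := by
          rw [← Finset.mul_sum, Finset.sum_comm]
      _ ≤ 2 * ∑ τ : J → Bool, ⨆ σ, R σ := by
          gcongr with τ
          exact (hR τ).trans (le_iSup R τ)
      _ = _ := by
          rw [Finset.sum_const, Finset.card_univ, nsmul_eq_mul]; ring
  rw [ENNReal.mul_le_mul_iff_right (by simp) (by simp)] at hsum
  rw [← ENNReal.mul_le_mul_iff_right (a := 2) (by simp) (by simp)]
  refine le_trans (le_of_eq ?_) hsum
  rw [div_eq_mul_inv, div_eq_mul_inv, show (16 : ℝ≥0∞) = 2 * 8 by norm_num,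
    ENNReal.mul_inv (by simp) (by simp)]
  calc (2 : ℝ≥0∞) * (Fintype.card J * (ENNReal.ofReal α * (2⁻¹ * 8⁻¹)))
      = (2 * 2⁻¹) * (Fintype.card J * (ENNReal.ofReal α * 8⁻¹)) := by ring
    _ = _ := by rw [ENNReal.mul_inv_cancel (by simp) (by simp), one_mul]

/-- Resolution at which a hypercube of perturbations is undetectable from `n` observations. -/
theorem exists_resolution {p s : ℕ} (hp : 1 ≤ p) {C : ℝ} (hC : 0 < C) :
    ∃ b : ℝ, 0 < b ∧ ∀ n : ℕ, 1 ≤ n → ∃ m : ℕ, 1 ≤ m ∧ n * (C / (m : ℝ) ^ p) ≤ 1 / 2 ∧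
      b * (n : ℝ) ^ (-((s : ℝ) / p)) ≤ 1 / (m : ℝ) ^ s := by
  have hp' : (p : ℝ) ≠ 0 := by positivity
  set M : ℝ := (2 * C) ^ ((1 : ℝ) / p) + 1
  have hM : 0 < M := by positivity
  refine ⟨1 / M ^ s, by positivity, fun n hn => ?_⟩
  have hn1 : (1 : ℝ) ≤ n := by exact_mod_cast hn
  have hn0 : (0 : ℝ) < n := by linarith
  set L : ℝ := (2 * C * n) ^ ((1 : ℝ) / p) with hL
  have hL0 : 0 < L := by positivity
  have hLp : L ^ p = 2 * C * n := by
    rw [hL, ← Real.rpow_natCast, ← Real.rpow_mul (by positivity), one_div_mul_cancel hp',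
      Real.rpow_one]
  have hm1 : 1 ≤ ⌈L⌉₊ := Nat.one_le_iff_ne_zero.2 (Nat.ceil_pos.2 hL0).ne'
  have hm0 : (0 : ℝ) < ⌈L⌉₊ := by exact_mod_cast hm1
  refine ⟨⌈L⌉₊, hm1, ?_, ?_⟩
  · rw [← mul_div_assoc, div_le_iff₀ (by positivity)]
    have : L ^ p ≤ (⌈L⌉₊ : ℝ) ^ p := pow_le_pow_left₀ hL0.le (Nat.le_ceil L) p
    linarith
  · have hmM : (⌈L⌉₊ : ℝ) ≤ M * (n : ℝ) ^ ((1 : ℝ) / p) := by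
      have h1 : L = (2 * C) ^ ((1 : ℝ) / p) * (n : ℝ) ^ ((1 : ℝ) / p) :=
        Real.mul_rpow (by positivity) hn0.le
      have h2 : (1 : ℝ) ≤ (n : ℝ) ^ ((1 : ℝ) / p) := Real.one_le_rpow hn1 (by positivity)
      have h3 := (Nat.ceil_lt_add_one hL0.le).le
      simp only [M]
      nlinarith
    have h4 : (⌈L⌉₊ : ℝ) ^ s ≤ M ^ s * (n : ℝ) ^ ((s : ℝ) / p) := by
      refine (pow_le_pow_left₀ hm0.le hmM s).trans (le_of_eq ?_)
      rw [mul_pow, ← Real.rpow_natCast ((n : ℝ) ^ ((1 : ℝ) / p)), ← Real.rpow_mul hn0.le]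
      congr 2
      ring
    rw [Real.rpow_neg hn0.le, one_div, ← mul_inv, ← one_div]
    exact one_div_le_one_div_of_le (by positivity) h4

/-- Minimax lower bound from hypercubes of log-concave densities at every resolution `m`, with
`m ^ k` cells carrying a squared Hellinger separation of order `m ^ (-(k + s))` each. -/
theorem minimax_lower_bound_of_hypercubes {E : Type*} [MeasureSpace E] [TopologicalSpace E]
    [AddCommGroup E] [Module ℝ E] [SigmaFinite (volume : Measure E)] {k s : ℕ} (hk : 1 ≤ k)
    {a C : ℝ} (ha : 0 < a) (hC : 0 < C)
    (H : ∀ m : ℕ, 1 ≤ m → ∃ (f : ((Fin k → Fin m) → Bool) → E → ℝ) (A : (Fin k → Fin m) → Set E),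
      (∀ τ, IsLCDensity (f τ)) ∧ (∀ j, MeasurableSet (A j)) ∧
      Pairwise (Function.onFun Disjoint A) ∧
      (∀ τ j, ∀ x ∉ A j, f (flipAt j τ) x = f τ x) ∧
      (∀ τ j, ENNReal.ofReal (a / (m : ℝ) ^ (k + s)) ≤
        ∫⁻ x in A j, ENNReal.ofReal ((√(f τ x) - √(f (flipAt j τ) x)) ^ 2)) ∧
      (∀ τ j, ∫⁻ x in A j, ENNReal.ofReal ((√(f τ x) - √(f (flipAt j τ) x)) ^ 2) ≤
        ENNReal.ofReal (C / (m : ℝ) ^ (k + s)))) :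
    ∃ c : ℝ, 0 < c ∧ ∀ n : ℕ, 1 ≤ n → ∀ T : (Fin n → E) → E → ℝ,
      Measurable (Function.uncurry T) → (∀ xs, IsDensity (T xs)) →
      ENNReal.ofReal (c * (n : ℝ) ^ (-((s : ℝ) / (k + s : ℕ)))) ≤
        ⨆ (f₀ : E → ℝ) (_ : IsLCDensity f₀), ∫⁻ xs, ENNReal.ofReal (hellingerSq (T xs) f₀)
          ∂(Measure.pi fun _ : Fin n => volume.withDensity fun x => ENNReal.ofReal (f₀ x)) := by
  obtain ⟨b, hb, hres⟩ := exists_resolution (p := k + s) (s := s) (by omega) hC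
  refine ⟨a / 16 * b, by positivity, fun n hn T hT hTd => ?_⟩
  obtain ⟨m, hm, hnm, hbm⟩ := hres n hn
  obtain ⟨f, A, hf, hA, hdisj, hoff, hlow, hup⟩ := H m hm
  have hm0 : (0 : ℝ) < m := by exact_mod_cast hm
  refine le_trans ?_ ((assouad_hellinger (fun τ => (hf τ).1) hA hdisj hoff (by positivity) hlow hup
    hn hnm hT hTd).trans (iSup_le fun τ => le_iSup₂_of_le (f τ) (hf τ) le_rfl))
  rw [show (16 : ℝ≥0∞) = ENNReal.ofReal 16 by norm_num, ← ENNReal.ofReal_div_of_pos (by norm_num),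
    ← ENNReal.ofReal_natCast, ← ENNReal.ofReal_mul (by positivity)]
  apply ENNReal.ofReal_le_ofReal
  rw [mul_assoc]
  refine (mul_le_mul_of_nonneg_left hbm (by positivity)).trans (le_of_eq ?_)
  simp only [Fintype.card_fun, Fintype.card_fin, pow_add]
  push_cast
  field_simp

section LogConcave

variable {E : Type*} [AddCommGroup E] [Module ℝ E]

theorem isLogConcaveFn_indicator {S : Set E} {g : E → ℝ} (hg : ConcaveOn ℝ S g)
    (hg0 : ∀ x ∈ S, 0 ≤ g x) : IsLogConcaveFn (S.indicator g) := by
  have hnn : ∀ x, 0 ≤ S.indicator g x := fun x => indicator_nonneg hg0 x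
  refine ⟨hnn, fun x y t ht => ?_⟩
  obtain ⟨ht0, ht1⟩ := ht
  rcases eq_or_lt_of_le ht0 with rfl | ht0'
  · simp
  rcases eq_or_lt_of_le ht1 with rfl | ht1'
  · simp
  by_cases hx : x ∈ S
  · by_cases hy : y ∈ S
    · have hxy : (1 - t) • x + t • y ∈ S := hg.1 hx hy (by linarith) ht0 (by ring)
      rw [indicator_of_mem hx, indicator_of_mem hy, indicator_of_mem hxy]
      exact (Real.geom_mean_le_arith_mean2_weighted (by linarith) ht0 (hg0 x hx) (hg0 y hy)
        (by ring)).trans (hg.2 hx hy (by linarith) ht0 (by ring))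
    · rw [indicator_of_notMem hy, Real.zero_rpow ht0'.ne', mul_zero]
      exact hnn _
  · rw [indicator_of_notMem hx, Real.zero_rpow (by linarith), zero_mul]
    exact hnn _

theorem upperSemicontinuous_indicator_of_continuous {X : Type*} [TopologicalSpace X] {S : Set X}
    (hS : IsClosed S) {g : X → ℝ} (hg : Continuous g) (hg0 : ∀ x ∈ S, 0 ≤ g x) :
    UpperSemicontinuous (S.indicator g) := by
  intro x y hxy
  by_cases hx : x ∈ S
  · rw [indicator_of_mem hx] at hxy
    have hy : 0 < y := (hg0 x hx).trans_lt hxy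
    filter_upwards [hg.continuousAt.eventually_lt_const hxy] with z hz
    by_cases hzS : z ∈ S
    · rwa [indicator_of_mem hzS]
    · rwa [indicator_of_notMem hzS]
  · rw [indicator_of_notMem hx] at hxy
    filter_upwards [hS.isOpen_compl.mem_nhds hx] with z hz
    rwa [indicator_of_notMem hz]

theorem isLCDensity_indicator [TopologicalSpace E] [MeasureSpace E] [OpensMeasurableSpace E]
    {S : Set E} (hS : IsClosed S) {g : E → ℝ} (hg : Continuous g) (hgc : ConcaveOn ℝ S g)
    (hg0 : ∀ x ∈ S, 0 ≤ g x) (hg1 : ∫⁻ x in S, ENNReal.ofReal (g x) = 1) :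
    IsLCDensity (S.indicator g) := by
  refine ⟨⟨fun x => indicator_nonneg hg0 x, hg.measurable.indicator hS.measurableSet, ?_⟩,
    upperSemicontinuous_indicator_of_continuous hS hg hg0, isLogConcaveFn_indicator hgc hg0⟩
  rw [← hg1, ← lintegral_indicator hS.measurableSet]
  refine lintegral_congr fun x => ?_
  by_cases hx : x ∈ S <;> simp [hx]

end LogConcave

section Bump

variable {F : Type*} [NormedAddCommGroup F]

/-- The depth by which the cap of radius `r` at `c` is cut from the graph of `-‖·‖ ^ 2` by a
translated tangent hyperplane. -/
def capDepth (r : ℝ) (c x : F) : ℝ := max 0 (r ^ 2 - ‖x - c‖ ^ 2)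

theorem capDepth_nonneg (r : ℝ) (c x : F) : 0 ≤ capDepth r c x := le_max_left _ _

theorem capDepth_le (r : ℝ) (c x : F) : capDepth r c x ≤ r ^ 2 :=
  max_le (sq_nonneg r) (by nlinarith [sq_nonneg ‖x - c‖])

theorem capDepth_eq_zero {r : ℝ} (hr : 0 ≤ r) {c x : F} (hx : x ∉ Metric.ball c r) :
    capDepth r c x = 0 := by
  rw [Metric.mem_ball, not_lt, dist_eq_norm] at hx
  exact max_eq_left (by nlinarith)

theorem le_capDepth_of_mem_half_ball {r : ℝ} {c x : F} (hx : x ∈ Metric.ball c (r / 2)) :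
    3 / 4 * r ^ 2 ≤ capDepth r c x := by
  rw [Metric.mem_ball, dist_eq_norm] at hx
  exact le_max_of_le_right (by nlinarith [norm_nonneg (x - c)])

@[fun_prop]
theorem continuous_capDepth (r : ℝ) (c : F) : Continuous (capDepth r c) := by
  unfold capDepth
  fun_prop

/-- The concave paraboloid `K - ‖·‖ ^ 2` with the caps at `c j` of radius `r` cut off. -/
def cappedParaboloid {J : Type*} [Fintype J] (K r : ℝ) (c : J → F) (x : F) : ℝ :=
  K - ‖x‖ ^ 2 - ∑ j, capDepth r (c j) x

@[fun_prop]
theorem continuous_cappedParaboloid {J : Type*} [Fintype J] (K r : ℝ) (c : J → F) :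
    Continuous (cappedParaboloid K r c) := by
  unfold cappedParaboloid
  fun_prop

theorem sum_capDepth_eq {J : Type*} [Fintype J] {r : ℝ} (hr : 0 ≤ r) {c : J → F}
    (hc : Pairwise (Function.onFun Disjoint fun j => Metric.ball (c j) r)) {j : J} {x : F}
    (hx : x ∈ Metric.ball (c j) r) : ∑ i, capDepth r (c i) x = capDepth r (c j) x :=
  Fintype.sum_eq_single j fun _ hij =>
    capDepth_eq_zero hr fun hi => Set.disjoint_left.1 (hc hij) hi hx

theorem sum_capDepth_le {J : Type*} [Fintype J] {r : ℝ} (hr : 0 ≤ r) {c : J → F}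
    (hc : Pairwise (Function.onFun Disjoint fun j => Metric.ball (c j) r)) (x : F) :
    ∑ i, capDepth r (c i) x ≤ r ^ 2 := by
  by_cases h : ∃ j, x ∈ Metric.ball (c j) r
  · obtain ⟨j, hj⟩ := h
    rw [sum_capDepth_eq hr hc hj]
    exact capDepth_le _ _ _
  · push Not at h
    rw [Finset.sum_eq_zero fun i _ => capDepth_eq_zero hr (h i)]
    positivity

theorem concaveOn_cappedParaboloid [InnerProductSpace ℝ F] {J : Type*} [Fintype J] (K : ℝ) {r : ℝ}
    (hr : 0 ≤ r) {c : J → F}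
    (hc : Pairwise (Function.onFun Disjoint fun j => Metric.ball (c j) r)) :
    ConcaveOn ℝ univ (cappedParaboloid K r c) := by
  have hsum0 : ∀ x, 0 ≤ ∑ i, capDepth r (c i) x := fun x =>
    Finset.sum_nonneg fun i _ => capDepth_nonneg _ _ _
  refine ⟨convex_univ, fun x _ y _ a b ha hb hab => ?_⟩
  simp only [smul_eq_mul]
  by_cases h : ∃ j, a • x + b • y ∈ Metric.ball (c j) r
  · obtain ⟨j, hj⟩ := h
    have haff : ∀ z : F, cappedParaboloid K r c z ≤
        K - r ^ 2 + ‖c j‖ ^ 2 - 2 * inner ℝ z (c j) := by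
      intro z
      have h1 : capDepth r (c j) z ≤ ∑ i, capDepth r (c i) z :=
        Finset.single_le_sum (fun i _ => capDepth_nonneg r (c i) z) (Finset.mem_univ j)
      have h2 : r ^ 2 - ‖z - c j‖ ^ 2 ≤ capDepth r (c j) z := le_max_right _ _
      have h3 := norm_sub_sq_real z (c j)
      simp only [cappedParaboloid]
      linarith
    have hz : cappedParaboloid K r c (a • x + b • y) =
        K - r ^ 2 + ‖c j‖ ^ 2 - 2 * inner ℝ (a • x + b • y) (c j) := by
      have h3 := norm_sub_sq_real (a • x + b • y) (c j)
      have h4 : 0 ≤ r ^ 2 - ‖a • x + b • y - c j‖ ^ 2 := by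
        rw [Metric.mem_ball, dist_eq_norm] at hj
        nlinarith [norm_nonneg (a • x + b • y - c j)]
      simp only [cappedParaboloid]
      rw [sum_capDepth_eq hr hc hj, capDepth, max_eq_right h4]
      linarith
    rw [hz, inner_add_left, real_inner_smul_left, real_inner_smul_left]
    have hx := mul_le_mul_of_nonneg_left (haff x) ha
    have hy := mul_le_mul_of_nonneg_left (haff y) hb
    obtain rfl : b = 1 - a := by linarith
    linarith
  · push Not at h
    have hz : cappedParaboloid K r c (a • x + b • y) = K - ‖a • x + b • y‖ ^ 2 := by
      simp only [cappedParaboloid]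
      rw [Finset.sum_eq_zero fun i _ => capDepth_eq_zero hr (h i), sub_zero]
    have hx := mul_le_mul_of_nonneg_left (hsum0 x) ha
    have hy := mul_le_mul_of_nonneg_left (hsum0 y) hb
    have hconv : ‖a • x + b • y‖ ^ 2 ≤ a * ‖x‖ ^ 2 + b * ‖y‖ ^ 2 := by
      have := ((convexOn_norm (convex_univ (E := F) (𝕜 := ℝ))).pow (fun _ _ => norm_nonneg _) 2).2
        (mem_univ x) (mem_univ y) ha hb hab
      simpa using this
    rw [hz]
    simp only [cappedParaboloid]
    obtain rfl : b = 1 - a := by linarith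
    linarith

/-- Switching the side on which cell `j` is capped exchanges the two cap depths. -/
theorem cappedParaboloid_sub_flipAt {J : Type*} [Fintype J] [DecidableEq J] (K r : ℝ)
    (c : J → Bool → F) (τ : J → Bool) (j : J) (x : F) :
    cappedParaboloid K r (fun i => c i (τ i)) x -
      cappedParaboloid K r (fun i => c i (flipAt j τ i)) x =
        capDepth r (c j (!τ j)) x - capDepth r (c j (τ j)) x := by
  have h : ∀ σ : J → Bool, ∑ i, capDepth r (c i (σ i)) x =
      capDepth r (c j (σ j)) x + ∑ i ∈ Finset.univ.erase j, capDepth r (c i (σ i)) x :=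
    fun σ => (Finset.add_sum_erase _ _ (Finset.mem_univ j)).symm
  have h' : ∑ i ∈ Finset.univ.erase j, capDepth r (c i (flipAt j τ i)) x =
      ∑ i ∈ Finset.univ.erase j, capDepth r (c i (τ i)) x :=
    Finset.sum_congr rfl fun i hi => by
      rw [flipAt, Function.update_of_ne (Finset.ne_of_mem_erase hi)]
  simp only [cappedParaboloid]
  rw [h (flipAt j τ), h τ, h', flipAt, Function.update_self]
  ring

end Bump

section Grid

variable {k m : ℕ}

/-- The unit cube of `ℝ^k`. -/
def unitCube (k : ℕ) : Set (Rd k) := {x | ∀ i, x i ∈ Icc (0 : ℝ) 1}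

theorem unitCube_eq_preimage (k : ℕ) :
    unitCube k = WithLp.ofLp ⁻¹' (univ.pi fun _ => Icc (0 : ℝ) 1) := by
  ext x
  simp [unitCube, Pi.le_def, forall_and]

theorem isCompact_unitCube (k : ℕ) : IsCompact (unitCube k) := by
  rw [unitCube_eq_preimage]
  exact (PiLp.homeomorph 2 fun _ : Fin k => ℝ).isCompact_preimage.2
    (isCompact_univ_pi fun _ => isCompact_Icc)

theorem convex_unitCube (k : ℕ) : Convex ℝ (unitCube k) := by
  intro x hx y hy a b ha hb hab i
  simpa using convex_Icc (0 : ℝ) 1 (hx i) (hy i) ha hb hab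

theorem volume_unitCube (k : ℕ) : volume (unitCube k) = 1 := by
  rw [unitCube_eq_preimage, (PiLp.volume_preserving_ofLp (Fin k)).measure_preimage
    (MeasurableSet.univ_pi fun _ => measurableSet_Icc).nullMeasurableSet, volume_pi_pi]
  simp

theorem norm_sq_le_of_mem_unitCube {x : Rd k} (hx : x ∈ unitCube k) : ‖x‖ ^ 2 ≤ k := by
  rw [EuclideanSpace.norm_sq_eq]
  calc ∑ i, ‖x i‖ ^ 2 ≤ ∑ _i : Fin k, (1 : ℝ) := by
        refine Finset.sum_le_sum fun i _ => ?_
        rw [Real.norm_eq_abs, sq_abs]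
        nlinarith [(hx i).1, (hx i).2]
    _ = k := by simp

theorem abs_apply_le_norm (x : Rd k) (i : Fin k) : |x i| ≤ ‖x‖ := by
  simpa using PiLp.norm_apply_le x i

/-- Centers of `2 m ^ k` disjoint balls of radius `1 / (4 m)` in the unit cube, two per cell. -/
def gridCenter (j : Fin k → Fin m) (b : Bool) : Rd k :=
  WithLp.toLp 2 fun i => (4 * (j i : ℝ) + 1 + bif b then 2 else 0) * (1 / (4 * (m : ℝ)))

theorem disjoint_ball_gridCenter (hk : 1 ≤ k) (hm : 1 ≤ m) {j j' : Fin k → Fin m} {b b' : Bool}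
    (h : j ≠ j' ∨ b ≠ b') :
    Disjoint (Metric.ball (gridCenter j b) (1 / (4 * (m : ℝ))))
      (Metric.ball (gridCenter j' b') (1 / (4 * (m : ℝ)))) := by
  have hr : 0 < 1 / (4 * (m : ℝ)) := by
    have : (0 : ℝ) < m := by exact_mod_cast hm
    positivity
  apply Metric.ball_disjoint_ball
  rw [dist_eq_norm]
  suffices ∃ i, 2 ≤ |4 * ((j i : ℕ) : ℝ) + (bif b then 2 else 0) -
      (4 * ((j' i : ℕ) : ℝ) + bif b' then 2 else 0)| by
    obtain ⟨i, hi⟩ := this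
    refine le_trans ?_ (abs_apply_le_norm _ i)
    have : (gridCenter j b - gridCenter j' b') i = (4 * ((j i : ℕ) : ℝ) + (bif b then 2 else 0) -
      (4 * ((j' i : ℕ) : ℝ) + bif b' then 2 else 0)) * (1 / (4 * (m : ℝ))) := by
      simp only [gridCenter, PiLp.sub_apply]
      ring
    rw [this, abs_mul, abs_of_pos hr]
    nlinarith
  by_cases hj : j = j'
  · subst hj
    refine ⟨⟨0, hk⟩, ?_⟩
    cases b <;> cases b' <;> simp_all
  · obtain ⟨i, hi⟩ := Function.ne_iff.1 hj
    refine ⟨i, ?_⟩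
    rcases lt_or_gt_of_ne (Fin.val_ne_of_ne hi) with h' | h'
    · have : ((j i : ℕ) : ℝ) + 1 ≤ (j' i : ℕ) := by exact_mod_cast h'
      rw [abs_sub_comm]
      refine le_trans ?_ (le_abs_self _)
      cases b <;> cases b' <;> simp <;> linarith
    · have : ((j' i : ℕ) : ℝ) + 1 ≤ (j i : ℕ) := by exact_mod_cast h'
      refine le_trans ?_ (le_abs_self _)
      cases b <;> cases b' <;> simp <;> linarith

theorem ball_gridCenter_subset (hm : 1 ≤ m) (j : Fin k → Fin m) (b : Bool) :
    Metric.ball (gridCenter j b) (1 / (4 * (m : ℝ))) ⊆ unitCube k := by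
  intro x hx i
  have hm0 : (0 : ℝ) < m := by exact_mod_cast hm
  set r := 1 / (4 * (m : ℝ)) with hr
  have hr0 : 0 < r := by positivity
  have hmr : 4 * (m : ℝ) * r = 1 := by rw [hr]; field_simp
  rw [Metric.mem_ball, dist_eq_norm] at hx
  have h1 := (abs_apply_le_norm _ i).trans_lt hx
  rw [PiLp.sub_apply, abs_lt] at h1
  simp only [gridCenter] at h1
  rw [← hr] at h1
  have hj0 : (0 : ℝ) ≤ (j i : ℕ) := by positivity
  have hj1 : ((j i : ℕ) : ℝ) + 1 ≤ m := by exact_mod_cast (j i).2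
  have h2 : (((j i : ℕ) : ℝ) + 1) * r ≤ m * r := by gcongr
  have h3 : 0 ≤ ((j i : ℕ) : ℝ) * r := by positivity
  cases b
  · simp only [cond_false, add_zero] at h1
    constructor <;> nlinarith
  · simp only [cond_true] at h1
    constructor <;> nlinarith

/-- The part of the cube on which the perturbation indexed by `j` lives. -/
def gridCell (j : Fin k → Fin m) : Set (Rd k) :=
  ⋃ b, Metric.ball (gridCenter j b) (1 / (4 * (m : ℝ)))

theorem measurableSet_gridCell (j : Fin k → Fin m) : MeasurableSet (gridCell j) :=
  MeasurableSet.iUnion fun _ => measurableSet_ball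

theorem pairwise_disjoint_gridCell (hk : 1 ≤ k) (hm : 1 ≤ m) :
    Pairwise (Function.onFun Disjoint (gridCell : (Fin k → Fin m) → Set (Rd k))) := by
  intro j j' hj
  simp only [Function.onFun, gridCell, disjoint_iUnion_left, disjoint_iUnion_right]
  exact fun _ _ => disjoint_ball_gridCenter hk hm (Or.inl hj)

theorem gridCell_subset (hm : 1 ≤ m) (j : Fin k → Fin m) : gridCell j ⊆ unitCube k :=
  iUnion_subset fun b => ball_gridCenter_subset hm j b

theorem setLIntegral_gridCell_bounds (hk : 1 ≤ k) (hm : 1 ≤ m) (j : Fin k → Fin m)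
    {Φ : Rd k → ℝ≥0∞} {lo hi : ℝ} (hlo0 : 0 ≤ lo) (hhi0 : 0 ≤ hi)
    (hlo : ∀ x ∈ Metric.ball (gridCenter j false) (1 / (4 * (m : ℝ)) / 2), ENNReal.ofReal lo ≤ Φ x)
    (hhi : ∀ x ∈ gridCell j, Φ x ≤ ENNReal.ofReal hi) :
    ENNReal.ofReal (lo * volume.real (Metric.ball (0 : Rd k) 1) / (8 * m : ℝ) ^ k) ≤
      ∫⁻ x in gridCell j, Φ x ∧
    ∫⁻ x in gridCell j, Φ x ≤
      ENNReal.ofReal (hi * (2 * volume.real (Metric.ball (0 : Rd k) 1)) / (4 * m : ℝ) ^ k) := by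
  have hm0 : (0 : ℝ) < m := by exact_mod_cast hm
  have : Nonempty (Fin k) := ⟨⟨0, hk⟩⟩
  set v := volume.real (Metric.ball (0 : Rd k) 1) with hv
  have hv0 : 0 ≤ v := measureReal_nonneg
  have hball : ∀ (c : Rd k) {r : ℝ}, 0 ≤ r →
      volume (Metric.ball c r) = ENNReal.ofReal (r ^ k * v) := by
    intro c r hr
    rw [Measure.addHaar_ball _ _ hr, finrank_euclideanSpace_fin,
      ENNReal.ofReal_mul (by positivity), hv, ofReal_measureReal (measure_ball_lt_top.ne)]
  constructor
  · have hsub : Metric.ball (gridCenter j false) (1 / (4 * (m : ℝ)) / 2) ⊆ gridCell j :=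
      (Metric.ball_subset_ball (by have : 0 < 1 / (4 * (m : ℝ)) := by positivity
                                   linarith)).trans
        (subset_iUnion (fun b => Metric.ball (gridCenter j b) (1 / (4 * (m : ℝ)))) false)
    refine le_trans ?_ (lintegral_mono_set hsub)
    refine le_trans (le_of_eq ?_) (setLIntegral_mono' measurableSet_ball hlo)
    rw [setLIntegral_const, hball _ (by positivity), ← ENNReal.ofReal_mul hlo0]
    congr 1
    rw [show 1 / (4 * (m : ℝ)) / 2 = 1 / (8 * m) by field_simp; norm_num, one_div_pow]
    ring
  · refine (setLIntegral_mono' (measurableSet_gridCell j) hhi).trans ?_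
    rw [setLIntegral_const]
    have hvol : volume (gridCell j) ≤ ENNReal.ofReal (2 * ((1 / (4 * (m : ℝ))) ^ k * v)) := by
      refine (measure_iUnion_le _).trans (le_of_eq ?_)
      rw [tsum_fintype, Fintype.sum_bool, hball _ (by positivity), hball _ (by positivity),
        ← ENNReal.ofReal_add (by positivity) (by positivity)]
      congr 1
      ring
    refine (mul_le_mul_right hvol _).trans (le_of_eq ?_)
    rw [← ENNReal.ofReal_mul hhi0, one_div_pow]
    congr 1
    ring

/-- The hypercube of capped paraboloids at resolution `m`: in each cell `j` the bit `τ j` selects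
which of two caps is cut. -/
def gridParaboloid (τ : (Fin k → Fin m) → Bool) : Rd k → ℝ :=
  cappedParaboloid (k + 2) (1 / (4 * (m : ℝ))) fun j => gridCenter j (τ j)

@[fun_prop]
theorem continuous_gridParaboloid (τ : (Fin k → Fin m) → Bool) :
    Continuous (gridParaboloid τ) :=
  continuous_cappedParaboloid _ _ _

theorem gridParaboloid_le (τ : (Fin k → Fin m) → Bool) (x : Rd k) :
    gridParaboloid τ x ≤ k + 2 := by
  have h := Finset.sum_nonneg fun (j : Fin k → Fin m) (_ : j ∈ Finset.univ) =>
    capDepth_nonneg (1 / (4 * (m : ℝ))) (gridCenter j (τ j)) x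
  simp only [gridParaboloid, cappedParaboloid]
  nlinarith [sq_nonneg ‖x‖]

theorem pairwise_disjoint_ball_gridCenter (hk : 1 ≤ k) (hm : 1 ≤ m)
    (τ : (Fin k → Fin m) → Bool) :
    Pairwise (Function.onFun Disjoint fun j =>
      Metric.ball (gridCenter j (τ j)) (1 / (4 * (m : ℝ)))) :=
  fun _ _ h => disjoint_ball_gridCenter hk hm (Or.inl h)

theorem sq_resolution_le_one (hm : 1 ≤ m) : (1 / (4 * (m : ℝ))) ^ 2 ≤ 1 := by
  have hm1 : (1 : ℝ) ≤ m := by exact_mod_cast hm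
  apply pow_le_one₀ (by positivity)
  rw [div_le_one (by positivity)]
  linarith

theorem one_le_gridParaboloid (hk : 1 ≤ k) (hm : 1 ≤ m) (τ : (Fin k → Fin m) → Bool) {x : Rd k}
    (hx : x ∈ unitCube k) : 1 ≤ gridParaboloid τ x := by
  have h1 := sum_capDepth_le (by positivity) (pairwise_disjoint_ball_gridCenter hk hm τ) x
  have h2 := norm_sq_le_of_mem_unitCube hx
  have h3 := sq_resolution_le_one hm
  simp only [gridParaboloid, cappedParaboloid]
  linarith

theorem concaveOn_gridParaboloid (hk : 1 ≤ k) (hm : 1 ≤ m) (τ : (Fin k → Fin m) → Bool) :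
    ConcaveOn ℝ (unitCube k) (gridParaboloid τ) :=
  (concaveOn_cappedParaboloid _ (by positivity)
    (pairwise_disjoint_ball_gridCenter hk hm τ)).subset (subset_univ _) (convex_unitCube k)

theorem gridParaboloid_flipAt_of_notMem (τ : (Fin k → Fin m) → Bool) {j : Fin k → Fin m}
    {x : Rd k} (hx : x ∉ gridCell j) : gridParaboloid (flipAt j τ) x = gridParaboloid τ x := by
  have h := cappedParaboloid_sub_flipAt (k + 2) (1 / (4 * (m : ℝ)))
    (gridCenter : (Fin k → Fin m) → Bool → Rd k) τ j x
  simp only [gridCell, mem_iUnion, not_exists] at hx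
  rw [capDepth_eq_zero (by positivity) (hx _), capDepth_eq_zero (by positivity) (hx _)] at h
  simp only [gridParaboloid]
  linarith

theorem abs_gridParaboloid_sub_flipAt_le (τ : (Fin k → Fin m) → Bool) (j : Fin k → Fin m)
    (x : Rd k) :
    |gridParaboloid τ x - gridParaboloid (flipAt j τ) x| ≤ (1 / (4 * (m : ℝ))) ^ 2 := by
  simp only [gridParaboloid]
  rw [cappedParaboloid_sub_flipAt, abs_le]
  constructor <;>
  linarith [capDepth_nonneg (1 / (4 * (m : ℝ))) (gridCenter j (!τ j)) x,
    capDepth_nonneg (1 / (4 * (m : ℝ))) (gridCenter j (τ j)) x,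
    capDepth_le (1 / (4 * (m : ℝ))) (gridCenter j (!τ j)) x,
    capDepth_le (1 / (4 * (m : ℝ))) (gridCenter j (τ j)) x]

theorem le_abs_gridParaboloid_sub_flipAt (hk : 1 ≤ k) (hm : 1 ≤ m) (τ : (Fin k → Fin m) → Bool)
    (j : Fin k → Fin m) {x : Rd k}
    (hx : x ∈ Metric.ball (gridCenter j false) (1 / (4 * (m : ℝ)) / 2)) :
    3 / 4 * (1 / (4 * (m : ℝ))) ^ 2 ≤
      |gridParaboloid τ x - gridParaboloid (flipAt j τ) x| := by
  have hm0 : (0 : ℝ) < m := by exact_mod_cast hm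
  have hr : 0 < 1 / (4 * (m : ℝ)) := by positivity
  have h1 := le_capDepth_of_mem_half_ball hx
  have h2 : capDepth (1 / (4 * (m : ℝ))) (gridCenter j true) x = 0 :=
    capDepth_eq_zero hr.le fun h => Set.disjoint_left.1
      (disjoint_ball_gridCenter hk hm (Or.inr (by simp))) h
      (Metric.ball_subset_ball (by linarith) hx)
  simp only [gridParaboloid]
  rw [cappedParaboloid_sub_flipAt]
  cases τ j
  · simp only [Bool.not_false]
    rw [h2, zero_sub, abs_neg]
    exact h1.trans (le_abs_self _)
  · simp only [Bool.not_true]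
    rw [h2, sub_zero]
    exact h1.trans (le_abs_self _)

theorem exists_gridParaboloid_mass (hk : 1 ≤ k) (hm : 1 ≤ m) :
    ∃ Z : ℝ, 1 ≤ Z ∧ Z ≤ k + 2 ∧ ∀ τ : (Fin k → Fin m) → Bool,
      ∫⁻ x in unitCube k, ENNReal.ofReal (gridParaboloid τ x) = ENNReal.ofReal Z := by
  have hQ := (isCompact_unitCube k).measurableSet
  have hint : ∀ {g : Rd k → ℝ}, Continuous g → IntegrableOn g (unitCube k) := fun hg =>
    hg.continuousOn.integrableOn_compact (isCompact_unitCube k)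
  have hvol : volume.real (unitCube k) = 1 := by simp [measureReal_def, volume_unitCube]
  have hcap : ∀ (j : Fin k → Fin m) b,
      ∫ x in unitCube k, capDepth (1 / (4 * (m : ℝ))) (gridCenter j b) x =
        ∫ x : Rd k, capDepth (1 / (4 * (m : ℝ))) 0 x := by
    intro j b
    rw [setIntegral_eq_integral_of_forall_compl_eq_zero fun x hx => capDepth_eq_zero
      (by positivity) fun h => hx (ball_gridCenter_subset hm j b h)]
    rw [← integral_sub_right_eq_self (fun x => capDepth (1 / (4 * (m : ℝ))) 0 x) (gridCenter j b)]
    simp [capDepth]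
  have hZ : ∀ τ : (Fin k → Fin m) → Bool, ∫ x in unitCube k, gridParaboloid τ x =
      (∫ x in unitCube k, ((k : ℝ) + 2 - ‖x‖ ^ 2)) -
        ∑ _j : Fin k → Fin m, ∫ x : Rd k, capDepth (1 / (4 * (m : ℝ))) 0 x := by
    intro τ
    simp only [gridParaboloid, cappedParaboloid]
    rw [integral_sub (hint (by fun_prop)) (hint (by fun_prop)),
      integral_finsetSum _ fun j _ => hint (by fun_prop)]
    simp only [hcap]
  refine ⟨∫ x in unitCube k, gridParaboloid (fun _ : Fin k → Fin m => false) x, ?_, ?_,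
    fun τ => ?_⟩
  · calc (1 : ℝ) = ∫ x in unitCube k, (1 : ℝ) := by simp [hvol]
      _ ≤ _ := setIntegral_mono_on (hint (by fun_prop)) (hint (by fun_prop)) hQ
        fun x hx => one_le_gridParaboloid hk hm _ hx
  · calc _ ≤ ∫ x in unitCube k, ((k : ℝ) + 2) :=
        setIntegral_mono_on (hint (by fun_prop)) (hint (by fun_prop)) hQ
          fun x _ => gridParaboloid_le _ x
      _ = _ := by simp [hvol]
  · rw [hZ, ← hZ τ, ofReal_integral_eq_lintegral_ofReal (hint (by fun_prop))]
    filter_upwards [ae_restrict_mem hQ] with x hx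
    exact zero_le_one.trans (one_le_gridParaboloid hk hm τ hx)

end Grid

theorem sq_sqrt_sub_sqrt_le {u w δ : ℝ} (hδ : 0 < δ) (hu : δ ≤ u) (hw : δ ≤ w) :
    (√u - √w) ^ 2 ≤ (u - w) ^ 2 / δ := by
  have hu0 : 0 ≤ u := hδ.le.trans hu
  have hw0 : 0 ≤ w := hδ.le.trans hw
  have h1 : δ ≤ (√u + √w) ^ 2 := by
    nlinarith [Real.sq_sqrt hu0, Real.sq_sqrt hw0, mul_nonneg (Real.sqrt_nonneg u)
      (Real.sqrt_nonneg w)]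
  have h2 : (u - w) ^ 2 = (√u - √w) ^ 2 * (√u + √w) ^ 2 := by
    rw [← mul_pow]
    congr 1
    nlinarith [Real.sq_sqrt hu0, Real.sq_sqrt hw0]
  rw [le_div_iff₀ hδ, h2]
  exact mul_le_mul_of_nonneg_left h1 (sq_nonneg _)

theorem le_sq_sqrt_sub_sqrt {u w M : ℝ} (hM : 0 < M) (hu0 : 0 ≤ u) (hw0 : 0 ≤ w) (hu : u ≤ M)
    (hw : w ≤ M) : (u - w) ^ 2 / (4 * M) ≤ (√u - √w) ^ 2 := by
  have h1 : (√u + √w) ^ 2 ≤ 4 * M := by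
    nlinarith [Real.sq_sqrt hu0, Real.sq_sqrt hw0, sq_nonneg (√u - √w)]
  have h2 : (u - w) ^ 2 = (√u - √w) ^ 2 * (√u + √w) ^ 2 := by
    rw [← mul_pow]
    congr 1
    nlinarith [Real.sq_sqrt hu0, Real.sq_sqrt hw0]
  rw [div_le_iff₀ (by positivity), h2]
  exact mul_le_mul_of_nonneg_left h1 (sq_nonneg _)

/-- Lower bound over densities that are concave on the unit cube. -/
theorem minimax_lower_bound_concave_density {k : ℕ} (hk : 1 ≤ k) :
    ∃ c : ℝ, 0 < c ∧ ∀ n : ℕ, 1 ≤ n → ∀ T : (Fin n → Rd k) → Rd k → ℝ,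
      Measurable (Function.uncurry T) → (∀ xs, IsDensity (T xs)) →
      ENNReal.ofReal (c * (n : ℝ) ^ (-(((4 : ℕ) : ℝ) / (k + 4 : ℕ)))) ≤
        ⨆ (f₀ : Rd k → ℝ) (_ : IsLCDensity f₀), ∫⁻ xs, ENNReal.ofReal (hellingerSq (T xs) f₀)
          ∂(Measure.pi fun _ : Fin n => volume.withDensity fun x => ENNReal.ofReal (f₀ x)) := by
  have hv : 0 < volume.real (Metric.ball (0 : Rd k) 1) :=
    ENNReal.toReal_pos (Metric.measure_ball_pos _ _ one_pos).ne' measure_ball_lt_top.ne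
  set v := volume.real (Metric.ball (0 : Rd k) 1) with hv'
  refine minimax_lower_bound_of_hypercubes hk
    (a := (3 / 4 * (1 / 4) ^ 2 / (k + 2)) ^ 2 / (4 * (k + 2)) * v / 8 ^ k)
    (C := ((1 / 4) ^ 2) ^ 2 * (k + 2) * (2 * v) / 4 ^ k) (by positivity) (by positivity)
    fun m hm => ?_
  have hm0 : (0 : ℝ) < m := by exact_mod_cast hm
  obtain ⟨Z, hZ1, hZk, hZ⟩ := exists_gridParaboloid_mass hk hm
  have hZ0 : 0 < Z := by linarith
  have hdiff : ∀ (τ : (Fin k → Fin m) → Bool) j x,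
      (gridParaboloid τ x / Z - gridParaboloid (flipAt j τ) x / Z) ^ 2 =
        |gridParaboloid τ x - gridParaboloid (flipAt j τ) x| ^ 2 / Z ^ 2 := fun τ j x => by
    rw [← sub_div, div_pow, sq_abs]
  have hpos : ∀ (τ : (Fin k → Fin m) → Bool) {x}, x ∈ unitCube k → 0 ≤ gridParaboloid τ x / Z :=
    fun τ x hx => div_nonneg (zero_le_one.trans (one_le_gridParaboloid hk hm τ hx)) hZ0.le
  have hbounds : ∀ (τ : (Fin k → Fin m) → Bool) (j : Fin k → Fin m), _ ∧ _ := fun τ j =>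
    setLIntegral_gridCell_bounds hk hm j
      (Φ := fun x => ENNReal.ofReal
        ((√((unitCube k).indicator (fun x => gridParaboloid τ x / Z) x) -
          √((unitCube k).indicator (fun x => gridParaboloid (flipAt j τ) x / Z) x)) ^ 2))
      (lo := (3 / 4 * (1 / (4 * (m : ℝ))) ^ 2 / (k + 2)) ^ 2 / (4 * (k + 2)))
      (hi := ((1 / (4 * (m : ℝ))) ^ 2) ^ 2 * (k + 2)) (by positivity) (by positivity) (by
        intro x hx
        have hxQ : x ∈ unitCube k := ball_gridCenter_subset hm j false
          (Metric.ball_subset_ball (half_le_self (by positivity)) hx)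
        have hle : ∀ σ : (Fin k → Fin m) → Bool, gridParaboloid σ x / Z ≤ k + 2 := fun σ =>
          (div_le_self (zero_le_one.trans (one_le_gridParaboloid hk hm σ hxQ)) hZ1).trans
            (gridParaboloid_le σ x)
        rw [indicator_of_mem hxQ, indicator_of_mem hxQ]
        refine ENNReal.ofReal_le_ofReal (le_trans ?_ (le_sq_sqrt_sub_sqrt (M := (k : ℝ) + 2)
          (by positivity) (hpos τ hxQ) (hpos _ hxQ) (hle τ) (hle _)))
        rw [hdiff, ← div_pow]
        gcongr
        exact le_abs_gridParaboloid_sub_flipAt hk hm τ j hx) (by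
        intro x hx
        have hxQ : x ∈ unitCube k := gridCell_subset hm j hx
        have hge : ∀ σ : (Fin k → Fin m) → Bool, 1 / ((k : ℝ) + 2) ≤ gridParaboloid σ x / Z :=
          fun σ => div_le_div₀ (zero_le_one.trans (one_le_gridParaboloid hk hm σ hxQ))
            (one_le_gridParaboloid hk hm σ hxQ) hZ0 hZk
        rw [indicator_of_mem hxQ, indicator_of_mem hxQ]
        refine ENNReal.ofReal_le_ofReal ((sq_sqrt_sub_sqrt_le (by positivity) (hge τ)
          (hge _)).trans ?_)
        rw [hdiff, div_div_eq_mul_div, div_one]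
        gcongr
        exact (div_le_self (by positivity) (one_le_pow₀ hZ1)).trans
          (pow_le_pow_left₀ (abs_nonneg _) (abs_gridParaboloid_sub_flipAt_le τ j x) 2))
  refine ⟨fun τ => (unitCube k).indicator fun x => gridParaboloid τ x / Z, gridCell, fun τ => ?_,
    measurableSet_gridCell, pairwise_disjoint_gridCell hk hm, fun τ j x hx => ?_, fun τ j => ?_,
    fun τ j => ?_⟩
  · refine isLCDensity_indicator (isCompact_unitCube k).isClosed (by fun_prop) ?_
      (fun x hx => hpos τ hx) ?_
    · simpa only [div_eq_inv_mul, smul_eq_mul] using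
        (concaveOn_gridParaboloid hk hm τ).smul (inv_nonneg.2 hZ0.le)
    · simp_rw [ENNReal.ofReal_div_of_pos hZ0, div_eq_mul_inv]
      rw [lintegral_mul_const _ (by fun_prop), hZ,
        ENNReal.mul_inv_cancel (by simpa using hZ0) (by simp)]
  · dsimp only
    by_cases hxQ : x ∈ unitCube k
    · rw [indicator_of_mem hxQ, indicator_of_mem hxQ, gridParaboloid_flipAt_of_notMem τ hx]
    · rw [indicator_of_notMem hxQ, indicator_of_notMem hxQ]
  · refine le_trans (le_of_eq ?_) (hbounds τ j).1
    congr 1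
    rw [← hv', mul_pow, pow_add]
    field_simp
  · refine (hbounds τ j).2.trans (le_of_eq ?_)
    congr 1
    rw [← hv', mul_pow, pow_add]
    field_simp

theorem lintegral_euclidean_succ {k : ℕ} {F : Rd (k + 1) → ℝ≥0∞} (hF : Measurable F) :
    ∫⁻ x, F x = ∫⁻ y : Rd k, ∫⁻ t : ℝ, F (WithLp.toLp 2 (Fin.cons t y.ofLp)) := by
  have hG : Measurable fun y : Fin k → ℝ => ∫⁻ t : ℝ, F (WithLp.toLp 2 (Fin.cons t y)) := by
    refine Measurable.lintegral_prod_right'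
      (f := fun z : (Fin k → ℝ) × ℝ => F (WithLp.toLp 2 (Fin.cons z.2 z.1))) ?_
    refine hF.comp ((WithLp.measurable_toLp 2 _).comp ?_)
    exact measurable_pi_lambda _ fun i => Fin.cases (by simpa using measurable_snd)
      (fun i => by simpa [Function.comp_def] using (measurable_pi_apply i).comp measurable_fst) i
  rw [(PiLp.volume_preserving_ofLp (Fin k)).lintegral_comp hG,
    ← (PiLp.volume_preserving_toLp (Fin (k + 1))).lintegral_comp hF,
    ← ((volume_preserving_piFinSuccAbove (fun _ : Fin (k + 1) => ℝ) 0).symm).lintegral_comp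
      (by fun_prop), Measure.volume_eq_prod, lintegral_prod_symm _ (by fun_prop)]
  simp [MeasurableEquiv.piFinSuccAbove_symm_apply, Fin.insertNthEquiv]

/-- Forget the first coordinate. -/
def tailVec {k : ℕ} (x : Rd (k + 1)) : Rd k := WithLp.toLp 2 fun i => x i.succ

@[fun_prop]
theorem continuous_tailVec {k : ℕ} : Continuous (tailVec : Rd (k + 1) → Rd k) := by
  unfold tailVec
  fun_prop

theorem tailVec_toLp_cons {k : ℕ} (t : ℝ) (y : Rd k) :
    tailVec (WithLp.toLp 2 (Fin.cons t y.ofLp)) = y := by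
  ext i
  simp [tailVec]

theorem tailVec_smul_add_smul {k : ℕ} (a b : ℝ) (x y : Rd (k + 1)) :
    tailVec (a • x + b • y) = a • tailVec x + b • tailVec y := by
  ext i
  simp [tailVec]

/-- The region between `0` and the graph of `g` over the unit cube. -/
def hypograph {k : ℕ} (g : Rd k → ℝ) : Set (Rd (k + 1)) :=
  {x | tailVec x ∈ unitCube k ∧ x 0 ∈ Icc 0 (g (tailVec x))}

theorem isClosed_hypograph {k : ℕ} {g : Rd k → ℝ} (hg : Continuous g) :
    IsClosed (hypograph g) := by
  refine ((isCompact_unitCube k).isClosed.preimage continuous_tailVec).inter ?_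
  exact (isClosed_le (f := fun _ : Rd (k + 1) => (0 : ℝ)) (g := fun x => x 0) (by fun_prop)
    (by fun_prop)).inter (isClosed_le (f := fun x : Rd (k + 1) => x 0)
      (g := fun x => g (tailVec x)) (by fun_prop) (by fun_prop))

theorem convex_hypograph {k : ℕ} {g : Rd k → ℝ} (hg : ConcaveOn ℝ (unitCube k) g) :
    Convex ℝ (hypograph g) := by
  intro x ⟨hx, hx0, hx1⟩ y ⟨hy, hy0, hy1⟩ a b ha hb hab
  simp only [hypograph, mem_ofPred_eq, tailVec_smul_add_smul, PiLp.add_apply, PiLp.smul_apply,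
    smul_eq_mul]
  refine ⟨hg.1 hx hy ha hb hab, by positivity, ?_⟩
  have := hg.2 hx hy ha hb hab
  simp only [smul_eq_mul] at this
  nlinarith

theorem toLp_cons_mem_hypograph {k : ℕ} {g : Rd k → ℝ} {t : ℝ} {y : Rd k} :
    WithLp.toLp 2 (Fin.cons t y.ofLp) ∈ hypograph g ↔ y ∈ unitCube k ∧ t ∈ Icc 0 (g y) := by
  simp [hypograph, tailVec_toLp_cons]

theorem indicator_hypograph_toLp_cons {M : Type*} [Zero M] {k : ℕ} {g : Rd k → ℝ} {y : Rd k}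
    (hy : y ∈ unitCube k) (z : M) (t : ℝ) :
    (hypograph g).indicator (fun _ => z) (WithLp.toLp 2 (Fin.cons t y.ofLp)) =
      (Icc 0 (g y)).indicator (fun _ => z) t := by
  by_cases ht : t ∈ Icc 0 (g y)
  · rw [indicator_of_mem (toLp_cons_mem_hypograph.2 ⟨hy, ht⟩), indicator_of_mem ht]
  · rw [indicator_of_notMem fun h => ht (toLp_cons_mem_hypograph.1 h).2, indicator_of_notMem ht]

theorem indicator_hypograph_congr {M : Type*} [Zero M] {k : ℕ} {g h : Rd k → ℝ} {x : Rd (k + 1)}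
    (hx : g (tailVec x) = h (tailVec x)) (z : M) :
    (hypograph g).indicator (fun _ => z) x = (hypograph h).indicator (fun _ => z) x := by
  have : x ∈ hypograph g ↔ x ∈ hypograph h := by simp only [hypograph, mem_ofPred_eq, hx]
  by_cases hxh : x ∈ hypograph h
  · rw [indicator_of_mem (this.2 hxh), indicator_of_mem hxh]
  · rw [indicator_of_notMem (mt this.1 hxh), indicator_of_notMem hxh]

theorem volume_hypograph {k : ℕ} {g : Rd k → ℝ} (hg : Continuous g) :
    volume (hypograph g) = ∫⁻ y in unitCube k, ENNReal.ofReal (g y) := by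
  rw [← lintegral_indicator_one (isClosed_hypograph hg).measurableSet, lintegral_euclidean_succ
    (measurable_one.indicator (isClosed_hypograph hg).measurableSet),
    ← lintegral_indicator (isCompact_unitCube k).measurableSet]
  refine lintegral_congr fun y => ?_
  by_cases hy : y ∈ unitCube k
  · have : (fun t : ℝ => (hypograph g).indicator (1 : Rd (k + 1) → ℝ≥0∞)
        (WithLp.toLp 2 (Fin.cons t y.ofLp))) = (Icc 0 (g y)).indicator 1 :=
      funext fun t => indicator_hypograph_toLp_cons hy 1 t
    rw [this, lintegral_indicator_one measurableSet_Icc, indicator_of_mem hy, Real.volume_Icc,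
      sub_zero]
  · simp [toLp_cons_mem_hypograph, hy]

theorem lintegral_sq_sqrt_indicator_Icc_sub {u w z : ℝ} (hu : 0 ≤ u) (hw : 0 ≤ w) (hz : 0 ≤ z) :
    ∫⁻ t, ENNReal.ofReal ((√((Icc 0 u).indicator (fun _ => z) t) -
      √((Icc 0 w).indicator (fun _ => z) t)) ^ 2) = ENNReal.ofReal (z * |u - w|) := by
  wlog huw : u ≤ w generalizing u w
  · rw [abs_sub_comm, ← this hw hu (by linarith)]
    refine lintegral_congr fun t => ?_
    congr 1
    ring
  have : (fun t => ENNReal.ofReal ((√((Icc 0 u).indicator (fun _ => z) t) -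
      √((Icc 0 w).indicator (fun _ => z) t)) ^ 2)) =
        (Ioc u w).indicator fun _ => ENNReal.ofReal z := by
    ext t
    by_cases h0 : 0 ≤ t
    · by_cases h1 : t ≤ u
      · have : t ≤ w := h1.trans huw
        simp [h0, h1, this]
      · have : u < t := not_le.1 h1
        by_cases h2 : t ≤ w <;> simp [h1, h2, this, h0, Real.sq_sqrt hz]
    · have : ¬ u < t := by linarith
      simp [h0, this]
  rw [this, lintegral_indicator_const measurableSet_Ioc, Real.volume_Ioc,
    ← ENNReal.ofReal_mul hz, abs_sub_comm, abs_of_nonneg (by linarith)]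

theorem setLIntegral_sq_sqrt_hypograph_sub {k : ℕ} {g h : Rd k → ℝ} (hg : Continuous g)
    (hh : Continuous h) {A : Set (Rd k)} (hA : MeasurableSet A) (hAQ : A ⊆ unitCube k)
    (hg0 : ∀ y ∈ unitCube k, 0 ≤ g y) (hh0 : ∀ y ∈ unitCube k, 0 ≤ h y) {z : ℝ} (hz : 0 ≤ z) :
    ∫⁻ x in tailVec ⁻¹' A, ENNReal.ofReal ((√((hypograph g).indicator (fun _ => z) x) -
      √((hypograph h).indicator (fun _ => z) x)) ^ 2) =
        ∫⁻ y in A, ENNReal.ofReal (z * |g y - h y|) := by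
  have hA' := continuous_tailVec.measurable hA
  have hgm : Measurable ((hypograph g).indicator fun _ => z) :=
    measurable_const.indicator (isClosed_hypograph hg).measurableSet
  have hhm : Measurable ((hypograph h).indicator fun _ => z) :=
    measurable_const.indicator (isClosed_hypograph hh).measurableSet
  rw [← lintegral_indicator hA', lintegral_euclidean_succ (Measurable.indicator
    (by fun_prop) hA'), ← lintegral_indicator hA]
  refine lintegral_congr fun y => ?_
  by_cases hy : y ∈ A
  · rw [indicator_of_mem hy, ← lintegral_sq_sqrt_indicator_Icc_sub (hg0 y (hAQ hy))
      (hh0 y (hAQ hy)) hz]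
    refine lintegral_congr fun t => ?_
    have hyA : WithLp.toLp 2 (Fin.cons t y.ofLp) ∈ tailVec ⁻¹' A := by
      rwa [mem_preimage, tailVec_toLp_cons]
    rw [indicator_of_mem hyA, indicator_hypograph_toLp_cons (hAQ hy),
      indicator_hypograph_toLp_cons (hAQ hy)]
  · rw [indicator_of_notMem hy, ← lintegral_zero (μ := (volume : Measure ℝ))]
    refine lintegral_congr fun t => indicator_of_notMem ?_ _
    rwa [mem_preimage, tailVec_toLp_cons]

/-- Lower bound over uniform densities on convex bodies. -/
theorem minimax_lower_bound_uniform_density {k : ℕ} (hk : 1 ≤ k) :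
    ∃ c : ℝ, 0 < c ∧ ∀ n : ℕ, 1 ≤ n → ∀ T : (Fin n → Rd (k + 1)) → Rd (k + 1) → ℝ,
      Measurable (Function.uncurry T) → (∀ xs, IsDensity (T xs)) →
      ENNReal.ofReal (c * (n : ℝ) ^ (-(((2 : ℕ) : ℝ) / (k + 2 : ℕ)))) ≤
        ⨆ (f₀ : Rd (k + 1) → ℝ) (_ : IsLCDensity f₀),
          ∫⁻ xs, ENNReal.ofReal (hellingerSq (T xs) f₀)
            ∂(Measure.pi fun _ : Fin n => volume.withDensity fun x => ENNReal.ofReal (f₀ x)) := by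
  have hv : 0 < volume.real (Metric.ball (0 : Rd k) 1) :=
    ENNReal.toReal_pos (Metric.measure_ball_pos _ _ one_pos).ne' measure_ball_lt_top.ne
  set v := volume.real (Metric.ball (0 : Rd k) 1) with hv'
  refine minimax_lower_bound_of_hypercubes hk
    (a := 1 / ((k : ℝ) + 2) * (3 / 4 * (1 / 4) ^ 2) * v / 8 ^ k)
    (C := (1 / 4) ^ 2 * (2 * v) / 4 ^ k) (by positivity) (by positivity)
    fun m hm => ?_
  have hm0 : (0 : ℝ) < m := by exact_mod_cast hm
  obtain ⟨Z, hZ1, hZk, hZ⟩ := exists_gridParaboloid_mass hk hm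
  have hZ0 : 0 < Z := by linarith
  have hgpos : ∀ (τ : (Fin k → Fin m) → Bool) {x}, x ∈ unitCube k → 0 ≤ gridParaboloid τ x :=
    fun τ x hx => zero_le_one.trans (one_le_gridParaboloid hk hm τ hx)
  set f : ((Fin k → Fin m) → Bool) → Rd (k + 1) → ℝ := fun τ =>
    (hypograph (gridParaboloid τ)).indicator fun _ => 1 / Z with hf
  have hcell : ∀ (τ : (Fin k → Fin m) → Bool) (j : Fin k → Fin m),
      ∫⁻ x in tailVec ⁻¹' gridCell j, ENNReal.ofReal ((√(f τ x) - √(f (flipAt j τ) x)) ^ 2) =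
        ∫⁻ y in gridCell j, ENNReal.ofReal
          (1 / Z * |gridParaboloid τ y - gridParaboloid (flipAt j τ) y|) :=
    fun τ j => setLIntegral_sq_sqrt_hypograph_sub (continuous_gridParaboloid τ)
      (continuous_gridParaboloid _) (measurableSet_gridCell j) (gridCell_subset hm j)
      (fun _ => hgpos τ) (fun _ => hgpos _) (by positivity)
  have hbounds : ∀ (τ : (Fin k → Fin m) → Bool) (j : Fin k → Fin m), _ ∧ _ := fun τ j =>
    setLIntegral_gridCell_bounds hk hm j
      (Φ := fun y => ENNReal.ofReal
        (1 / Z * |gridParaboloid τ y - gridParaboloid (flipAt j τ) y|))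
      (lo := 1 / ((k : ℝ) + 2) * (3 / 4 * (1 / (4 * (m : ℝ))) ^ 2))
      (hi := (1 / (4 * (m : ℝ))) ^ 2) (by positivity) (by positivity) (by
        intro x hx
        apply ENNReal.ofReal_le_ofReal
        gcongr
        exact le_abs_gridParaboloid_sub_flipAt hk hm τ j hx) (by
        intro x hx
        apply ENNReal.ofReal_le_ofReal
        refine le_trans ?_ (abs_gridParaboloid_sub_flipAt_le τ j x)
        exact mul_le_of_le_one_left (abs_nonneg _) ((div_le_one hZ0).2 hZ1))
  refine ⟨f, fun j => tailVec ⁻¹' gridCell j, fun τ => ?_,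
    fun j => continuous_tailVec.measurable (measurableSet_gridCell j),
    fun i j hij => (pairwise_disjoint_gridCell hk hm hij).preimage _, fun τ j x hx => ?_,
    fun τ j => ?_, fun τ j => ?_⟩
  · refine isLCDensity_indicator (isClosed_hypograph (continuous_gridParaboloid τ))
      continuous_const (concaveOn_const _ (convex_hypograph (concaveOn_gridParaboloid hk hm τ)))
      (fun _ _ => by positivity) ?_
    rw [setLIntegral_const, volume_hypograph (continuous_gridParaboloid τ), hZ,
      ← ENNReal.ofReal_mul (by positivity), one_div_mul_cancel hZ0.ne', ENNReal.ofReal_one]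
  · exact indicator_hypograph_congr (gridParaboloid_flipAt_of_notMem τ hx) _
  · rw [hcell]
    refine le_trans (le_of_eq ?_) (hbounds τ j).1
    congr 1
    rw [← hv', mul_pow, pow_add]
    field_simp
  · rw [hcell]
    refine (hbounds τ j).2.trans (le_of_eq ?_)
    congr 1
    rw [← hv', mul_pow, pow_add]
    field_simp

/-- Minimax lower bound for log-concave density estimation in squared Hellinger risk:
rate `n^{-4/5}` when `d = 1` and `n^{-2/(d+1)}` when `d ≥ 2`. -/
theorem statement16 (d : ℕ) (hd : 1 ≤ d) :
    ∃ c : ℝ, 0 < c ∧ ∀ n : ℕ,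
      ∀ T : (Fin n → Rd d) → Rd d → ℝ,
        Measurable (Function.uncurry T) →
        (∀ xs : Fin n → Rd d, IsDensity (T xs)) →
        ENNReal.ofReal
            (c * (n : ℝ) ^ (if d = 1 then -(4/5 : ℝ) else -(2 / ((d : ℝ) + 1)))) ≤
          ⨆ (f₀ : Rd d → ℝ) (_ : IsLCDensity f₀),
            ∫⁻ xs, ENNReal.ofReal (hellingerSq (T xs) f₀)
              ∂(Measure.pi fun _ : Fin n =>
                  volume.withDensity fun x => ENNReal.ofReal (f₀ x)) := by
  obtain ⟨k, rfl⟩ : ∃ k, d = k + 1 := ⟨d - 1, by omega⟩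
  obtain ⟨c, hc, h⟩ : ∃ c : ℝ, 0 < c ∧ ∀ n : ℕ, 1 ≤ n →
      ∀ T : (Fin n → Rd (k + 1)) → Rd (k + 1) → ℝ,
        Measurable (Function.uncurry T) → (∀ xs, IsDensity (T xs)) →
        ENNReal.ofReal (c * (n : ℝ) ^
          (if k + 1 = 1 then -(4/5 : ℝ) else -(2 / (((k + 1 : ℕ) : ℝ) + 1)))) ≤
        ⨆ (f₀ : Rd (k + 1) → ℝ) (_ : IsLCDensity f₀),
          ∫⁻ xs, ENNReal.ofReal (hellingerSq (T xs) f₀)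
            ∂(Measure.pi fun _ : Fin n =>
              volume.withDensity fun x => ENNReal.ofReal (f₀ x)) := by
    rcases Nat.eq_zero_or_pos k with rfl | hk
    · simpa using minimax_lower_bound_concave_density (k := 1) le_rfl
    · have hexp : (if k + 1 = 1 then -(4/5 : ℝ) else -(2 / (((k + 1 : ℕ) : ℝ) + 1))) =
          -(((2 : ℕ) : ℝ) / (k + 2 : ℕ)) := by
        rw [if_neg (by omega)]
        push_cast
        ring
      rw [hexp]
      exact minimax_lower_bound_uniform_density hk
  refine ⟨c, hc, fun n T hT hTd => ?_⟩
  rcases Nat.eq_zero_or_pos n with rfl | hn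
  · have hexp : (if k + 1 = 1 then -(4/5 : ℝ) else -(2 / (((k + 1 : ℕ) : ℝ) + 1))) ≠ 0 := by
      split_ifs
      · norm_num
      · exact neg_ne_zero.2 (by positivity)
    rw [Nat.cast_zero, Real.zero_rpow hexp, mul_zero, ENNReal.ofReal_zero]
    exact bot_le
  · exact h n hn T hT hTd
end
end
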